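/- Let l be a prime with l ∉ {2,3,7} and l ≡ 6 (mod 7). Then the number of distinct roots of Ĥ_{7,l}(x) in 𝔽_l (equivalently, the number of distinct monic linear factors of Ĥ_{7,l}(x) over 𝔽_l) equals 3·h(−l) if l ≡ 1 (mod 4), and equals 3·(3 − χ(2))·h(−l) if l ≡ 3 (mod 4), where χ denotes the Legendre symbol modulo l. -/

import Mathlib

open Polynomial

/-- The Hasse invariant polynomial `Ĥ_{7,l}(x)` of the Tate normal form `E₇`
over `𝔽_l`. -/
noncomputable def hasseH7 (l : ℕ) [Fact (Nat.Prime l)] : Polynomial (ZMod l) :=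
  let r : ℕ := ((1 - legendreSym l (-3)) / 2).toNat
  let s : ℕ := ((1 - legendreSym l (-4)) / 2).toNat
  let n : ℕ := l / 12
  let A : Polynomial (ZMod l) :=
    (X ^ 2 - X + 1) ^ 3 *
      (X ^ 6 - 11 * X ^ 5 + 30 * X ^ 4 - 15 * X ^ 3 - 10 * X ^ 2 + 5 * X + 1) ^ 3
  let Δ : Polynomial (ZMod l) := X ^ 7 * (X - 1) ^ 7 * (X ^ 3 - 8 * X ^ 2 + 5 * X + 1)
  (X ^ 2 - X + 1) ^ r *
    (X ^ 6 - 11 * X ^ 5 + 30 * X ^ 4 - 15 * X ^ 3 - 10 * X ^ 2 + 5 * X + 1) ^ r *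
    (X ^ 12 - 18 * X ^ 11 + 117 * X ^ 10 - 354 * X ^ 9 + 570 * X ^ 8 - 486 * X ^ 7
        + 273 * X ^ 6 - 222 * X ^ 5 + 174 * X ^ 4 - 46 * X ^ 3 - 15 * X ^ 2 + 6 * X + 1) ^ s *
    ∑ k ∈ Finset.range (n + 1),
      C (((2 * n + s).choose (2 * k + s) : ZMod l) * ((2 * n - 2 * k).choose (n - k) : ZMod l)
          * (-432 : ZMod l) ^ (n - k)) *
        (A - 1728 * Δ) ^ k * Δ ^ (n - k)

namespace H7
open UpperHalfPlane hiding I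
open Complex
open scoped Manifold MatrixGroups ModularForm Topology
open Function.Periodic (qParam)

lemma hasSum_cg {ι : Type*} {f g : ι → ℂ} {a : ℂ} (h : HasSum f a) (hfg : ∀ n, g n = f n) :
    HasSum g a := by rwa [show g = f from funext hfg]

lemma mem_eball_iff {z : ℂ} : z ∈ Metric.eball (0:ℂ) 1 ↔ ‖z‖ < 1 := by
  have : ((1:NNReal) : ENNReal) = 1 := rfl
  rw [← this, Metric.eball_coe]; simp

/-- `f` has the (everywhere convergent) expansion `a` in `exp(2πiτ/N)`. -/
def HasExp (N : ℕ) (a : PowerSeries ℂ) (f : ℍ → ℂ) : Prop :=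
  ∀ τ : ℍ, HasSum (fun n => PowerSeries.coeff n a * qParam N τ ^ n) (f τ)

lemma HasExp.summable_norm {N a f} (h : HasExp N a f) (τ : ℍ) :
    Summable fun n => ‖PowerSeries.coeff n a * qParam N τ ^ n‖ :=
  (h τ).summable.norm

lemma HasExp.add {N a b f g} (hf : HasExp N a f) (hg : HasExp N b g) :
    HasExp N (a + b) (fun τ => f τ + g τ) := by
  intro τ
  have := (hf τ).add (hg τ)
  simpa [add_mul] using this

lemma HasExp.neg {N a f} (hf : HasExp N a f) : HasExp N (-a) (fun τ => - f τ) := by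
  intro τ
  have := (hf τ).neg
  simpa using this

lemma HasExp.sub {N a b f g} (hf : HasExp N a f) (hg : HasExp N b g) :
    HasExp N (a - b) (fun τ => f τ - g τ) := by
  simpa [sub_eq_add_neg] using hf.add hg.neg

lemma HasExp.mul {N a b f g} (hf : HasExp N a f) (hg : HasExp N b g) :
    HasExp N (a * b) (fun τ => f τ * g τ) := by
  intro τ
  have h1 := hf.summable_norm τ
  have h2 := hg.summable_norm τ
  have h3 := tsum_mul_tsum_eq_tsum_sum_antidiagonal_of_summable_norm h1 h2
  rw [(hf τ).tsum_eq, (hg τ).tsum_eq] at h3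
  have h4 := summable_norm_sum_mul_antidiagonal_of_summable_norm h1 h2
  have h5 := h4.of_norm.hasSum
  rw [← h3] at h5
  refine hasSum_cg (h5) ?_ 
  intro n
  rw [PowerSeries.coeff_mul, Finset.sum_mul]
  refine Finset.sum_congr rfl fun kl hkl => ?_
  have hkl := Finset.HasAntidiagonal.mem_antidiagonal.1 hkl
  rw [← hkl, pow_add]; ring

lemma HasExp.const (N : ℕ) (c : ℂ) : HasExp N (PowerSeries.C c) (fun _ => c) := by
  intro τ
  have := hasSum_single (f := fun n => PowerSeries.coeff n (PowerSeries.C c) * qParam N τ ^ n) 0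
    (fun n hn => by simp [PowerSeries.coeff_C, hn])
  simpa using this

lemma HasExp.one (N : ℕ) : HasExp N 1 (fun _ => 1) := by
  simpa using HasExp.const N 1

lemma HasExp.pow {N a f} (hf : HasExp N a f) (k : ℕ) : HasExp N (a ^ k) (fun τ => f τ ^ k) := by
  induction k with
  | zero => simpa using HasExp.one N
  | succ k ih => simpa [pow_succ] using ih.mul hf

lemma HasExp.prod {ι} {N} (s : Finset ι) (a : ι → PowerSeries ℂ) (f : ι → ℍ → ℂ)
    (h : ∀ i ∈ s, HasExp N (a i) (f i)) :
    HasExp N (∏ i ∈ s, a i) (fun τ => ∏ i ∈ s, f i τ) := by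
  classical
  induction s using Finset.induction_on with
  | empty => simpa using HasExp.one N
  | insert i s hi ih =>
    simp only [Finset.prod_insert hi]
    exact (h i (by simp)).mul (ih fun j hj => h j (by simp [hj]))

lemma HasExp.sum {ι} {N} (s : Finset ι) (a : ι → PowerSeries ℂ) (f : ι → ℍ → ℂ)
    (h : ∀ i ∈ s, HasExp N (a i) (f i)) :
    HasExp N (∑ i ∈ s, a i) (fun τ => ∑ i ∈ s, f i τ) := by
  classical
  induction s using Finset.induction_on with
  | empty => simpa using HasExp.const N 0
  | insert i s hi ih =>
    simp only [Finset.sum_insert hi]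
    exact (h i (by simp)).add (ih fun j hj => h j (by simp [hj]))

lemma HasExp.X (N : ℕ) : HasExp N PowerSeries.X (fun τ => qParam N τ) := by
  intro τ
  have := hasSum_single (f := fun n => PowerSeries.coeff n PowerSeries.X * qParam N τ ^ n) 1
    (fun n hn => by simp [PowerSeries.coeff_X, hn])
  simpa using this

lemma HasExp.congr {N a f g} (h : HasExp N a f) (hfg : ∀ τ, f τ = g τ) : HasExp N a g :=
  fun τ => hfg τ ▸ h τ

lemma HasExp.comp {N M : ℕ} {a f} (h : HasExp N a f) (σ : ℍ → ℍ) (c : ℂ) (k : ℕ) (hk : k ≠ 0)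
    (hσ : ∀ τ, qParam N (σ τ) = c * qParam M τ ^ k) :
    HasExp M (PowerSeries.expand k hk (PowerSeries.rescale c a)) (fun τ => f (σ τ)) := by
  intro τ
  have h1 := h (σ τ)
  have hinj : Function.Injective (fun n : ℕ => k * n) := fun x y h => Nat.eq_of_mul_eq_mul_left (Nat.pos_of_ne_zero hk) h
  rw [← hinj.hasSum_iff]
  · refine hasSum_cg (h1) ?_
    intro n
    simp only [Function.comp]
    rw [PowerSeries.coeff_expand, if_pos (Dvd.intro _ rfl),
      Nat.mul_div_cancel_left _ (Nat.pos_of_ne_zero hk), PowerSeries.coeff_rescale, hσ, mul_pow,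
      pow_mul]
    ring
  · intro n hn
    rw [PowerSeries.coeff_expand, if_neg, zero_mul]
    rintro ⟨m, rfl⟩
    exact hn ⟨m, rfl⟩

/-- The sum of the power series. -/
noncomputable def psum (a : PowerSeries ℂ) (z : ℂ) : ℂ := ∑' n, PowerSeries.coeff n a * z ^ n

lemma exists_qParam {N : ℕ} (hN : 0 < N) {z : ℂ} (hz : z ≠ 0) (hz1 : ‖z‖ < 1) :
    ∃ τ : ℍ, qParam N τ = z := by
  refine ⟨⟨Function.Periodic.invQParam N z, ?_⟩, ?_⟩
  · exact Function.Periodic.im_invQParam_pos_of_norm_lt_one (by exact_mod_cast hN) hz1 hz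
  · exact Function.Periodic.qParam_right_inv (by exact_mod_cast hN.ne') hz

lemma HasExp.hasSum_psum {N : ℕ} (hN : 0 < N) {a f} (h : HasExp N a f) {z : ℂ} (hz : ‖z‖ < 1) :
    HasSum (fun n => PowerSeries.coeff n a * z ^ n) (psum a z) := by
  by_cases h0 : z = 0
  · subst h0
    have := hasSum_single (f := fun n => PowerSeries.coeff n a * (0:ℂ) ^ n) 0
      (fun n hn => by simp [hn])
    exact this.summable.hasSum
  · obtain ⟨τ, hτ⟩ := exists_qParam hN h0 hz
    have := (h τ).summable
    rw [hτ] at this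
    exact this.hasSum

lemma HasExp.eq_psum {N : ℕ} {a f} (h : HasExp N a f) (τ : ℍ) : f τ = psum a (qParam N τ) :=
  ((h τ).tsum_eq).symm

lemma psum_zero (a : PowerSeries ℂ) : psum a 0 = PowerSeries.coeff 0 a := by
  unfold psum
  rw [tsum_eq_single 0 (fun n hn => by simp [hn])]; simp

lemma hasFPS_of_hasSum {c : ℕ → ℂ} {G : ℂ → ℂ}
    (h : ∀ z : ℂ, ‖z‖ < 1 → HasSum (fun n => c n * z ^ n) (G z)) :
    HasFPowerSeriesOnBall G (FormalMultilinearSeries.ofScalars ℂ c) 0 1 := by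
  refine ⟨?_, by norm_num, ?_⟩
  · refine ENNReal.le_of_forall_nnreal_lt fun r hr => ?_
    apply FormalMultilinearSeries.le_radius_of_summable_norm
    have hr1 : ‖((r : ℝ) : ℂ)‖ < 1 := by
      simp only [norm_real, NNReal.norm_eq]
      exact_mod_cast hr
    have := (h _ hr1).summable.norm
    refine this.congr ?_
    intro n
    simp
  · intro y hy
    have hy1 : ‖y‖ < 1 := by
      exact mem_eball_iff.1 hy
    simp only [zero_add]
    refine hasSum_cg ((h y hy1)) ?_
    intro n
    simp [mul_comm]

lemma HasExp.hasFPS {N : ℕ} (hN : 0 < N) {a f} (h : HasExp N a f) :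
    HasFPowerSeriesOnBall (psum a) (FormalMultilinearSeries.ofScalars ℂ
      (fun n => PowerSeries.coeff n a)) 0 1 :=
  hasFPS_of_hasSum fun _ hz => h.hasSum_psum hN hz

lemma HasExp.uniq {N : ℕ} (hN : 0 < N) {a b f} (ha : HasExp N a f) (hb : HasExp N b f) : a = b := by
  have h1 := (ha.hasFPS hN).hasFPowerSeriesAt
  have h2 := (hb.hasFPS hN).hasFPowerSeriesAt
  have heq : psum a =ᶠ[𝓝 0] psum b := by
    have hc1 := h1.analyticAt
    have hc2 := h2.analyticAt
    refine (hc1.frequently_eq_iff_eventually_eq hc2).1 ?_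
    apply Filter.Eventually.frequently
    have : Metric.ball (0:ℂ) 1 ∈ 𝓝 (0:ℂ) := Metric.ball_mem_nhds _ one_pos
    filter_upwards [nhdsWithin_le_nhds this, self_mem_nhdsWithin] with z hz hz0
    obtain ⟨τ, hτ⟩ := exists_qParam hN hz0 (by simpa using hz)
    rw [← hτ, ← ha.eq_psum, ← hb.eq_psum]
  have h3 := h1.eq_formalMultilinearSeries (h2.congr heq.symm)
  ext n
  have h4 := congrArg (fun p => FormalMultilinearSeries.coeff p n) h3
  simpa [FormalMultilinearSeries.coeff_ofScalars] using h4

lemma HasExp.inv {N : ℕ} (hN : 0 < N) {a f} (h : HasExp N a f) (hf : ∀ τ, f τ ≠ 0)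
    (h0 : PowerSeries.coeff 0 a ≠ 0) : HasExp N a⁻¹ (fun τ => (f τ)⁻¹) := by
  have hd : DifferentiableOn ℂ (fun z => (psum a z)⁻¹) (Metric.ball 0 1) := by
    apply DifferentiableOn.inv
    · have := (h.hasFPS hN).differentiableOn
      refine this.mono ?_
      intro z hz
      exact mem_eball_iff.2 (by simpa using hz)
    · intro z hz
      by_cases hz0 : z = 0
      · rw [hz0, psum_zero]; exact h0
      · obtain ⟨τ, hτ⟩ := exists_qParam hN hz0 (by simpa using hz)
        rw [← hτ, ← h.eq_psum]; exact hf τ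
  set c : ℕ → ℂ := fun n => (n.factorial : ℂ)⁻¹ * iteratedDeriv n (fun z => (psum a z)⁻¹) 0 with hc
  have hs : HasExp N (PowerSeries.mk c) (fun τ => (f τ)⁻¹) := by
    intro τ
    have hq : qParam N τ ∈ Metric.ball (0:ℂ) 1 := by
      simpa using Function.Periodic.norm_qParam_lt_one (by exact_mod_cast hN) τ.im_pos
    have := Complex.hasSum_taylorSeries_on_ball hd hq
    show HasSum _ (f τ)⁻¹
    rw [h.eq_psum]
    refine hasSum_cg (this) ?_
    intro n
    simp [hc]
    ring
  have hm := (h.mul hs).congr (g := fun _ => 1) (fun τ => mul_inv_cancel₀ (hf τ))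
  have h1 := hm.uniq hN (HasExp.one N)
  have : PowerSeries.mk c = a⁻¹ := by
    rw [PowerSeries.eq_inv_iff_mul_eq_one (by simpa using h0), mul_comm]; exact h1
  rw [← this]; exact hs

lemma HasExp.differentiableOn_psum {N : ℕ} (hN : 0 < N) {a f} (h : HasExp N a f) :
    DifferentiableOn ℂ (psum a) (Metric.ball 0 1) := by
  refine ((h.hasFPS hN).differentiableOn).mono ?_
  intro z hz
  exact mem_eball_iff.2 (by simpa using hz)

lemma HasExp.taylor {N : ℕ} (hN : 0 < N) {a f} (h : HasExp N a f) (n : ℕ) :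
    iteratedDeriv n (psum a) 0 = n.factorial * PowerSeries.coeff n a := by
  have h1 := hasFPS_of_hasSum (c := fun n => (n.factorial : ℂ)⁻¹ * iteratedDeriv n (psum a) 0)
    (G := psum a) (fun z hz => by
      have := Complex.hasSum_taylorSeries_on_ball (h.differentiableOn_psum hN)
        (show z ∈ Metric.ball (0:ℂ) 1 by simpa using hz)
      refine hasSum_cg this ?_
      intro n
      simp
      ring)
  have h3 := h1.hasFPowerSeriesAt.eq_formalMultilinearSeries (h.hasFPS hN).hasFPowerSeriesAt
  have h4 := congrArg (fun p => FormalMultilinearSeries.coeff p n) h3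
  simp only [FormalMultilinearSeries.coeff_ofScalars] at h4
  rw [← h4, mul_inv_cancel_left₀]
  exact_mod_cast n.factorial_ne_zero

lemma HasExp.deriv_psum {N : ℕ} (hN : 0 < N) {a f} (h : HasExp N a f) {z : ℂ} (hz : ‖z‖ < 1) :
    HasSum (fun n : ℕ => (n * PowerSeries.coeff n a) * z ^ n) (z * deriv (psum a) z) := by
  have hd : DifferentiableOn ℂ (deriv (psum a)) (Metric.ball 0 1) :=
    (h.differentiableOn_psum hN).deriv Metric.isOpen_ball
  have h1 := Complex.hasSum_taylorSeries_on_ball hd (show z ∈ Metric.ball (0:ℂ) 1 by simpa using hz)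
  have h2 := h1.mul_left z
  rw [← hasSum_nat_add_iff' 1]
  simp only [Finset.range_one, Finset.sum_singleton, Nat.cast_zero, zero_mul, sub_zero]
  refine hasSum_cg h2 ?_
  intro n
  rw [← iteratedDeriv_succ', h.taylor hN]
  simp only [sub_zero, smul_eq_mul, Nat.factorial_succ]
  have : (n.factorial : ℂ) ≠ 0 := by exact_mod_cast n.factorial_ne_zero
  push_cast
  field_simp
  ring

lemma norm_q_lt {N : ℕ} (hN : 0 < N) {z : ℂ} (hz : 0 < z.im) : ‖qParam N z‖ < 1 :=
  Function.Periodic.norm_qParam_lt_one (by exact_mod_cast hN) hz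

lemma HasExp.comp_ofComplex {N : ℕ} {a f} (h : HasExp N a f) {z : ℂ} (hz : 0 < z.im) :
    (f ∘ ofComplex) z = psum a (qParam N z) := by
  simp only [Function.comp]
  rw [h.eq_psum]
  congr 2
  rw [ofComplex_apply_of_im_pos hz]

lemma hasDerivAt_q (z : ℂ) : HasDerivAt (fun z => qParam (1:ℕ) z) (2 * Real.pi * I * qParam (1:ℕ) z) z := by
  have : (fun z => qParam (1:ℕ) z) = fun z => exp (2 * Real.pi * I * z) := by
    ext z; simp [Function.Periodic.qParam]
  rw [this]
  have := ((hasDerivAt_id z).const_mul (2 * Real.pi * I)).cexp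
  refine this.congr_deriv ?_
  simp [Function.Periodic.qParam]
  ring

lemma HasExp.hasDerivAt {a f} (h : HasExp 1 a f) {z : ℂ} (hz : 0 < z.im) :
    HasDerivAt (f ∘ ofComplex)
      (deriv (psum a) (qParam (1:ℕ) z) * (2 * Real.pi * I * qParam (1:ℕ) z)) z := by
  have hq := norm_q_lt one_pos hz
  have h1 : DifferentiableAt ℂ (psum a) (qParam (1:ℕ) z) :=
    (h.differentiableOn_psum one_pos).differentiableAt
      (Metric.isOpen_ball.mem_nhds (by simpa using hq))
  have h2 := h1.hasDerivAt.comp z (hasDerivAt_q z)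
  refine h2.congr_of_eventuallyEq ?_
  filter_upwards [(isOpen_lt continuous_const Complex.continuous_im).mem_nhds hz] with w hw
  exact h.comp_ofComplex hw

lemma HasExp.mdiff {a f} (h : HasExp 1 a f) : MDiff f := by
  rw [UpperHalfPlane.mdifferentiable_iff]
  intro z hz
  exact (h.hasDerivAt hz).differentiableAt.differentiableWithinAt

/-- formal `q d/dq` -/
noncomputable def thetaC (a : PowerSeries ℂ) : PowerSeries ℂ :=
  PowerSeries.mk fun n => n * PowerSeries.coeff n a

lemma HasExp.D {a f} (h : HasExp 1 a f) :
    HasExp 1 (thetaC a) (Derivative.normalizedDerivOfComplex f) := by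
  intro τ
  have h1 := (h.hasDerivAt τ.im_pos).deriv
  unfold Derivative.normalizedDerivOfComplex
  rw [h1]
  have h2 := h.deriv_psum one_pos (norm_q_lt one_pos τ.im_pos)
  have e : (2 * Real.pi * I)⁻¹ * (deriv (psum a) (qParam (1:ℕ) τ) *
    (2 * Real.pi * I * qParam (1:ℕ) τ)) = qParam (1:ℕ) τ * deriv (psum a) (qParam (1:ℕ) τ) := by
    have : (2 * Real.pi * I : ℂ) ≠ 0 := Complex.two_pi_I_ne_zero
    field_simp
  rw [e]
  refine hasSum_cg h2 ?_
  intro n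
  simp [thetaC]

lemma HasExp.bounded {a f} (h : HasExp 1 a f) : IsBoundedAtImInfty f := by
  refine isBoundedAtImInfty_of_hasSum_qExpansion (h := 1) (c := fun n => PowerSeries.coeff n a)
    one_pos ?_
  intro τ
  have := h τ
  simpa using this

lemma HasExp.bounded' {N : ℕ} (hN : 0 < N) {a f} (h : HasExp N a f) : IsBoundedAtImInfty f := by
  refine isBoundedAtImInfty_of_hasSum_qExpansion (h := N) (c := fun n => PowerSeries.coeff n a)
    (by exact_mod_cast hN) ?_
  intro τ
  have := h τ
  simpa using this

end H7

namespace H7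
open UpperHalfPlane hiding I
open Complex ModularForm
open scoped Manifold MatrixGroups ModularForm Topology
open Function.Periodic (qParam)

/-- Build a level one modular form. -/
noncomputable def mkForm (k : ℤ) (f : ℍ → ℂ) (hf : ∀ γ : SL(2, ℤ), f ∣[k] γ = f) (hd : MDiff f)
    (hb : IsBoundedAtImInfty f) : ModularForm 𝒮ℒ k where
  toFun := f
  slash_action_eq' := by
    rintro _ ⟨γ, rfl⟩
    exact hf γ
  holo' := hd
  bdd_at_cusps' := by
    intro c hc
    rw [OnePoint.isBoundedAt_iff_exists_SL2Z hc]
    rw [isCusp_SL2Z_iff'] at hc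
    obtain ⟨g, rfl⟩ := hc
    exact ⟨g, rfl, by rw [hf]; exact hb⟩

lemma HasExp.coeff_eq {a : PowerSeries ℂ} {f : ℍ → ℂ} (h : HasExp 1 a f) {b : PowerSeries ℂ}
    (hb : HasExp 1 b f) (n) : PowerSeries.coeff n a = PowerSeries.coeff n b := by
  rw [h.uniq one_pos hb]

lemma hasExp_form {k : ℤ} (f : ModularForm 𝒮ℒ k) : HasExp 1 (qExpansion 1 f) f := by
  intro τ
  have := ModularForm.hasSum_qExpansion f one_pos one_mem_strictPeriods_SL τ
  simpa using this

lemma form_zero_of_lt {k : ℤ} (hk : k < 12) (f : ℍ → ℂ) (hf : ∀ γ : SL(2, ℤ), f ∣[k] γ = f)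
    {a : PowerSeries ℂ} (h : HasExp 1 a f) (h0 : PowerSeries.coeff 0 a = 0) : f = 0 := by
  set F := mkForm k f hf h.mdiff h.bounded with hF
  have hFf : ⇑F = f := rfl
  have h1 := hasExp_form F
  rw [hFf] at h1
  have h2 : F = 0 := by
    apply sturm_bound_levelOne
    have : k.toNat / 12 = 0 := by omega
    rw [this, hFf, h1.uniq one_pos h]
    simp only [Nat.cast_zero]
    have h3 : (1 : ℕ∞) ≤ a.order := by
      refine PowerSeries.nat_le_order _ 1 ?_
      intro i hi
      obtain rfl : i = 0 := by omega
      exact h0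
    exact lt_of_lt_of_le (by norm_num) h3
  rw [← hFf, h2]; rfl

/-- integral expansions of `E₂`, `E₄`, `E₆`. -/
def e2Z : PowerSeries ℤ :=
  PowerSeries.mk fun n => if n = 0 then 1 else -24 * (ArithmeticFunction.sigma 1 n : ℤ)
def e4Z : PowerSeries ℤ :=
  PowerSeries.mk fun n => if n = 0 then 1 else 240 * (ArithmeticFunction.sigma 3 n : ℤ)
def e6Z : PowerSeries ℤ :=
  PowerSeries.mk fun n => if n = 0 then 1 else -504 * (ArithmeticFunction.sigma 5 n : ℤ)

noncomputable abbrev toC : PowerSeries ℤ →+* PowerSeries ℂ := PowerSeries.map (Int.castRingHom ℂ)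

@[simp] lemma cc_e2 : PowerSeries.constantCoeff (toC e2Z) = 1 := by
  rw [← PowerSeries.coeff_zero_eq_constantCoeff_apply, toC, PowerSeries.coeff_map]; simp [e2Z]
@[simp] lemma cc_e4 : PowerSeries.constantCoeff (toC e4Z) = 1 := by
  rw [← PowerSeries.coeff_zero_eq_constantCoeff_apply, toC, PowerSeries.coeff_map]; simp [e4Z]
@[simp] lemma cc_e6 : PowerSeries.constantCoeff (toC e6Z) = 1 := by
  rw [← PowerSeries.coeff_zero_eq_constantCoeff_apply, toC, PowerSeries.coeff_map]; simp [e6Z]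
@[simp] lemma cc_theta (a : PowerSeries ℂ) : PowerSeries.constantCoeff (thetaC a) = 0 := by
  rw [← PowerSeries.coeff_zero_eq_constantCoeff_apply]; simp [thetaC]

lemma hasExp_E2 : HasExp 1 (toC e2Z) EisensteinSeries.E2 := by
  intro τ
  refine hasSum_cg (EisensteinSeries.hasSum_qExpansion_E2 τ) ?_
  intro n
  simp only [e2Z, toC, PowerSeries.coeff_map, PowerSeries.coeff_mk, Function.Periodic.qParam]
  split_ifs <;> simp

lemma hasExp_E4 : HasExp 1 (toC e4Z) E₄ := by
  have h := hasExp_form E₄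
  convert h using 1
  ext n
  rw [EisensteinSeries.E_qExpansion_coeff _ ⟨2, rfl⟩]
  simp only [e4Z, toC, PowerSeries.coeff_map, PowerSeries.coeff_mk]
  split_ifs
  · simp
  · norm_num [show _root_.bernoulli 4 = -1 / 30 by decide +kernel]

lemma hasExp_E6 : HasExp 1 (toC e6Z) E₆ := by
  have h := hasExp_form E₆
  convert h using 1
  ext n
  rw [EisensteinSeries.E_qExpansion_coeff _ ⟨3, rfl⟩]
  simp only [e6Z, toC, PowerSeries.coeff_map, PowerSeries.coeff_mk]
  split_ifs
  · simp
  · norm_num [show _root_.bernoulli 6 = 1 / 42 by decide +kernel]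

open Derivative EisensteinSeries

lemma slash_form {k : ℤ} (f : ModularForm 𝒮ℒ k) (γ : SL(2, ℤ)) : (f : ℍ → ℂ) ∣[k] γ = f :=
  SlashInvariantFormClass.slash_action_eq f _ ⟨γ, rfl⟩

lemma slash_add' (k : ℤ) (f g : ℍ → ℂ) (γ : SL(2, ℤ)) (hf : f ∣[k] γ = f) (hg : g ∣[k] γ = g) (c : ℂ) :
    (f + c • g) ∣[k] γ = f + c • g := by
  rw [SlashAction.add_slash, ModularForm.SL_smul_slash, hf, hg]

lemma coe_mulE (τ : ℍ) : (E₄.mul E₄ : ModularForm 𝒮ℒ (4+4)) τ = E₄ τ * E₄ τ := rfl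

lemma ramanujan4 (τ : ℍ) : normalizedDerivOfComplex E₄ τ = (E2 τ * E₄ τ - E₆ τ) / 3 := by
  have h1 : ∀ γ : SL(2, ℤ), (serreDerivative (4:ℤ) E₄ + (1/3 : ℂ) • (E₆ : ℍ → ℂ)) ∣[(6:ℤ)] γ =
      serreDerivative (4:ℤ) E₄ + (1/3 : ℂ) • (E₆ : ℍ → ℂ) := by
    intro γ
    refine slash_add' _ _ _ _ ?_ (slash_form E₆ γ) _
    exact serreDerivative_slash_invariant (k := 4) hasExp_E4.mdiff (slash_form E₄ γ)
  have h2 : HasExp 1 _ (serreDerivative (4:ℤ) E₄ + (1/3 : ℂ) • (E₆ : ℍ → ℂ)) :=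
    ((hasExp_E4.D.sub (((HasExp.const 1 (4/12)).mul hasExp_E2).mul hasExp_E4)).add
      ((HasExp.const 1 (1/3)).mul hasExp_E6)).congr (by
        intro τ; simp only [serreDerivative_apply, Pi.add_apply, Pi.smul_apply, smul_eq_mul, coe_mulE]; push_cast; ring)
  have h3 := congrFun (form_zero_of_lt (by norm_num) _ h1 h2 (by
    simp; norm_num)) τ
  simp only [serreDerivative_apply, Pi.add_apply, Pi.smul_apply, smul_eq_mul, coe_mulE, Pi.zero_apply] at h3
  push_cast at h3
  linear_combination h3

lemma ramanujan6 (τ : ℍ) : normalizedDerivOfComplex E₆ τ = (E2 τ * E₆ τ - E₄ τ ^ 2) / 2 := by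
  have h1 : ∀ γ : SL(2, ℤ), (serreDerivative (6:ℤ) E₆ + (1/2 : ℂ) • ((E₄.mul E₄ : ModularForm 𝒮ℒ (4+4)) : ℍ → ℂ)) ∣[(8:ℤ)] γ =
      serreDerivative (6:ℤ) E₆ + (1/2 : ℂ) • ((E₄.mul E₄ : ModularForm 𝒮ℒ (4+4)) : ℍ → ℂ) := by
    intro γ
    refine slash_add' _ _ _ _ ?_ (slash_form (E₄.mul E₄ : ModularForm 𝒮ℒ (4+4)) γ) _
    exact serreDerivative_slash_invariant (k := 6) hasExp_E6.mdiff (slash_form E₆ γ)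
  have h2 : HasExp 1 _ (serreDerivative (6:ℤ) E₆ + (1/2 : ℂ) • ((E₄.mul E₄ : ModularForm 𝒮ℒ (4+4)) : ℍ → ℂ)) :=
    ((hasExp_E6.D.sub (((HasExp.const 1 (6/12)).mul hasExp_E2).mul hasExp_E6)).add
      ((HasExp.const 1 (1/2)).mul (hasExp_E4.mul hasExp_E4))).congr (by
        intro τ; simp only [serreDerivative_apply, Pi.add_apply, Pi.smul_apply, smul_eq_mul, coe_mulE]; push_cast; ring)
  have h3 := congrFun (form_zero_of_lt (by norm_num) _ h1 h2 (by
    simp; norm_num)) τ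
  simp only [serreDerivative_apply, Pi.add_apply, Pi.smul_apply, smul_eq_mul, coe_mulE, Pi.zero_apply] at h3
  push_cast at h3
  linear_combination h3

lemma slash_smul_fun (k : ℤ) (f : ℍ → ℂ) (γ : SL(2, ℤ)) (τ : ℍ) :
    (f ∣[k] γ) τ = f (γ • τ) * denom γ τ ^ (-k) := by
  rw [ModularForm.SL_slash_apply]

lemma ramanujan2 (τ : ℍ) : normalizedDerivOfComplex E2 τ = (E2 τ ^ 2 - E₄ τ) / 12 := by
  have h1 : ∀ γ : SL(2, ℤ), (fun τ => normalizedDerivOfComplex E2 τ - (E2 τ ^ 2 - E₄ τ) / 12) ∣[(4:ℤ)] γ =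
      (fun τ => normalizedDerivOfComplex E2 τ - (E2 τ ^ 2 - E₄ τ) / 12) := by
    intro γ
    ext τ
    have hD := congrFun (normalizedDerivOfComplex_SL_slash (k := 2) (γ := γ) hasExp_E2.mdiff) τ
    have hE := E2_slash_action γ
    have hEτ := congrFun hE τ
    have h4 := congrFun (slash_form E₄ γ) τ
    have hd : denom γ τ ≠ 0 := denom_ne_zero _ _
    have hpi : (Real.pi : ℂ) ≠ 0 := by exact_mod_cast Real.pi_ne_zero
    rw [hE] at hD
    have hmd : normalizedDerivOfComplex (E2 - (1 / (2 * riemannZeta 2)) • D2 γ) τ =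
        normalizedDerivOfComplex E2 τ + (3 / Real.pi ^ 2) * ((γ 1 0 : ℂ) / denom γ τ) ^ 2 := by
      have hD2 : ∀ z : ℂ, 0 < z.im → (D2 γ ∘ ofComplex) z =
          2 * Real.pi * I * (γ 1 0 : ℂ) * ((γ 1 0 : ℂ) * z + (γ 1 1 : ℂ))⁻¹ := by
        intro z hz
        simp [D2, denom, ofComplex_apply_of_im_pos hz, div_eq_mul_inv]
      have hden : denom γ τ = (γ 1 0 : ℂ) * τ + (γ 1 1 : ℂ) := by simp [denom]
      have hder : HasDerivAt (D2 γ ∘ ofComplex)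
          (2 * Real.pi * I * (γ 1 0 : ℂ) * (-(γ 1 0 : ℂ) / (denom γ τ) ^ 2)) τ := by
        have h0 : HasDerivAt (fun z : ℂ => (γ 1 0 : ℂ) * z + (γ 1 1 : ℂ)) (γ 1 0 : ℂ) τ := by
          simpa using ((hasDerivAt_id (τ : ℂ)).const_mul (γ 1 0 : ℂ)).add_const (γ 1 1 : ℂ)
        have h1 := (h0.inv (hden ▸ hd)).const_mul (2 * Real.pi * I * (γ 1 0 : ℂ))
        rw [← hden] at h1
        refine h1.congr_of_eventuallyEq ?_
        filter_upwards [(isOpen_lt continuous_const Complex.continuous_im).mem_nhds τ.im_pos]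
          with w hw
        rw [hD2 w hw]
        simp
      have hE' := hasExp_E2.hasDerivAt τ.im_pos
      unfold normalizedDerivOfComplex
      have hsub := (hE'.sub (hder.const_mul (1 / (2 * riemannZeta 2)))).deriv
      have e1 : ((E2 - (1 / (2 * riemannZeta 2)) • D2 γ) ∘ ofComplex) =
        (E2 ∘ ofComplex - fun y => (1 / (2 * riemannZeta 2)) * (D2 γ ∘ ofComplex) y) := by
        ext z; simp
      rw [e1, hsub, hE'.deriv, riemannZeta_two]
      field_simp
      ring
    rw [hmd] at hD
    simp only [Pi.sub_apply, Pi.smul_apply, D2, riemannZeta_two, slash_smul_fun, smul_eq_mul, hE]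
      at hD hEτ h4 ⊢
    simp only [show (2:ℤ) + 2 = 4 by norm_num] at hD
    have z4 : denom γ τ ^ (-4 : ℤ) = (denom γ τ ^ (-2 : ℤ)) ^ 2 := by
      rw [← zpow_natCast, ← zpow_mul]; norm_num
    rw [z4] at hD h4 ⊢
    generalize denom γ τ ^ (-2 : ℤ) = Z at *
    have hI : I ^ 2 = -1 := I_sq
    have hG : E2 (γ • τ) ^ 2 * Z ^ 2 = (E2 (γ • τ) * Z) ^ 2 := by ring
    have hgoal : normalizedDerivOfComplex E2 (γ • τ) * Z ^ 2 =
      normalizedDerivOfComplex E2 τ + 3 / ↑Real.pi ^ 2 * (↑(γ 1 0) / denom γ ↑τ) ^ 2 +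
       ((2:ℤ):ℂ) * (2 * ↑Real.pi * I)⁻¹ * (↑(γ 1 0) / denom γ ↑τ) * (E2 (γ • τ) * Z) := by
      rw [hEτ]
      linear_combination -hD
    calc _ = normalizedDerivOfComplex E2 (γ • τ) * Z ^ 2 - ((E2 (γ • τ) * Z) ^ 2 -
      E₄ (γ • τ) * Z ^ 2) / 12 := by ring
      _ = _ := by
        rw [hgoal, h4, hEτ]
        push_cast
        field_simp
        ring_nf
        try simp only [hI, show I ^ 3 = -I by rw [pow_succ, hI]; ring, show I ^ 4 = 1 by rw [show (4:ℕ) = 2 * 2 by norm_num, pow_mul, hI]; norm_num]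
        try ring
  have h2 : HasExp 1 _ (fun τ => normalizedDerivOfComplex E2 τ - (E2 τ ^ 2 - E₄ τ) / 12) :=
    ((hasExp_E2.D.sub (((hasExp_E2.pow 2).sub hasExp_E4).mul (HasExp.const 1 (1/12))))).congr (by
        intro τ; simp; ring)
  have h3 := congrFun (form_zero_of_lt (by norm_num) _ h1 h2 (by
    simp)) τ
  simp  at h3
  linear_combination h3

end H7

namespace H7
open UpperHalfPlane hiding I
open Complex ModularForm
open scoped Manifold MatrixGroups ModularForm Topology
open Function.Periodic (qParam)
open Derivative EisensteinSeries

def aS3 : PowerSeries ℤ := PowerSeries.mk fun n => (ArithmeticFunction.sigma 3 n : ℤ)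
def aS5 : PowerSeries ℤ := PowerSeries.mk fun n => (ArithmeticFunction.sigma 5 n : ℤ)

lemma e4Z_eq : e4Z = 1 + PowerSeries.C 240 * aS3 := by
  ext n
  simp only [e4Z, aS3, map_add, PowerSeries.coeff_mk, PowerSeries.coeff_C_mul, PowerSeries.coeff_one]
  split_ifs with h
  · subst h; simp
  · simp

lemma e6Z_eq : e6Z = 1 - PowerSeries.C 504 * aS5 := by
  ext n
  simp only [e6Z, aS5, map_sub, PowerSeries.coeff_mk, PowerSeries.coeff_C_mul, PowerSeries.coeff_one]
  split_ifs with h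
  · subst h; simp
  · simp

lemma sig_dvd (n : ℕ) : (12 : ℤ) ∣ 5 * (ArithmeticFunction.sigma 3 n : ℤ) + 7 * (ArithmeticFunction.sigma 5 n : ℤ) := by
  simp only [ArithmeticFunction.sigma_apply]
  push_cast
  rw [Finset.mul_sum, Finset.mul_sum, ← Finset.sum_add_distrib]
  apply Finset.dvd_sum
  intro d _
  have : ∀ x : ZMod 12, 5 * x ^ 3 + 7 * x ^ 5 = 0 := by decide
  have := this (d : ZMod 12)
  have h := (ZMod.intCast_zmod_eq_zero_iff_dvd (5 * (d:ℤ) ^ 3 + 7 * (d:ℤ) ^ 5) 12).1 (by push_cast; exact this)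
  exact h

/-- `5σ₃+7σ₅` over 12 -/
def aSm : PowerSeries ℤ :=
  PowerSeries.mk fun n => (5 * (ArithmeticFunction.sigma 3 n : ℤ) + 7 * (ArithmeticFunction.sigma 5 n : ℤ)) / 12

lemma aSm_eq : PowerSeries.C 12 * aSm = PowerSeries.C 5 * aS3 + PowerSeries.C 7 * aS5 := by
  ext n
  simp only [aSm, aS3, aS5, map_add, PowerSeries.coeff_mk, PowerSeries.coeff_C_mul]
  have := sig_dvd n
  omega

/-- integral expansion of `Δ` -/
noncomputable def deltaZ : PowerSeries ℤ :=
  aSm + PowerSeries.C 100 * aS3 ^ 2 + PowerSeries.C 8000 * aS3 ^ 3 - PowerSeries.C 147 * aS5 ^ 2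

lemma deltaZ_eq : PowerSeries.C 1728 * deltaZ = e4Z ^ 3 - e6Z ^ 2 := by
  rw [e4Z_eq, e6Z_eq, deltaZ]
  have := aSm_eq
  have hc : ∀ a : ℤ, (PowerSeries.C a : PowerSeries ℤ) = (a : PowerSeries ℤ) := fun a => by simp
  simp only [hc] at this ⊢
  push_cast at this ⊢
  linear_combination 144 * this

/-- integral expansion of `Δ/q` -/
noncomputable def dZ : PowerSeries ℤ := PowerSeries.mk fun n => PowerSeries.coeff (n+1) deltaZ

lemma deltaZ_eq_X_mul : deltaZ = PowerSeries.X * dZ := by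
  ext n
  rcases n with _ | n
  · simp [deltaZ, aSm, aS3, aS5]
  · rw [PowerSeries.coeff_succ_X_mul, dZ, PowerSeries.coeff_mk]

lemma cc_dZ : PowerSeries.constantCoeff dZ = 1 := by
  rw [← PowerSeries.coeff_zero_eq_constantCoeff_apply, dZ, PowerSeries.coeff_mk, deltaZ]
  simp only [map_add, map_sub, PowerSeries.coeff_C_mul, PowerSeries.coeff_mul, pow_succ, aSm, aS3, aS5, PowerSeries.coeff_mk,
    Finset.Nat.antidiagonal_succ, Finset.sum_cons]
  simp [ArithmeticFunction.sigma_apply]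

/-- inverse of dZ -/
noncomputable def dinvZ : PowerSeries ℤ := PowerSeries.invOfUnit dZ 1

lemma dZ_mul_inv : dZ * dinvZ = 1 := PowerSeries.mul_invOfUnit _ _ (by simp [cc_dZ])

/-- `q·j` -/
noncomputable def jZ : PowerSeries ℤ := e4Z ^ 3 * dinvZ

lemma cc_e4Z : PowerSeries.constantCoeff e4Z = 1 := by
  rw [← PowerSeries.coeff_zero_eq_constantCoeff_apply]; simp [e4Z]
lemma cc_e6Z : PowerSeries.constantCoeff e6Z = 1 := by
  rw [← PowerSeries.coeff_zero_eq_constantCoeff_apply]; simp [e6Z]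

lemma cc_dinvZ : PowerSeries.constantCoeff dinvZ = 1 := by
  have := congrArg PowerSeries.constantCoeff dZ_mul_inv
  rwa [map_mul, cc_dZ, one_mul, map_one] at this

lemma cc_jZ : PowerSeries.constantCoeff jZ = 1 := by
  simp [jZ, cc_e4Z, cc_dinvZ]

notation "Dl" => ModularForm.discriminant

lemma qParam_ne {N : ℕ} (τ : ℍ) : qParam N τ ≠ 0 := Complex.exp_ne_zero _

lemma hasExp_delta : HasExp 1 (toC deltaZ) Dl := by
  have h := ((hasExp_E4.pow 3).sub (hasExp_E6.pow 2)).mul (HasExp.const 1 (1/1728))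
  convert h.congr (g := Dl) (fun τ => by rw [discriminant_eq_E₄_cube_sub_E₆_sq]; ring) using 1
  have := congrArg toC deltaZ_eq
  rw [map_mul, map_sub, map_pow, map_pow] at this
  rw [← this]
  have h1 : toC (PowerSeries.C 1728) = PowerSeries.C (1728 : ℂ) := by
    rw [toC, PowerSeries.map_C]; simp
  rw [h1, mul_comm, ← mul_assoc, ← map_mul]; norm_num

lemma hasExp_d : HasExp 1 (toC dZ) (fun τ => Dl τ / qParam (1:ℕ) τ) := by
  intro τ
  have h := hasExp_delta τ
  rw [← hasSum_nat_add_iff' 1] at h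
  have h0 : PowerSeries.coeff 0 deltaZ = 0 := by rw [deltaZ_eq_X_mul]; simp
  simp only [Finset.sum_range_one, toC, PowerSeries.coeff_map, h0] at h
  have h2 := h.div_const (qParam (1:ℕ) τ)
  simp only [eq_intCast, Int.cast_zero, zero_mul, sub_zero] at h2
  refine hasSum_cg h2 ?_
  intro n
  have := qParam_ne (N := 1) τ
  simp only [dZ, toC, PowerSeries.coeff_map, PowerSeries.coeff_mk, eq_intCast, pow_succ]
  field_simp

lemma delta_ne (τ : ℍ) : Dl τ ≠ 0 := discriminant_ne_zero τ

lemma toC_inv : (toC dZ)⁻¹ = toC dinvZ := by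
  have h := congrArg toC dZ_mul_inv
  rw [map_mul, map_one] at h
  have h0 : PowerSeries.constantCoeff (toC dZ) ≠ 0 := by
    rw [← PowerSeries.coeff_zero_eq_constantCoeff_apply, toC, PowerSeries.coeff_map]
    simp [cc_dZ]
  rw [PowerSeries.inv_eq_iff_mul_eq_one h0, mul_comm]; exact h

lemma hasExp_dinv : HasExp 1 (toC dinvZ) (fun τ => qParam (1:ℕ) τ / Dl τ) := by
  have h := hasExp_d.inv one_pos (fun τ => div_ne_zero (delta_ne τ) (qParam_ne τ)) (by
    rw [toC, PowerSeries.coeff_map]; simp [cc_dZ])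
  rw [toC_inv] at h
  exact h.congr fun τ => by rw [inv_div]

/-- Klein's `j`. -/
noncomputable def kj (τ : ℍ) : ℂ := E₄ τ ^ 3 / Dl τ

lemma hasExp_j : HasExp 1 (toC jZ) (fun τ => qParam (1:ℕ) τ * kj τ) := by
  rw [jZ, map_mul, map_pow]
  exact ((hasExp_E4.pow 3).mul hasExp_dinv).congr fun τ => by rw [kj]; ring

lemma kj_sub (τ : ℍ) : kj τ - 1728 = E₆ τ ^ 2 / Dl τ := by
  have := delta_ne τ
  have h := discriminant_eq_E₄_cube_sub_E₆_sq τ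
  rw [kj]; field_simp; rw [h]; ring

lemma slash_delta (γ : SL(2, ℤ)) : (Dl : ℍ → ℂ) ∣[(12:ℤ)] γ = Dl :=
  SlashInvariantFormClass.slash_action_eq CuspForm.discriminant _ ⟨γ, rfl⟩

lemma form_smul {k : ℤ} {f : ℍ → ℂ} {γ : SL(2, ℤ)} (h : f ∣[k] γ = f) (τ : ℍ) :
    f (γ • τ) = denom γ τ ^ k * f τ := by
  have := congrFun h τ
  rw [slash_smul_fun] at this
  have hd := denom_ne_zero (γ : GL (Fin 2) ℝ) τ
  rw [← this, zpow_neg]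
  have hd' : denom γ τ ^ k ≠ 0 := zpow_ne_zero _ hd
  field_simp

lemma kj_smul (γ : SL(2, ℤ)) (τ : ℍ) : kj (γ • τ) = kj τ := by
  rw [kj, kj, form_smul (slash_form E₄ γ), form_smul (slash_delta γ)]
  have hd := denom_ne_zero (γ : GL (Fin 2) ℝ) τ
  have := delta_ne τ
  rw [mul_pow, ← zpow_natCast, ← zpow_mul]
  norm_num
  rw [mul_div_mul_left]
  exact pow_ne_zero _ hd

end H7

namespace H7
open UpperHalfPlane hiding I
open Complex ModularForm
open scoped Manifold MatrixGroups ModularForm Topology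
open Function.Periodic (qParam)
open Derivative EisensteinSeries

section hom
variable {R : Type*} [CommRing R]

/-- base change of integral series -/
noncomputable abbrev toR (R : Type*) [CommRing R] : PowerSeries ℤ →+* PowerSeries R :=
  PowerSeries.map (Int.castRingHom R)

/-- `q^M p(j)` as a power series in `q`. -/
noncomputable def hom (M : ℕ) (p : R[X]) : PowerSeries R :=
  ∑ i ∈ Finset.range (M + 1), PowerSeries.C (p.coeff i) * (PowerSeries.X ^ (M - i) * toR R jZ ^ i)

lemma hom_eq (M : ℕ) (p : R[X]) :
    hom M p = MvPolynomial.aeval ![toR R jZ, PowerSeries.X] (p.homogenize M) := by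
  rw [hom, homogenize, map_sum, Finset.Nat.sum_antidiagonal_eq_sum_range_succ_mk]
  refine Finset.sum_congr rfl fun i hi => ?_
  rw [MvPolynomial.aeval_monomial, Finsupp.update_eq_add_single (by simp),
    Finsupp.prod_add_index' (by simp) (by intros; rw [pow_add])]
  simp [PowerSeries.algebraMap_apply, mul_comm]

lemma hom_mul {M N : ℕ} {p q : R[X]} (hp : p.natDegree ≤ M) (hq : q.natDegree ≤ N) :
    hom (M + N) (p * q) = hom M p * hom N q := by
  rw [hom_eq, hom_eq, hom_eq, homogenize_mul _ _ hp hq, map_mul]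

lemma hom_pow {M : ℕ} {p : R[X]} (hp : p.natDegree ≤ M) (k : ℕ) :
    hom (k * M) (p ^ k) = hom M p ^ k := by
  induction k with
  | zero => simp [hom]
  | succ k ih =>
    rw [add_mul, one_mul, pow_succ, hom_mul (natDegree_pow_le_of_le k hp) hp, ih, pow_succ]

lemma hom_sub (M : ℕ) (p q : R[X]) : hom M (p - q) = hom M p - hom M q := by
  simp [hom, sub_mul]
lemma hom_add (M : ℕ) (p q : R[X]) : hom M (p + q) = hom M p + hom M q := by
  simp [hom, add_mul, Finset.sum_add_distrib]
lemma hom_neg (M : ℕ) (p : R[X]) : hom M (-p) = - hom M p := by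
  simp [hom]
lemma hom_sum {ι} (s : Finset ι) (M : ℕ) (p : ι → R[X]) : hom M (∑ i ∈ s, p i) = ∑ i ∈ s, hom M (p i) := by
  simp only [hom_eq, homogenize_finsetSum, map_sum]
lemma hom_C_mul (M : ℕ) (c : R) (p : R[X]) : hom M (C c * p) = PowerSeries.C c * hom M p := by
  simp [hom, Finset.mul_sum, mul_assoc]
lemma hom_X_pow {M k : ℕ} (h : k ≤ M) : hom M (X ^ k : R[X]) = toR R jZ ^ k * PowerSeries.X ^ (M - k) := by
  rw [hom_eq, homogenize_X_pow h]; simp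
lemma hom_one (M : ℕ) : hom M (1 : R[X]) = PowerSeries.X ^ M := by
  rw [hom_eq, homogenize_one]; simp
lemma hom_C (M : ℕ) (c : R) : hom M (C c) = PowerSeries.C c * PowerSeries.X ^ M := by
  rw [← mul_one (C c), hom_C_mul, hom_one]

lemma map_toR {S : Type*} [CommRing S] (f : R →+* S) (a : PowerSeries ℤ) :
    PowerSeries.map f (toR R a) = toR S a := by
  ext n; simp

lemma hom_map {S : Type*} [CommRing S] (f : R →+* S) (M : ℕ) (p : R[X]) :
    PowerSeries.map f (hom M p) = hom M (p.map f) := by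
  simp only [hom, map_sum, map_mul, PowerSeries.map_C, map_pow, PowerSeries.map_X, map_toR, coeff_map]

lemma cc_toR (a : PowerSeries ℤ) : PowerSeries.constantCoeff (toR R a) = ((PowerSeries.constantCoeff a : ℤ) : R) := by
  rw [← PowerSeries.coeff_zero_eq_constantCoeff_apply, PowerSeries.coeff_map]; simp

lemma cc_hom (M : ℕ) (p : R[X]) : PowerSeries.constantCoeff (hom M p) = p.coeff M := by
  rw [hom, map_sum, Finset.sum_range_succ, Finset.sum_eq_zero]
  · simp [cc_toR, cc_jZ]
  · intro i hi
    rw [Finset.mem_range] at hi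
    have : M - i ≠ 0 := by omega
    simp [this]

lemma hom_succ (M : ℕ) (p : R[X]) (h : p.coeff (M+1) = 0) : hom (M+1) p = PowerSeries.X * hom M p := by
  rw [hom, Finset.sum_range_succ, h, map_zero, zero_mul, add_zero, hom, Finset.mul_sum]
  refine Finset.sum_congr rfl fun i hi => ?_
  rw [Finset.mem_range] at hi
  rw [show M + 1 - i = (M - i) + 1 by omega, pow_succ]; ring

lemma hom_inj (M : ℕ) (p : R[X]) (hp : p.natDegree ≤ M) (h : PowerSeries.X ^ (M+1) ∣ hom M p) : p = 0 := by
  induction M with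
  | zero =>
    have h1 := cc_hom 0 p
    obtain ⟨c, hc⟩ := h
    rw [hc] at h1
    rw [eq_C_of_natDegree_eq_zero (Nat.le_zero.1 hp), ← h1]; simp
  | succ M ih =>
    have h1 := cc_hom (M+1) p
    obtain ⟨c, hc⟩ := h
    rw [hc] at h1
    have h2 : p.coeff (M+1) = 0 := by rw [← h1]; simp
    apply ih
    · rw [natDegree_le_iff_coeff_eq_zero] at hp ⊢
      intro N hN
      rcases eq_or_lt_of_le (Nat.succ_le_of_lt hN) with h | h
      · rw [← h]; exact h2
      · exact hp _ h
    · rw [hom_succ _ _ h2, pow_succ', mul_assoc] at hc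
      exact ⟨c, PowerSeries.X_mul_cancel hc⟩

end hom

lemma HasExp.shift {N : ℕ} {b f} (h : HasExp N (PowerSeries.X * b) f) :
    HasExp N b (fun τ => f τ / qParam N τ) := by
  intro τ
  have h := h τ
  rw [← hasSum_nat_add_iff' 1] at h
  simp only [Finset.sum_range_one, PowerSeries.coeff_zero_X_mul, zero_mul, sub_zero] at h
  refine hasSum_cg (h.div_const (qParam N τ)) ?_
  intro n
  have := qParam_ne (N := N) τ
  rw [PowerSeries.coeff_succ_X_mul, pow_succ]
  field_simp

/-- `SL₂(ℤ)`-invariance -/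
def Inv (f : ℍ → ℂ) : Prop := ∀ (γ : SL(2, ℤ)) τ, f (γ • τ) = f τ

lemma Inv.slash {f : ℍ → ℂ} (h : Inv f) (γ : SL(2, ℤ)) : f ∣[(0:ℤ)] γ = f := by
  ext τ
  rw [slash_smul_fun, h]; simp

lemma inv_kj : Inv kj := kj_smul

lemma hasExp_hom {R : Type*} [CommRing R] (φ : R →+* ℂ) (M : ℕ) (p : R[X]) (hp : p.natDegree ≤ M) :
    HasExp 1 (PowerSeries.map φ (hom M p)) (fun τ => qParam (1:ℕ) τ ^ M * p.eval₂ φ (kj τ)) := by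
  rw [hom, map_sum]
  have h := (HasExp.sum (Finset.range (M+1)) _ _ fun i _ => ((HasExp.const 1 (φ (p.coeff i))).mul
    (((HasExp.X 1).pow (M - i)).mul (hasExp_j.pow i))))
  have h := h.congr (g := fun τ => qParam (1:ℕ) τ ^ M * p.eval₂ φ (kj τ)) ?_
  rotate_left
  · intro τ
    rw [eval₂_eq_sum_range' φ (Nat.lt_succ_of_le hp), Finset.mul_sum]
    refine Finset.sum_congr rfl fun i hi => ?_
    rw [Finset.mem_range] at hi
    have : qParam (1:ℕ) τ ^ M = qParam (1:ℕ) τ ^ (M-i) * qParam (1:ℕ) τ ^ i := by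
      rw [← pow_add]; congr 1; omega
    rw [this, mul_pow]; ring
  · convert h using 1
    refine Finset.sum_congr rfl fun i hi => ?_
    rw [map_mul, map_mul, map_pow, map_pow, PowerSeries.map_C, PowerSeries.map_X, map_toR]

theorem QEP {R : Type*} [CommRing R] (φ : R →+* ℂ) (M : ℕ) : ∀ (f : ℍ → ℂ) (a : PowerSeries R),
    Inv f → HasExp 1 (PowerSeries.map φ a) (fun τ => qParam (1:ℕ) τ ^ M * f τ) →
    ∃ p : R[X], p.natDegree ≤ M ∧ ∀ τ, f τ = p.eval₂ φ (kj τ) := by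
  induction M with
  | zero =>
    intro f a hf ha
    refine ⟨C (PowerSeries.coeff 0 a), by simp, fun τ => ?_⟩
    have h1 : Inv (fun τ => f τ - φ (PowerSeries.coeff 0 a)) := fun γ τ => by simp only [hf γ τ]
    have h2 := form_zero_of_lt (k := 0) (by norm_num) _ h1.slash
      ((ha.congr (g := f) (by simp)).sub (HasExp.const 1 (φ (PowerSeries.coeff 0 a)))) (by
        rw [map_sub, PowerSeries.coeff_map]; simp)
    have := congrFun h2 τ
    simp only [Pi.zero_apply] at this
    rw [eval₂_C]; linear_combination this
  | succ M ih =>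
    intro f a hf ha
    set c := PowerSeries.coeff 0 a with hc
    have h1 : Inv (fun τ => f τ - φ c * kj τ ^ (M+1)) := fun γ τ => by simp only [hf γ τ, kj_smul]
    set b := a - PowerSeries.C c * toR R jZ ^ (M+1) with hb
    have h2 : HasExp 1 (PowerSeries.map φ b) (fun τ => qParam (1:ℕ) τ ^ (M+1) * (f τ - φ c * kj τ ^ (M+1))) := by
      rw [hb, map_sub, map_mul, map_pow, map_toR, PowerSeries.map_C]
      refine (ha.sub ((HasExp.const 1 (φ c)).mul (hasExp_j.pow (M+1)))).congr fun τ => ?_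
      rw [mul_pow]; ring
    have h3 : PowerSeries.constantCoeff b = 0 := by
      rw [hb]; simp [cc_toR, cc_jZ, hc]
    obtain ⟨b', hb'⟩ := PowerSeries.X_dvd_iff.2 h3
    rw [hb', map_mul, PowerSeries.map_X] at h2
    obtain ⟨p, hp, hpe⟩ := ih _ b' h1 (h2.shift.congr fun τ => by
      have := qParam_ne (N := 1) τ
      rw [pow_succ]; field_simp)
    refine ⟨p + C c * X ^ (M+1), ?_, fun τ => ?_⟩
    · refine (natDegree_add_le _ _).trans (max_le (by omega) ?_)
      exact natDegree_C_mul_X_pow_le _ _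
    · have := hpe τ
      simp only [eval₂_add, eval₂_mul, eval₂_C, eval₂_X_pow]
      linear_combination this

theorem QEP' {R : Type*} [CommRing R] (φ : R →+* ℂ) (hφ : Function.Injective φ) (M : ℕ) (f : ℍ → ℂ) (a : PowerSeries R)
    (hf : Inv f) (ha : HasExp 1 (PowerSeries.map φ a) (fun τ => qParam (1:ℕ) τ ^ M * f τ)) :
    ∃ p : R[X], p.natDegree ≤ M ∧ (∀ τ, f τ = p.eval₂ φ (kj τ)) ∧ a = hom M p := by
  obtain ⟨p, hp, hpe⟩ := QEP φ M f a hf ha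
  refine ⟨p, hp, hpe, ?_⟩
  have h1 := (hasExp_hom φ M p hp).congr (g := fun τ => qParam (1:ℕ) τ ^ M * f τ) (fun τ => by rw [hpe])
  exact PowerSeries.map_injective φ hφ (ha.uniq one_pos h1)

/-- descent from `u = q^{1/N}` to `q` -/
lemma descent {R : Type*} [CommRing R] (φ : R →+* ℂ) (hφ : Function.Injective φ) (N : ℕ) (hN : N ≠ 0) (f : ℍ → ℂ)
    (a : PowerSeries R) (hT : ∀ τ, f (ModularGroup.T • τ) = f τ)
    (ha : HasExp N (PowerSeries.map φ a) f) :
    ∃ b : PowerSeries R, a = PowerSeries.expand N hN b ∧ HasExp 1 (PowerSeries.map φ b) f := by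
  have hpos : 0 < N := Nat.pos_of_ne_zero hN
  have hp := Complex.isPrimitiveRoot_exp N hN
  set ζ := Complex.exp (2 * Real.pi * I / N) with hζ
  have h1 := ha.comp (M := N) (fun τ => ModularGroup.T • τ) ζ 1 one_ne_zero (by
    intro τ
    rw [UpperHalfPlane.modular_T_smul, UpperHalfPlane.coe_vadd, pow_one, hζ, Function.Periodic.qParam, Function.Periodic.qParam, ← Complex.exp_add]
    congr 1; push_cast; field_simp)
  have h2 := (h1.congr hT).uniq hpos ha
  have h3 : ∀ n, ¬ N ∣ n → PowerSeries.coeff n a = 0 := by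
    intro n hn
    have h4 := congrArg (PowerSeries.coeff n) h2
    rw [PowerSeries.expand_one_apply, PowerSeries.coeff_rescale] at h4
    have h5 : ζ ^ n ≠ 1 := fun h => hn (hp.dvd_of_pow_eq_one n h)
    have h6 : (ζ ^ n - 1) * PowerSeries.coeff n (PowerSeries.map φ a) = 0 := by linear_combination h4
    rcases mul_eq_zero.1 h6 with h | h
    · exact absurd (sub_eq_zero.1 h) h5
    · rw [PowerSeries.coeff_map] at h
      exact hφ (by rw [h, map_zero])
  refine ⟨PowerSeries.mk fun n => PowerSeries.coeff (N * n) a, ?_, ?_⟩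
  · ext n
    rw [PowerSeries.coeff_expand]
    split_ifs with h
    · obtain ⟨m, rfl⟩ := h
      rw [PowerSeries.coeff_mk, Nat.mul_div_cancel_left _ hpos]
    · exact h3 n h
  · intro τ
    have h4 := ha τ
    have hinj : Function.Injective (fun n : ℕ => N * n) := fun x y h => Nat.eq_of_mul_eq_mul_left hpos h
    rw [← hinj.hasSum_iff] at h4
    · refine hasSum_cg h4 fun n => ?_
      simp only [Function.comp, PowerSeries.coeff_map, PowerSeries.coeff_mk]
      rw [pow_mul]
      congr 2
      rw [Function.Periodic.qParam, Function.Periodic.qParam, ← Complex.exp_nat_mul]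
      congr 1; push_cast; field_simp
    · intro n hn
      rw [PowerSeries.coeff_map, h3 n, map_zero, zero_mul]
      rintro ⟨m, rfl⟩
      exact hn ⟨m, rfl⟩

/-- `j` is surjective -/
lemma kj_surj (c : ℂ) : ∃ τ, kj τ = c := by
  by_contra! hne
  have h1 : Inv (fun τ => (kj τ - c)⁻¹) := fun γ τ => by simp only [kj_smul]
  have h2 := hasExp_j.sub ((HasExp.const 1 c).mul (HasExp.X 1))
  have h3 := h2.inv one_pos (fun τ => by
    have := mul_ne_zero (qParam_ne (N := 1) τ) (sub_ne_zero.2 (hne τ))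
    intro h; apply this; linear_combination h) (by
      have : PowerSeries.constantCoeff (toC jZ) = 1 := by rw [cc_toR (R := ℂ), cc_jZ]; simp
      simp [this])
  have h4 := ((HasExp.X 1).mul h3).congr (g := fun τ => (kj τ - c)⁻¹) (fun τ => by
    have h5 := sub_ne_zero.2 (hne τ)
    have h6 := qParam_ne (N := 1) τ
    have : qParam (1:ℕ) τ * kj τ - c * qParam (1:ℕ) τ = qParam (1:ℕ) τ * (kj τ - c) := by ring
    rw [this]; field_simp)
  have h5 := congrFun (form_zero_of_lt (k := 0) (by norm_num) _ h1.slash h4 (by simp)) UpperHalfPlane.I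
  simp only [Pi.zero_apply, inv_eq_zero] at h5
  exact hne _ (sub_eq_zero.1 h5)

end H7

namespace H7
open UpperHalfPlane hiding I
open Complex ModularForm
open scoped Manifold MatrixGroups ModularForm Topology
open Function.Periodic (qParam)

abbrev Mat := Matrix (Fin 2) (Fin 2) ℤ

/-- denominators -/
noncomputable def den (M : Mat) (τ : ℍ) : ℂ := (M 1 0 : ℂ) * τ + (M 1 1 : ℂ)
/-- numerators -/
noncomputable def nmr (M : Mat) (τ : ℍ) : ℂ := (M 0 0 : ℂ) * τ + (M 0 1 : ℂ)
/-- action of integral matrices of positive determinant on `ℍ` -/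
noncomputable def act (M : Mat) (τ : ℍ) : ℍ := ofComplex (nmr M τ / den M τ)

lemma den_ne {M : Mat} (h : M.det ≠ 0) (τ : ℍ) : den M τ ≠ 0 := by
  intro h0
  rw [den] at h0
  have him := congrArg Complex.im h0
  have hre := congrArg Complex.re h0
  simp at him hre
  rcases him with h1 | h1
  · rw [h1] at hre
    simp at hre
    apply h
    rw [Matrix.det_fin_two, h1, hre]; ring
  · exact τ.im_pos.ne' h1

lemma im_mob (M : Mat) (h : M.det ≠ 0) (τ : ℍ) :
    (nmr M τ / den M τ).im = M.det * τ.im / Complex.normSq (den M τ) := by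
  have hd := den_ne h τ
  have hn : Complex.normSq (den M τ) ≠ 0 := by simpa using hd
  rw [Complex.div_im, Matrix.det_fin_two]
  field_simp
  simp [den, nmr]
  ring

lemma act_coe {M : Mat} (h : 0 < M.det) (τ : ℍ) : ((act M τ : ℍ) : ℂ) = nmr M τ / den M τ := by
  rw [act, ofComplex_apply_of_im_pos]
  rw [im_mob M h.ne']
  have hd := den_ne h.ne' τ
  have hn : 0 < Complex.normSq (den M τ) := Complex.normSq_pos.2 hd
  have := τ.im_pos
  have h' : (0:ℝ) < M.det := by exact_mod_cast h
  positivity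

lemma den_mul {M N : Mat} (hN : 0 < N.det) (τ : ℍ) :
    den (M * N) τ = den M (act N τ) * den N τ := by
  have hd := den_ne hN.ne' τ
  rw [den, den, act_coe hN]
  field_simp
  simp only [Matrix.mul_apply, Fin.sum_univ_two, nmr, den]
  push_cast
  ring

lemma nmr_mul {M N : Mat} (hN : 0 < N.det) (τ : ℍ) :
    nmr (M * N) τ = nmr M (act N τ) * den N τ := by
  have hd := den_ne hN.ne' τ
  rw [nmr, nmr, act_coe hN]
  field_simp
  simp only [Matrix.mul_apply, Fin.sum_univ_two, nmr, den]
  push_cast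
  ring

lemma act_mul {M N : Mat} (hM : 0 < M.det) (hN : 0 < N.det) (τ : ℍ) :
    act (M * N) τ = act M (act N τ) := by
  ext
  rw [act_coe (by rw [Matrix.det_mul]; positivity), act_coe hM, den_mul hN, nmr_mul hN,
    mul_div_mul_right _ _ (den_ne hN.ne' τ)]

lemma SLdet (A : SL(2, ℤ)) : 0 < (A : Mat).det := by rw [A.det_coe]; norm_num

lemma den_SL (A : SL(2, ℤ)) (τ : ℍ) : denom A τ = den A τ := by
  simp [denom, den]

lemma act_SL (A : SL(2, ℤ)) (τ : ℍ) : act A τ = A • τ := by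
  ext
  rw [act_coe (SLdet A), UpperHalfPlane.coe_specialLinearGroup_apply]
  simp [nmr, den]

variable (l : ℕ)

/-- coset representatives -/
def gam : Option (Fin l) → Mat
  | none => !![(l:ℤ), 0; 0, 1]
  | some b => !![1, (b : ℤ); 0, (l : ℤ)]

lemma gam_det (i) : (gam l i).det = l := by
  rcases i with _ | b <;> simp [gam]

lemma gam_exists (hl : l.Prime) (M : Mat) (hM : M.det = l) : ∃ (A : SL(2, ℤ)) (i : Option (Fin l)), M = A * gam l i := by
  have hl0 : (l : ℤ) ≠ 0 := by exact_mod_cast hl.ne_zero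
  rw [Matrix.det_fin_two] at hM
  by_cases h : (l : ℤ) ∣ M 0 0 ∧ (l : ℤ) ∣ M 1 0
  · obtain ⟨⟨x, hx⟩, ⟨y, hy⟩⟩ := h
    refine ⟨⟨!![x, M 0 1; y, M 1 1], ?_⟩, none, ?_⟩
    · rw [Matrix.det_fin_two_of]
      apply mul_left_cancel₀ hl0
      rw [hx, hy] at hM
      linear_combination hM
    · ext i j
      fin_cases i <;> fin_cases j <;> simp [gam, hx, hy, mul_comm]
  · have : ∃ b : Fin l, (l : ℤ) ∣ M 0 1 - M 0 0 * b ∧ (l : ℤ) ∣ M 1 1 - M 1 0 * b := by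
      haveI := Fact.mk hl
      have key : ∃ z : ZMod l, (M 0 1 : ZMod l) - M 0 0 * z = 0 ∧ (M 1 1 : ZMod l) - M 1 0 * z = 0 := by
        have hdet : (M 0 0 : ZMod l) * M 1 1 - M 0 1 * M 1 0 = 0 := by
          have := congrArg (Int.cast : ℤ → ZMod l) hM
          push_cast at this
          simpa using this
        by_cases h0 : (M 0 0 : ZMod l) = 0
        · have h1 : (M 1 0 : ZMod l) ≠ 0 := by
            intro h1
            rw [ZMod.intCast_zmod_eq_zero_iff_dvd] at h0 h1
            exact h ⟨h0, h1⟩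
          refine ⟨M 1 1 / M 1 0, ?_, ?_⟩
          · field_simp; linear_combination -hdet
          · field_simp; ring
        · refine ⟨M 0 1 / M 0 0, ?_, ?_⟩
          · field_simp; ring
          · field_simp; linear_combination hdet
      obtain ⟨z, hz0, hz1⟩ := key
      refine ⟨⟨z.val, z.val_lt⟩, ?_, ?_⟩
      · rw [← ZMod.intCast_zmod_eq_zero_iff_dvd]; push_cast; simpa using hz0
      · rw [← ZMod.intCast_zmod_eq_zero_iff_dvd]; push_cast; simpa using hz1
    obtain ⟨b, ⟨x, hx⟩, ⟨y, hy⟩⟩ := this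
    refine ⟨⟨!![M 0 0, x; M 1 0, y], ?_⟩, some b, ?_⟩
    · rw [Matrix.det_fin_two_of]
      apply mul_left_cancel₀ hl0
      linear_combination hM - M 0 0 * hy + M 1 0 * hx
    · ext i j
      fin_cases i <;> fin_cases j <;> simp [gam]
      · linear_combination hx
      · linear_combination hy

lemma gam_uniq (hl : l.Prime) (A : SL(2, ℤ)) (i j : Option (Fin l)) (h : (A : Mat) * gam l i = gam l j) : i = j := by
  have hl0 : (l : ℤ) ≠ 0 := by exact_mod_cast hl.ne_zero
  have hl1 : ¬ (l : ℤ) ∣ 1 := by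
    intro h; have := Int.natCast_dvd_natCast.1 (by exact_mod_cast h : (l:ℤ) ∣ (1:ℕ))
    exact hl.one_lt.ne' (Nat.dvd_one.1 this)
  have e : ∀ a b, ((A : Mat) * gam l i) a b = gam l j a b := fun a b => by rw [h]
  have hdet := A.det_coe
  rw [Matrix.det_fin_two] at hdet
  have e00 := e 0 0
  have e01 := e 0 1
  have e10 := e 1 0
  have e11 := e 1 1
  simp only [Matrix.mul_apply, Fin.sum_univ_two] at e00 e01 e10 e11
  rcases i with _ | b <;> rcases j with _ | b'
  · rfl
  · exfalso
    simp [gam] at e00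
    exact hl1 ⟨_, by rw [mul_comm]; exact e00.symm⟩
  · exfalso
    simp [gam] at e00 e10 e11
    rw [e10] at e11
    exact hl1 ⟨(A : Mat) 1 1, by linear_combination -e11⟩
  · simp [gam] at e00 e01 e10 e11
    rw [e00] at e01
    have hb := b.2
    have hb' := b'.2
    congr 1
    ext
    have hm : ((b' : ℤ) - b) = l * (A : Mat) 0 1 := by linear_combination -e01
    have h1 : (l:ℤ) ∣ ((b' : ℕ) : ℤ) - ((b : ℕ) : ℤ) := ⟨_, hm⟩
    have h2 := (Nat.modEq_iff_dvd.2 h1)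
    rw [Nat.ModEq, Nat.mod_eq_of_lt hb, Nat.mod_eq_of_lt hb'] at h2
    exact h2

/-- products over cosets are invariant -/
lemma prod_gam (hl : l.Prime) (ψ : Mat → ℂ) (hψ : ∀ (B : SL(2, ℤ)) i, ψ (B * gam l i) = ψ (gam l i))
    (A : SL(2, ℤ)) : ∏ i, ψ (gam l i * A) = ∏ i, ψ (gam l i) := by
  have hdet : ∀ i, (gam l i * (A : Mat)).det = l := fun i => by
    rw [Matrix.det_mul, gam_det, A.det_coe, mul_one]
  choose B σ hB using fun i => gam_exists l hl (gam l i * A) (hdet i)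
  have hinj : Function.Injective σ := by
    intro i j hij
    have h1 := hB i
    have h2 := hB j
    rw [hij] at h1
    have h3 : gam l (σ j) = ((B j)⁻¹ : SL(2, ℤ)) * (gam l j * A) := by
      rw [h2, ← mul_assoc, ← Matrix.SpecialLinearGroup.coe_mul]; simp
    have h4 : gam l i = (B i * (B j)⁻¹ : SL(2,ℤ)) * gam l j := by
      have : gam l i * (A : Mat) * (A⁻¹ : SL(2, ℤ)) = (B i : Mat) * (((B j)⁻¹ : SL(2, ℤ)) * (gam l j * A)) * (A⁻¹ : SL(2, ℤ)) := by
        rw [h1, h3]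
      rw [mul_assoc, ← Matrix.SpecialLinearGroup.coe_mul] at this
      simp only [mul_inv_cancel, Matrix.SpecialLinearGroup.coe_one, mul_one] at this
      rw [this, Matrix.SpecialLinearGroup.coe_mul]
      simp only [mul_assoc]
      rw [← Matrix.SpecialLinearGroup.coe_mul A]; simp
    exact (gam_uniq l hl _ _ _ h4.symm).symm
  have hbij := Finite.injective_iff_bijective.1 hinj
  calc ∏ i, ψ (gam l i * A) = ∏ i, ψ (gam l (σ i)) := by
        refine Finset.prod_congr rfl fun i _ => ?_
        rw [hB i, hψ]
    _ = _ := hbij.prod_comp (fun i => ψ (gam l i))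

/-- `l¹² (cτ+d)⁻¹² Δ(Mτ)/Δ(τ)` -/
noncomputable def phi (τ : ℍ) (M : Mat) : ℂ := (l : ℂ) ^ 12 / den M τ ^ 12 * Dl (act M τ) / Dl τ

lemma delta_act_SL (A : SL(2, ℤ)) (τ : ℍ) : Dl (act A τ) = den A τ ^ 12 * Dl τ := by
  rw [act_SL, form_smul (slash_delta A), den_SL]; norm_cast

lemma phi_left (τ : ℍ) (B : SL(2, ℤ)) (M : Mat) (hM : 0 < M.det) : phi l τ (B * M) = phi l τ M := by
  rw [phi, phi, act_mul (SLdet B) hM, delta_act_SL, den_mul hM]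
  have h1 := den_ne (SLdet B).ne' (act M τ)
  have h2 := den_ne hM.ne' τ
  have := delta_ne τ
  field_simp

lemma phi_right (τ : ℍ) (A : SL(2, ℤ)) (M : Mat) (hM : 0 < M.det) : phi l (A • τ) M = phi l τ (M * A) := by
  rw [phi, phi, ← act_SL, act_mul hM (SLdet A), delta_act_SL, den_mul (SLdet A)]
  have h1 := den_ne hM.ne' (act A τ)
  have h2 := den_ne (SLdet A).ne' τ
  have := delta_ne τ
  field_simp

lemma kj_act_SL (A : SL(2, ℤ)) (τ : ℍ) : kj (act A τ) = kj τ := by rw [act_SL, kj_smul]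

lemma gam_det_pos (hl : l.Prime) (i) : 0 < (gam l i).det := by
  rw [gam_det]; exact_mod_cast hl.pos

/-- the function `F` -/
noncomputable def Ffun (τ : ℍ) : ℂ := ∏ i, (kj τ - kj (act (gam l i) τ))
/-- the function `f_y` -/
noncomputable def Yfun (y : ℂ) (τ : ℍ) : ℂ := ∏ i, (y - phi l τ (gam l i))

lemma Ffun_inv (hl : l.Prime) : Inv (Ffun l) := by
  intro A τ
  rw [Ffun, Ffun, kj_smul]
  rw [← prod_gam l hl (fun M => kj τ - kj (act M τ)) (fun B i => by
    simp only [act_mul (SLdet B) (gam_det_pos l hl i), kj_act_SL]) A]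
  refine Finset.prod_congr rfl fun i _ => ?_
  rw [← act_SL, act_mul (gam_det_pos l hl i) (SLdet A)]

lemma Yfun_inv (hl : l.Prime) (y : ℂ) : Inv (Yfun l y) := by
  intro A τ
  rw [Yfun, Yfun]
  rw [← prod_gam l hl (fun M => y - phi l τ M) (fun B i => by
    simp only [phi_left l τ B _ (gam_det_pos l hl i)]) A]
  refine Finset.prod_congr rfl fun i _ => ?_
  rw [phi_right _ _ _ _ (gam_det_pos l hl i)]

end H7

namespace H7
open UpperHalfPlane hiding I
open Complex ModularForm
open scoped Manifold MatrixGroups ModularForm Topology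
open Function.Periodic (qParam)

/-- coefficients of the Hasse polynomial -/
def cf (n s k : ℕ) : ℤ := ((2 * n + s).choose (2 * k + s) : ℤ) * ((2 * n - 2 * k).choose (n - k) : ℤ) * (-432) ^ (n - k)

lemma cf_self (n s : ℕ) : cf n s n = 1 := by simp [cf]

lemma cf_rec (n s k : ℕ) (hk : k < n) :
    ((n - k : ℕ) : ℤ) ^ 2 * cf n s k = -432 * ((2 * k + s + 2) * (2 * k + s + 1)) * cf n s (k + 1) := by
  obtain ⟨N, rfl⟩ : ∃ N, n = k + N + 1 := ⟨n - k - 1, by omega⟩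
  have e1 : k + N + 1 - k = N + 1 := by omega
  have e2 : 2 * (k + N + 1) - 2 * k = 2 * N + 2 := by omega
  have e3 : 2 * (k + N + 1) - 2 * (k + 1) = 2 * N := by omega
  have e4 : k + N + 1 - (k + 1) = N := by omega
  simp only [cf, e1, e2, e3, e4]
  have c1 := Nat.choose_succ_right_eq (2 * (k + N + 1) + s) (2 * k + s)
  have c2 := Nat.choose_succ_right_eq (2 * (k + N + 1) + s) (2 * k + s + 1)
  rw [show 2 * (k + N + 1) + s - (2 * k + s) = 2 * N + 2 by omega] at c1
  rw [show 2 * (k + N + 1) + s - (2 * k + s + 1) = 2 * N + 1 by omega] at c2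
  have c3 := Nat.succ_mul_centralBinom_succ N
  rw [Nat.centralBinom_eq_two_mul_choose, Nat.centralBinom_eq_two_mul_choose, show 2 * (N + 1) = 2 * N + 2 by ring] at c3
  rw [show 2 * (k + 1) + s = 2 * k + s + 1 + 1 by ring]
  rw [show 2 * (k + N + 1) + s = (2 * (k + N + 1) + s) by rfl] at *
  set A := (2 * (k + N + 1) + s).choose (2 * k + s)
  set B := (2 * (k + N + 1) + s).choose (2 * k + s + 1)
  set E := (2 * (k + N + 1) + s).choose (2 * k + s + 1 + 1)
  set F := (2 * N + 2).choose (N + 1)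
  set G := (2 * N).choose N
  have c1' : (B : ℤ) * (2 * k + s + 1) = A * (2 * N + 2) := by exact_mod_cast c1
  have c2' : (E : ℤ) * (2 * k + s + 2) = B * (2 * N + 1) := by
    have : (E : ℤ) * (2 * k + s + 1 + 1) = B * (2 * N + 1) := by exact_mod_cast c2
    linear_combination this
  have c3' : ((N : ℤ) + 1) * F = 2 * (2 * N + 1) * G := by exact_mod_cast c3
  have key : ((N : ℤ) + 1) ^ 2 * (A * F) = (2 * k + s + 2) * (2 * k + s + 1) * (E * G) := by
    have h2 : ((N : ℤ) + 1) ^ 2 * (A * F) = ((N:ℤ) + 1) * A * (2 * (2 * N + 1) * G) := by rw [← c3']; ring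
    rw [h2]
    linear_combination (-(2 * N + 1) * G : ℤ) * c1' - (2 * k + s + 1) * G * c2'
  push_cast
  rw [pow_succ]
  linear_combination (-432) ^ N * (-432) * key

section ode
variable {A S : Type*} [CommRing A] [CommRing S] [Algebra A S] (θ : Derivation A S S) (P : S)

/-- Serre derivative relation -/
def SD (w F G : S) : Prop := 12 * θ F = w * P * F + G

variable {θ P}
lemma SD.mul {w F G w' F' G' : S} (h : SD θ P w F G) (h' : SD θ P w' F' G') :
    SD θ P (w + w') (F * F') (G * F' + F * G') := by
  unfold SD at *
  rw [Derivation.leibniz]; simp only [smul_eq_mul]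
  linear_combination F' * h + F * h'

lemma SD.pow {w F G : S} (h : SD θ P w F G) (m : ℕ) :
    SD θ P (m * w) (F ^ m) (m * (F ^ (m - 1) * G)) := by
  unfold SD at *
  rw [Derivation.leibniz_pow]
  rcases m with _ | m
  · simp
  · simp only [nsmul_eq_mul, smul_eq_mul, Nat.add_sub_cancel]
    linear_combination ((m + 1 : ℕ) : S) * F ^ m * h

lemma SD.add {w F G F' G' : S} (h : SD θ P w F G) (h' : SD θ P w F' G') :
    SD θ P w (F + F') (G + G') := by
  unfold SD at *
  rw [map_add]; linear_combination h + h'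

lemma SD.nat_mul {w F G : S} (h : SD θ P w F G) (m : ℤ) : SD θ P w (m * F) (m * G) := by
  unfold SD at *
  rw [Derivation.leibniz, θ.map_intCast]; simp only [smul_eq_mul]; linear_combination m * h

lemma SD.two {Q F G H : S} (hP : 12 * θ P = P ^ 2 - Q) (h : SD θ P (-1) F G) (h' : SD θ P 1 G H) :
    144 * θ (θ F) = Q * F + H := by
  unfold SD at *
  have h2 : 12 * θ (12 * θ F) = 144 * θ (θ F) := by
    rw [Derivation.leibniz]
    have : θ 12 = 0 := by exact_mod_cast θ.map_natCast 12
    rw [this]; simp; ring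
  rw [← h2, h, map_add, mul_add, h', Derivation.leibniz, Derivation.leibniz, map_neg]
  simp only [smul_eq_mul, Derivation.map_one_eq_zero, neg_zero, mul_zero, add_zero]
  linear_combination (-P) * h - F * hP

lemma SD.congr {w F G w' F' G' : S} (h : SD θ P w F G) (hw : w = w') (hF : F = F') (hG : G = G') : SD θ P w' F' G' := by
  subst hw hF hG; exact h

variable {Q R D : S}

lemma ode_mono0 (hP : 12 * θ P = P ^ 2 - Q) (hQ : 12 * θ Q = 4 * (P * Q - R)) (hR : 12 * θ R = 6 * (P * R - Q ^ 2))
    (hD : 12 * θ D = 12 * (P * D)) (hQR : Q ^ 3 = R ^ 2 + 1728 * D) (m e : ℕ) (hw : (6 * m + 12 * e : S) = -1) :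
    144 * θ (θ (R ^ m * D ^ e)) = 
      Q * ((1 + 48 * m + 36 * (m * (m - 1))) * (R ^ m * D ^ e) + 62208 * (m * (m - 1)) * (R ^ (m - 2) * D ^ (e + 1))) := by
  have sQ : SD θ P 4 Q (-4 * R) := by unfold SD; linear_combination hQ
  have sR : SD θ P 6 R (-6 * Q ^ 2) := by unfold SD; linear_combination hR
  have sD : SD θ P 12 D 0 := by unfold SD; linear_combination hD
  have F1 : SD θ P (-1) (R ^ m * D ^ e) ((m * (-6) : ℤ) * (R ^ (m - 1) * Q ^ 2 * D ^ e)) := 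
    ((sR.pow m).mul (sD.pow e)).congr (by linear_combination hw) rfl (by push_cast; ring)
  have G1 := (((sR.pow (m - 1)).mul (sQ.pow 2)).mul (sD.pow e)).nat_mul (m * (-6) : ℤ)
  rcases m with _ | m
  · have := SD.two hP F1 (H := 0) (by simp [SD])
    rw [this]; simp
  have G2 := G1.congr (w' := 1) (by push_cast [Nat.add_sub_cancel] at hw ⊢; linear_combination hw) rfl rfl
  rw [SD.two hP F1 G2]
  rcases m with _ | m
  · simp; ring
  · simp only [Nat.add_sub_cancel, show m + 1 + 1 - 2 = m by omega]
    push_cast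
    linear_combination (36 * (m + 1 + 1) * (m + 1) * Q * R ^ m * D ^ e) * hQR

lemma ode_mono1 (hP : 12 * θ P = P ^ 2 - Q) (hQ : 12 * θ Q = 4 * (P * Q - R)) (hR : 12 * θ R = 6 * (P * R - Q ^ 2))
    (hD : 12 * θ D = 12 * (P * D)) (hQR : Q ^ 3 = R ^ 2 + 1728 * D) (m e : ℕ) (hw : (4 + 6 * m + 12 * e : S) = -1) :
    144 * θ (θ (Q * (R ^ m * D ^ e))) = 
      Q ^ 2 * ((25 + 96 * m + 36 * (m * (m - 1))) * (R ^ m * D ^ e) + 62208 * (m * (m - 1)) * (R ^ (m - 2) * D ^ (e + 1))) := by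
  have sQ : SD θ P 4 Q (-4 * R) := by unfold SD; linear_combination hQ
  have sR : SD θ P 6 R (-6 * Q ^ 2) := by unfold SD; linear_combination hR
  have sD : SD θ P 12 D 0 := by unfold SD; linear_combination hD
  have F1 : SD θ P (-1) (Q * (R ^ m * D ^ e)) ((m * (-6) : ℤ) * (R ^ (m - 1) * Q ^ 3 * D ^ e) + (-4 : ℤ) * (R ^ (m + 1) * D ^ e)) := 
    (sQ.mul ((sR.pow m).mul (sD.pow e))).congr (by linear_combination hw) rfl (by push_cast; ring)
  have G1 := (((sR.pow (m - 1)).mul (sQ.pow 3)).mul (sD.pow e)).nat_mul (m * (-6) : ℤ)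
  have G0 := (((sR.pow (m + 1))).mul (sD.pow e)).nat_mul (-4 : ℤ)
  have G0' := G0.congr (w' := 1) (by push_cast at hw ⊢; linear_combination hw) rfl rfl
  rcases m with _ | m
  · have := SD.two hP F1 (G := _) (H := _) ((show SD θ P 1 _ 0 by simp [SD]).add G0')
    rw [this]; simp; ring
  have G2 := G1.congr (w' := 1) (by push_cast [Nat.add_sub_cancel] at hw ⊢; linear_combination hw) rfl rfl
  rw [SD.two hP F1 (G2.add G0')]
  rcases m with _ | m
  · simp; ring
  · simp only [Nat.add_sub_cancel, show m + 1 + 1 - 2 = m by omega]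
    push_cast
    linear_combination (36 * (m + 1 + 1) * (m + 1) * Q ^ 2 * R ^ m * D ^ e) * hQR

lemma ode_sum (hP : 12 * θ P = P ^ 2 - Q) (hQ : 12 * θ Q = 4 * (P * Q - R)) (hR : 12 * θ R = 6 * (P * R - Q ^ 2))
    (hD : 12 * θ D = 12 * (P * D)) (hQR : Q ^ 3 = R ^ 2 + 1728 * D) (n r s : ℕ) (hr : r = 0 ∨ r = 1) (hs : s = 0 ∨ s = 1)
    (hw : (4 * r + 6 * s + 12 * n : S) = -1) :
    144 * θ (θ (∑ k ∈ Finset.range (n + 1), (cf n s k : S) * (Q ^ r * (R ^ (2 * k + s) * D ^ (n - k))))) = 0 := by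
  have hmono : ∀ k ∈ Finset.range (n + 1), 144 * θ (θ ((cf n s k : S) * (Q ^ r * (R ^ (2 * k + s) * D ^ (n - k))))) =
      Q ^ (r + 1) * ((cf n s k : S) * (144 * ((n - k : ℕ) : S) ^ 2 * (R ^ (2 * k + s) * D ^ (n - k)) + 
        62208 * (((2 * k + s : ℕ) : S) * ((2 * k + s : ℕ) - 1)) * (R ^ (2 * k + s - 2) * D ^ (n - k + 1)))) := by
    intro k hk
    have hkn : k ≤ n := by simpa [Nat.lt_succ_iff] using hk
    have e1 : ∀ F : S, θ (θ ((cf n s k : S) * F)) = cf n s k * θ (θ F) := by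
      intro F
      rw [Derivation.leibniz, θ.map_intCast, smul_zero, add_zero, smul_eq_mul, Derivation.leibniz, θ.map_intCast, smul_zero, add_zero, smul_eq_mul]
    rw [e1, mul_left_comm]
    have e2 : ((n - k : ℕ) : S) = n - k := Nat.cast_sub hkn
    rcases hr with rfl | rfl
    · rw [pow_zero, one_mul, ode_mono0 hP hQ hR hD hQR _ _ (by rw [e2]; push_cast at hw ⊢; linear_combination hw)]
      rw [e2]
      push_cast at hw ⊢
      have h1 : (1 + 48 * (2 * k + s) + 36 * ((2 * k + s) * (2 * k + s - 1)) : S) = 144 * (n - k) ^ 2 := by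
        linear_combination (12 * k + 6 * s + 1 - 12 * (n - k)) * hw
      rw [h1]; ring
    · rw [pow_one, ode_mono1 hP hQ hR hD hQR _ _ (by rw [e2]; push_cast at hw ⊢; linear_combination hw)]
      rw [e2]
      push_cast at hw ⊢
      have h1 : (25 + 96 * (2 * k + s) + 36 * ((2 * k + s) * (2 * k + s - 1)) : S) = 144 * (n - k) ^ 2 := by
        linear_combination (12 * k + 6 * s + 5 - 12 * (n - k)) * hw
      rw [h1]; ring
  rw [map_sum, map_sum, Finset.mul_sum, Finset.sum_congr rfl hmono, ← Finset.mul_sum]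
  simp only [mul_add (cf n s _ : S)]
  rw [Finset.sum_add_distrib, Finset.sum_range_succ, Finset.sum_range_succ' (fun k => (cf n s k : S) * (62208 * (((2 * k + s : ℕ) : S) * ((2 * k + s : ℕ) - 1)) * (R ^ (2 * k + s - 2) * D ^ (n - k + 1))))]
  have z0 : (((2 * 0 + s : ℕ) : S) * ((2 * 0 + s : ℕ) - 1)) = 0 := by
    rcases hs with rfl | rfl <;> simp
  rw [z0]
  simp only [Nat.sub_self, Nat.cast_zero]
  have : ∀ k ∈ Finset.range n, (cf n s (k + 1) : S) * (62208 * (((2 * (k + 1) + s : ℕ) : S) * ((2 * (k + 1) + s : ℕ) - 1)) * (R ^ (2 * (k + 1) + s - 2) * D ^ (n - (k + 1) + 1))) =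
      - ((cf n s k : S) * (144 * ((n - k : ℕ) : S) ^ 2 * (R ^ (2 * k + s) * D ^ (n - k)))) := by
    intro k hk
    have hk' : k < n := by simpa using hk
    rw [show 2 * (k + 1) + s - 2 = 2 * k + s by omega, show n - (k + 1) + 1 = n - k by omega]
    have := congrArg (Int.cast : ℤ → S) (cf_rec n s k hk')
    push_cast at this ⊢
    linear_combination (144 * (R ^ (2 * k + s) * D ^ (n - k))) * this
  rw [Finset.sum_congr rfl this, Finset.sum_neg_distrib]
  ring

end ode

/-- q d/dq -/
noncomputable def thD (R : Type*) [CommRing R] : Derivation R (PowerSeries R) (PowerSeries R) :=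
  (PowerSeries.X : PowerSeries R) • PowerSeries.derivative R

lemma coeff_thD {R : Type*} [CommRing R] (a : PowerSeries R) (n : ℕ) : PowerSeries.coeff n (thD R a) = n * PowerSeries.coeff n a := by
  have : thD R a = PowerSeries.X * PowerSeries.derivative R a := rfl
  rw [this]
  rcases n with _ | n
  · simp
  · rw [PowerSeries.coeff_succ_X_mul, PowerSeries.coeff_derivative]; push_cast; ring

lemma map_thD {R R' : Type*} [CommRing R] [CommRing R'] (φ : R →+* R') (a : PowerSeries R) :
    PowerSeries.map φ (thD R a) = thD R' (PowerSeries.map φ a) := by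
  ext n; simp [coeff_thD]

lemma thetaC_eq (a : PowerSeries ℂ) : thetaC a = thD ℂ a := by
  ext n; simp [coeff_thD, thetaC]

lemma toC_inj {a b : PowerSeries ℤ} (h : toC a = toC b) : a = b :=
  PowerSeries.map_injective _ (RingHom.injective_int _) h

lemma toC_num (n : ℕ) : (PowerSeries.C (n : ℂ)) = toC (n : PowerSeries ℤ) := by
  simp

lemma ramZ4 : 12 * thD ℤ e4Z = 4 * (e2Z * e4Z - e6Z) := by
  apply toC_inj
  have h1 := (hasExp_E4.D).congr (g := fun τ => (EisensteinSeries.E2 τ * E₄ τ - E₆ τ) / 3) (fun τ => ramanujan4 τ)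
  have h2 := (((HasExp.const 1 (3 : ℂ))).mul h1).uniq one_pos (((hasExp_E2.mul hasExp_E4).sub hasExp_E6).congr (fun τ => by ring))
  rw [thetaC_eq] at h2
  simp only [map_mul, map_sub, map_thD, map_ofNat] at h2 ⊢
  linear_combination 4 * h2

lemma ramZ6 : 12 * thD ℤ e6Z = 6 * (e2Z * e6Z - e4Z ^ 2) := by
  apply toC_inj
  have h1 := (hasExp_E6.D).congr (g := fun τ => (EisensteinSeries.E2 τ * E₆ τ - E₄ τ ^ 2) / 2) (fun τ => ramanujan6 τ)
  have h2 := (((HasExp.const 1 (2 : ℂ))).mul h1).uniq one_pos (((hasExp_E2.mul hasExp_E6).sub (hasExp_E4.pow 2)).congr (fun τ => by ring))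
  rw [thetaC_eq] at h2
  simp only [map_mul, map_sub, map_thD, map_ofNat, map_pow] at h2 ⊢
  linear_combination 6 * h2

lemma ramZ2 : 12 * thD ℤ e2Z = e2Z ^ 2 - e4Z := by
  apply toC_inj
  have h1 := (hasExp_E2.D).congr (g := fun τ => (EisensteinSeries.E2 τ ^ 2 - E₄ τ) / 12) (fun τ => ramanujan2 τ)
  have h2 := (((HasExp.const 1 (12 : ℂ))).mul h1).uniq one_pos (((hasExp_E2.pow 2).sub hasExp_E4).congr (fun τ => by ring))
  rw [thetaC_eq] at h2
  simp only [map_mul, map_sub, map_thD, map_ofNat, map_pow] at h2 ⊢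
  linear_combination h2

lemma deltaZ_eq' : e4Z ^ 3 = e6Z ^ 2 + 1728 * deltaZ := by
  have := deltaZ_eq
  rw [show (PowerSeries.C (1728 : ℤ) : PowerSeries ℤ) = 1728 by simp] at this
  linear_combination -this

lemma ramZD : 12 * thD ℤ deltaZ = 12 * (e2Z * deltaZ) := by
  have h := congrArg (fun x => 12 * thD ℤ x) deltaZ_eq'
  simp only [map_add, Derivation.leibniz, Derivation.leibniz_pow] at h
  have : thD ℤ 1728 = 0 := by exact_mod_cast (thD ℤ).map_natCast 1728
  rw [this] at h
  simp only [smul_eq_mul, nsmul_eq_mul, Nat.reduceSub, mul_zero, add_zero, pow_one, Nat.cast_ofNat] at h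
  have hz : (1728 : PowerSeries ℤ) ≠ 0 := by
    intro h; have := congrArg (PowerSeries.constantCoeff (R := ℤ)) h; rw [map_ofNat, map_zero] at this; norm_num at this
  apply mul_left_cancel₀ hz
  linear_combination -h + 3 * e4Z ^ 2 * ramZ4 - 2 * e6Z * ramZ6 + 12 * e2Z * deltaZ_eq'

/-- the Hasse invariant form, over the integers -/
noncomputable def hZ (n r s : ℕ) : PowerSeries ℤ :=
  ∑ k ∈ Finset.range (n + 1), (cf n s k : PowerSeries ℤ) * (e4Z ^ r * (e6Z ^ (2 * k + s) * deltaZ ^ (n - k)))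

lemma cc_hZ (n r s : ℕ) : PowerSeries.constantCoeff (hZ n r s) = 1 := by
  have hd : PowerSeries.constantCoeff deltaZ = 0 := by rw [deltaZ_eq_X_mul]; simp
  rw [hZ, map_sum, Finset.sum_range_succ, Finset.sum_eq_zero]
  · simp [cc_e4Z, cc_e6Z, cf_self]
  · intro k hk
    have : n - k ≠ 0 := by have := Finset.mem_range.1 hk; omega
    simp [hd, this]

lemma hZ_ode (l n r s : ℕ) (hr : r = 0 ∨ r = 1) (hs : s = 0 ∨ s = 1) (hl : l = 12 * n + 4 * r + 6 * s + 1)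
    (k : Type*) [Field k] [CharP k l] : 144 * thD k (thD k (toR k (hZ n r s))) = 0 := by
  have c2 : 12 * thD k (toR k e2Z) = toR k e2Z ^ 2 - toR k e4Z := by
    have := congrArg (toR k) ramZ2
    simpa only [map_mul, map_sub, map_add, map_pow, map_thD, map_ofNat] using this
  have c4 : 12 * thD k (toR k e4Z) = 4 * (toR k e2Z * toR k e4Z - toR k e6Z) := by
    have := congrArg (toR k) ramZ4
    simpa only [map_mul, map_sub, map_add, map_pow, map_thD, map_ofNat] using this
  have c6 : 12 * thD k (toR k e6Z) = 6 * (toR k e2Z * toR k e6Z - toR k e4Z ^ 2) := by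
    have := congrArg (toR k) ramZ6
    simpa only [map_mul, map_sub, map_add, map_pow, map_thD, map_ofNat] using this
  have cD : 12 * thD k (toR k deltaZ) = 12 * (toR k e2Z * toR k deltaZ) := by
    have := congrArg (toR k) ramZD
    simpa only [map_mul, map_sub, map_add, map_pow, map_thD, map_ofNat] using this
  have cE : toR k e4Z ^ 3 = toR k e6Z ^ 2 + 1728 * toR k deltaZ := by
    have := congrArg (toR k) deltaZ_eq'
    simpa only [map_mul, map_sub, map_add, map_pow, map_thD, map_ofNat] using this
  have e : toR k (hZ n r s) = ∑ j ∈ Finset.range (n + 1), (cf n s j : PowerSeries k) * (toR k e4Z ^ r * (toR k e6Z ^ (2 * j + s) * toR k deltaZ ^ (n - j))) := by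
    rw [hZ, map_sum]
    simp only [map_mul, map_pow, map_intCast]
  have hw : (4 * (r : PowerSeries k) + 6 * (s : PowerSeries k) + 12 * (n : PowerSeries k)) = -1 := by
    have : (l : k) = 0 := CharP.cast_eq_zero k l
    have h2 : ((l : ℕ) : PowerSeries k) = 0 := by
      rw [← map_natCast (PowerSeries.C (R := k)), this, map_zero]
    rw [hl] at h2
    push_cast at h2
    linear_combination h2
  rw [e]
  exact ode_sum (θ := thD k) (P := toR k e2Z) (Q := toR k e4Z) (R := toR k e6Z) (D := toR k deltaZ) c2 c4 c6 cD cE n r s hr hs hw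

lemma hZ_one (l n r s : ℕ) [Fact l.Prime] (h5 : 5 ≤ l) (hr : r = 0 ∨ r = 1) (hs : s = 0 ∨ s = 1) (hl : l = 12 * n + 4 * r + 6 * s + 1)
    (k : Type*) [Field k] [CharP k l] : ∃ c : PowerSeries k, toR k (hZ n r s) = 1 + PowerSeries.X ^ l * c := by
  have h0 : 144 * thD k (thD k (toR k (hZ n r s))) = 0 := hZ_ode l n r s hr hs hl k
  have hl' : l.Prime := Fact.out
  have hd : (PowerSeries.X : PowerSeries k) ^ l ∣ toR k (hZ n r s) - 1 := by
    rw [PowerSeries.X_pow_dvd_iff]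
    intro m hm
    rcases Nat.eq_zero_or_pos m with rfl | hm0
    · have := cc_hZ n r s
      rw [PowerSeries.coeff_zero_eq_constantCoeff_apply, map_sub, cc_toR, this]
      simp
    · have h1 := congrArg (PowerSeries.coeff m) h0
      rw [show (144 : PowerSeries k) = PowerSeries.C (144 : k) from (map_ofNat _ _).symm, PowerSeries.coeff_C_mul, coeff_thD, coeff_thD] at h1
      have hmk : (m : k) ≠ 0 := by
        rw [Ne, CharP.cast_eq_zero_iff k l]
        exact fun h => absurd (Nat.le_of_dvd hm0 h) (by omega)
      have h144 : (144 : k) ≠ 0 := by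
        have : ((144 : ℕ) : k) ≠ 0 := by
          rw [Ne, CharP.cast_eq_zero_iff k l, show 144 = 2 ^ 4 * 3 ^ 2 by norm_num, hl'.dvd_mul]
          rintro (h | h)
          · have := Nat.le_of_dvd (by norm_num) (hl'.dvd_of_dvd_pow h); omega
          · have := Nat.le_of_dvd (by norm_num) (hl'.dvd_of_dvd_pow h); omega
        exact_mod_cast this
      simp only [map_zero, mul_eq_zero, h144, hmk, false_or] at h1
      rw [map_sub, h1, PowerSeries.coeff_one, if_neg (by omega), sub_zero]
  obtain ⟨c, hc⟩ := hd
  exact ⟨c, by rw [← hc]; ring⟩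

end H7

namespace H7
open UpperHalfPlane hiding I
open Complex ModularForm
open scoped Manifold MatrixGroups ModularForm Topology
open Function.Periodic (qParam)

lemma qP1 (l : ℕ) (hl : l ≠ 0) (τ : ℍ) : qParam (1:ℕ) τ = qParam l τ ^ l := by
  simp only [qParam]
  rw [← Complex.exp_nat_mul]
  congr 1
  have : (l : ℂ) ≠ 0 := by exact_mod_cast hl
  push_cast
  field_simp

lemma qP_none (l : ℕ) (hl : l.Prime) (τ : ℍ) : qParam (1:ℕ) (act (gam l none) τ) = qParam l τ ^ (l ^ 2) := by
  rw [act_coe (gam_det_pos l hl _)]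
  simp only [qParam, nmr, den, gam]
  rw [← Complex.exp_nat_mul]
  congr 1
  have : (l : ℂ) ≠ 0 := by exact_mod_cast hl.ne_zero
  simp
  field_simp

lemma qP_some (l : ℕ) (hl : l.Prime) (b : Fin l) (τ : ℍ) : qParam (1:ℕ) (act (gam l (some b)) τ) = Complex.exp (2 * Real.pi * Complex.I / l) ^ (b : ℕ) * qParam l τ := by
  rw [act_coe (gam_det_pos l hl _)]
  simp only [qParam, nmr, den, gam]
  rw [← Complex.exp_nat_mul, ← Complex.exp_add]
  congr 1
  have : (l : ℂ) ≠ 0 := by exact_mod_cast hl.ne_zero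
  simp
  field_simp
  ring

lemma rescale_map {R S : Type*} [CommRing R] [CommRing S] (φ : R →+* S) (c : R) (a : PowerSeries R) :
    PowerSeries.map φ (PowerSeries.rescale c a) = PowerSeries.rescale (φ c) (PowerSeries.map φ a) := by
  ext n; simp

lemma hasExp_sub {V : Type*} [CommRing V] (φ : V →+* ℂ) {l : ℕ} {x : PowerSeries ℤ} {f : ℍ → ℂ} (h : HasExp 1 (toC x) f)
    (σ : ℍ → ℍ) (c : V) (k : ℕ) (hk : k ≠ 0) (hσ : ∀ τ, qParam (1:ℕ) (σ τ) = φ c * qParam l τ ^ k) :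
    HasExp l (PowerSeries.map φ (PowerSeries.expand k hk (PowerSeries.rescale c (toR V x)))) (fun τ => f (σ τ)) := by
  rw [PowerSeries.map_expand, rescale_map, map_toR]
  exact h.comp σ (φ c) k hk hσ

/-- Frobenius on series with integral coefficients -/
lemma expand_frob {k : Type*} [Field k] (l : ℕ) [Fact l.Prime] [CharP k l] (hl : l ≠ 0) (x : PowerSeries ℤ) :
    PowerSeries.expand l hl (toR k x) = toR k x ^ l := by
  have : ExpChar k l := ExpChar.prime Fact.out
  rw [← MvPowerSeries.map_frobenius_expand (p := l) (hp := hl)]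
  have e : (PowerSeries.map (frobenius k l)) (PowerSeries.expand l hl (toR k x)) = PowerSeries.expand l hl (toR k x) := by
    rw [PowerSeries.map_expand, map_toR]
  exact e.symm

section pf
variable (l : ℕ) [Fact l.Prime] {V k : Type*} [CommRing V] [Field k] [CharP k l] (φ : V →+* ℂ) (hφ : Function.Injective φ) (ρ : V →+* k)
  (ζ : V) (hζ : φ ζ = Complex.exp (2 * Real.pi * Complex.I / l)) (hζ1 : ρ ζ = 1)

include hφ hζ hζ1

lemma zeta_pow : ζ ^ l = 1 := by
  apply hφ
  have hl : l.Prime := Fact.out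
  rw [map_pow, hζ, map_one]
  exact (Complex.isPrimitiveRoot_exp l hl.ne_zero).pow_eq_one

theorem pF_exists : ∃ p : V[X], p.natDegree ≤ 2 * l ∧ p.coeff (2 * l) = -1 ∧ (∀ τ, Ffun l τ = p.eval₂ φ (kj τ)) ∧
    p.map ρ = - (X ^ l - X) ^ 2 := by
  have hl : l.Prime := Fact.out
  have hl0 := hl.ne_zero
  have hll : l ^ 2 ≠ 0 := pow_ne_zero 2 hl0
  let J := toR V jZ
  let a0 : PowerSeries V := PowerSeries.X ^ (l ^ 2 - l) * PowerSeries.expand l hl0 (PowerSeries.rescale 1 J) - PowerSeries.expand (l ^ 2) hll (PowerSeries.rescale 1 J)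
  let a1 : Fin l → PowerSeries V := fun b => PowerSeries.expand l hl0 (PowerSeries.rescale 1 J) - PowerSeries.X ^ (l - 1) * PowerSeries.C (ζ ^ ((l - 1) * b)) * PowerSeries.expand 1 one_ne_zero (PowerSeries.rescale (ζ ^ (b:ℕ)) J)
  let a := a0 * ∏ b, a1 b
  have hz := zeta_pow l φ hφ ρ ζ hζ hζ1
  have hq0 : ∀ τ : ℍ, qParam l τ ≠ 0 := fun τ => by simp [qParam]
  have hJ := hasExp_sub φ (l := l) hasExp_j (fun τ => τ) 1 l hl0 (fun τ => by rw [map_one, one_mul]; exact qP1 l hl0 τ)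
  have hJn := hasExp_sub φ (l := l) hasExp_j (fun τ => act (gam l none) τ) 1 (l ^ 2) hll (fun τ => by rw [map_one, one_mul]; exact qP_none l hl τ)
  have hJs := fun b : Fin l => hasExp_sub φ (l := l) hasExp_j (fun τ => act (gam l (some b)) τ) (ζ ^ (b:ℕ)) 1 one_ne_zero (fun τ => by rw [map_pow, hζ, pow_one]; exact qP_some l hl b τ)
  have h0 : HasExp l (PowerSeries.map φ a0) (fun τ => qParam l τ ^ (l ^ 2) * (kj τ - kj (act (gam l none) τ))) := by
    have := (((HasExp.X l).pow (l ^ 2 - l)).mul hJ).sub hJn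
    simp only [a0, map_sub, map_mul, map_pow, PowerSeries.map_X]
    refine this.congr fun τ => ?_
    rw [qP_none l hl, qP1 l hl0]
    have : qParam l τ ^ (l ^ 2) = qParam l τ ^ (l ^ 2 - l) * qParam l τ ^ l := by
      rw [← pow_add, Nat.sub_add_cancel]; nlinarith [hl.two_le]
    rw [mul_sub]
    conv_rhs => rw [this]
    rw [this]
    ring
  have h1 : ∀ b, HasExp l (PowerSeries.map φ (a1 b)) (fun τ => qParam l τ ^ l * (kj τ - kj (act (gam l (some b)) τ))) := by
    intro b
    have := hJ.sub ((((HasExp.X l).pow (l - 1)).mul (HasExp.const l (φ (ζ ^ ((l - 1) * b))))).mul (hJs b))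
    simp only [a1, map_sub, map_mul, map_pow, PowerSeries.map_X, PowerSeries.map_C] at this ⊢
    refine this.congr fun τ => ?_
    rw [qP_some l hl, qP1 l hl0, ← hζ]
    have e1 : qParam l τ ^ l = qParam l τ ^ (l - 1) * qParam l τ := by
      rw [← pow_succ, Nat.sub_add_cancel hl.one_le]
    have e2 : φ ζ ^ ((l - 1) * b) * φ ζ ^ (b : ℕ) = 1 := by
      rw [← pow_add, ← map_pow, show (l - 1) * (b:ℕ) + b = l * b by
        rw [Nat.sub_mul, one_mul, Nat.sub_add_cancel]; exact Nat.le_mul_of_pos_left _ hl.pos, pow_mul, hz]; simp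
    rw [mul_sub]
    conv_rhs => rw [e1]
    rw [e1]
    linear_combination (-qParam l τ ^ (l - 1) * qParam l τ * kj (act (gam l (some b)) τ)) * e2
  have ha : HasExp l (PowerSeries.map φ a) (fun τ => qParam (1:ℕ) τ ^ (2 * l) * Ffun l τ) := by
    have := h0.mul (HasExp.prod Finset.univ _ _ fun b _ => h1 b)
    simp only [a, map_mul, map_prod]
    refine this.congr fun τ => ?_
    rw [Finset.prod_mul_distrib, Finset.prod_const, Finset.card_univ, Fintype.card_fin, Ffun, Fintype.prod_option, qP1 l hl0]
    ring
  obtain ⟨b, hb, hbe⟩ := descent φ hφ l hl0 _ a (fun τ => by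
    rw [Ffun_inv l hl]
    congr 2
    simp only [qParam, UpperHalfPlane.modular_T_smul]
    rw [UpperHalfPlane.coe_vadd, mul_add, add_div, Complex.exp_add]
    simp) ha
  obtain ⟨p, hp, hpe, hph⟩ := QEP' φ hφ (2 * l) _ b (Ffun_inv l hl) hbe
  refine ⟨p, hp, ?_, hpe, ?_⟩
  · have h2 : PowerSeries.constantCoeff a = PowerSeries.constantCoeff b := by rw [hb]; simp
    rw [← cc_hom, ← hph, ← h2]
    have : l ^ 2 - l ≠ 0 := by
      have := hl.two_le
      have : l < l ^ 2 := by nlinarith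
      omega
    have t : l - 1 ≠ 0 := by have := hl.two_le; omega
    simp [a, a0, a1, this, t, J, cc_toR, cc_jZ]
  · have hfr := expand_frob (k := k) l hl0 jZ
    set Jk := toR k jZ with hJk
    set G := Jk ^ l - PowerSeries.X ^ (l - 1) * Jk with hG
    have hGe : PowerSeries.expand l hl0 G = G ^ l := by
      rw [hG, map_sub, map_mul, map_pow, map_pow, hfr, PowerSeries.expand_X]
      have : CharP (PowerSeries k) l := charP_of_injective_ringHom (PowerSeries.C_injective (R := k)) l
      rw [sub_pow_char, mul_pow, ← pow_mul, ← pow_mul, ← pow_mul, mul_comm l (l-1)]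
    have r0 : PowerSeries.map ρ a0 = - PowerSeries.expand l hl0 G := by
      simp only [a0, J, PowerSeries.rescale_one, RingHom.id_apply, map_sub, map_mul, map_pow, PowerSeries.map_X, PowerSeries.map_expand, map_toR, G]
      rw [← hJk]
      have : PowerSeries.expand (l ^ 2) hll Jk = PowerSeries.expand l hl0 (Jk ^ l) := by
        rw [← hfr, ← PowerSeries.expand_mul]; congr 1; ring
      rw [this, PowerSeries.expand_X, ← pow_mul, map_pow, show l ^ 2 - l = l * (l - 1) by rw [Nat.mul_sub, sq, mul_one]]
      ring
    have r1 : ∀ b, PowerSeries.map ρ (a1 b) = G := by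
      intro b
      simp only [a1, J, PowerSeries.rescale_one, RingHom.id_apply, map_sub, map_mul, map_pow, PowerSeries.map_X, PowerSeries.map_expand, map_toR, PowerSeries.map_C, rescale_map, hζ1, one_pow]
      rw [← hJk, hfr, hG]
      simp
    have ra : PowerSeries.map ρ a = PowerSeries.expand l hl0 (- G ^ 2) := by
      simp only [a, map_mul, map_prod, r0, r1, Finset.prod_const, Finset.card_univ, Fintype.card_fin]
      rw [← hGe, map_neg, map_pow]; ring
    have hinj : PowerSeries.map ρ b = - G ^ 2 := by
      rw [hb, PowerSeries.map_expand] at ra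
      generalize - G ^ 2 = G2 at ra ⊢
      ext n
      have := congrArg (PowerSeries.coeff (l * n)) ra
      simpa [PowerSeries.coeff_expand, hl0] using this
    have hdeg : (X ^ l - X : k[X]).natDegree ≤ l := by
      compute_degree!
      exact hl.one_le
    have hhom : hom (2 * l) (-(X ^ l - X) ^ 2 : k[X]) = - G ^ 2 := by
      rw [hom_neg, hom_pow hdeg, hom_sub, hom_X_pow le_rfl]
      have := hom_X_pow (R := k) hl.one_le
      rw [pow_one, pow_one] at this
      rw [this, hG]; simp; ring
    rw [← sub_eq_zero]
    apply hom_inj (2 * l)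
    · refine (natDegree_sub_le _ _).trans (max_le ((natDegree_map_le).trans hp) ?_)
      rw [natDegree_neg]
      exact natDegree_pow_le.trans (Nat.mul_le_mul_left 2 hdeg)
    · rw [hom_sub, ← hom_map, ← hph, hinj, hhom, sub_self]
      exact dvd_zero _

/-- the level one Hasse polynomial in `j` -/
noncomputable def gpol (R : Type*) [CommRing R] (n r s : ℕ) : R[X] :=
  X ^ (4 * r) * (X - C 1728) ^ (6 * s) * (∑ i ∈ Finset.range (n + 1), C (cf n s i : R) * (X - C 1728) ^ i) ^ 12

end pf

lemma dd_X : (PowerSeries.X : PowerSeries ℤ) = deltaZ * dinvZ := by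
  rw [deltaZ_eq_X_mul, mul_assoc, dZ_mul_inv, mul_one]

lemma gsum_deg {R : Type*} [CommRing R] (n s : ℕ) : (∑ i ∈ Finset.range (n + 1), C (cf n s i : R) * (X - C 1728) ^ i).natDegree ≤ n := by
  apply natDegree_sum_le_of_forall_le
  intro i hi
  have : i ≤ n := by simpa [Nat.lt_succ_iff] using hi
  refine (natDegree_C_mul_le _ _).trans ((natDegree_pow_le).trans ?_)
  have : (X - C 1728 : R[X]).natDegree ≤ 1 := natDegree_X_sub_C_le _
  nlinarith

lemma gpol_deg {R : Type*} [CommRing R] (n r s : ℕ) : (gpol R n r s).natDegree ≤ 4 * r + 6 * s + 12 * n := by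
  refine natDegree_mul_le.trans (add_le_add (natDegree_mul_le.trans (add_le_add (natDegree_X_pow_le _) ?_)) ?_)
  · refine natDegree_pow_le.trans ?_
    have : (X - C 1728 : R[X]).natDegree ≤ 1 := natDegree_X_sub_C_le _
    nlinarith
  · exact natDegree_pow_le.trans (Nat.mul_le_mul_left 12 (gsum_deg n s))

lemma hom_gpol {R : Type*} [CommRing R] (n r s : ℕ) : hom (4 * r + 6 * s + 12 * n) (gpol R n r s) =
    toR R (hZ n r s) ^ 12 * toR R dinvZ ^ (4 * r + 6 * s + 12 * n) := by
  have hX : (X : R[X]).natDegree ≤ 1 := natDegree_X_le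
  have hX1 : (X - C 1728 : R[X]).natDegree ≤ 1 := natDegree_X_sub_C_le _
  have hXe : (PowerSeries.X : PowerSeries R) = toR R deltaZ * toR R dinvZ := by
    rw [← map_mul, ← dd_X]; simp
  have e1 : hom 1 (X : R[X]) = toR R e4Z ^ 3 * toR R dinvZ := by
    have := hom_X_pow (R := R) (le_refl 1)
    rw [pow_one] at this
    rw [this, jZ]; simp
  have e2 : hom 1 (X - C 1728 : R[X]) = toR R e6Z ^ 2 * toR R dinvZ := by
    rw [hom_sub, e1, hom_C, pow_one, hXe, ← map_pow, deltaZ_eq', map_add, map_mul]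
    simp only [map_ofNat, map_pow]
    ring
  have e3 : hom n (∑ i ∈ Finset.range (n + 1), C (cf n s i : R) * (X - C 1728) ^ i) = 
      (∑ i ∈ Finset.range (n + 1), (cf n s i : PowerSeries R) * (toR R e6Z ^ (2 * i) * toR R deltaZ ^ (n - i))) * toR R dinvZ ^ n := by
    rw [hom_sum, Finset.sum_mul]
    refine Finset.sum_congr rfl fun i hi => ?_
    have hi' : i ≤ n := by simpa [Nat.lt_succ_iff] using hi
    rw [hom_C_mul]
    obtain ⟨m, rfl⟩ := Nat.exists_eq_add_of_le hi'
    have : hom (i * 1 + m) ((X - C 1728 : R[X]) ^ i * 1) = hom 1 (X - C 1728 : R[X]) ^ i * PowerSeries.X ^ m := by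
      rw [hom_mul (by refine natDegree_pow_le.trans ?_; nlinarith) (by simp), hom_pow hX1, hom_one]
    rw [mul_one, mul_one] at this
    rw [this, e2, hXe, Nat.add_sub_cancel_left]
    simp only [map_intCast]
    ring
  have d1 : (X ^ (4 * r) : R[X]).natDegree ≤ 4 * r * 1 := by rw [mul_one]; exact natDegree_X_pow_le _
  have d2 : ((X - C 1728 : R[X]) ^ (6 * s)).natDegree ≤ 6 * s * 1 := natDegree_pow_le.trans (Nat.mul_le_mul_left _ hX1)
  have d3 := natDegree_pow_le.trans (Nat.mul_le_mul_left 12 (gsum_deg (R := R) n s))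
  have main : hom (4 * r * 1 + 6 * s * 1 + 12 * n) (gpol R n r s) = hom 1 (X : R[X]) ^ (4 * r) * hom 1 (X - C 1728 : R[X]) ^ (6 * s) * hom n (∑ i ∈ Finset.range (n + 1), C (cf n s i : R) * (X - C 1728) ^ i) ^ 12 := by
    rw [gpol, hom_mul (natDegree_mul_le.trans (add_le_add d1 d2)) d3, hom_mul d1 d2, hom_pow hX, hom_pow hX1, hom_pow (gsum_deg n s)]
  rw [mul_one, mul_one] at main
  rw [main, e1, e2, e3]
  have e4 : toR R (hZ n r s) = toR R e4Z ^ r * toR R e6Z ^ s * ∑ i ∈ Finset.range (n + 1), (cf n s i : PowerSeries R) * (toR R e6Z ^ (2 * i) * toR R deltaZ ^ (n - i)) := by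
    rw [hZ, map_sum, Finset.mul_sum]
    refine Finset.sum_congr rfl fun i hi => ?_
    simp only [map_mul, map_pow, map_intCast, pow_add]
    ring
  rw [e4]
  ring

section pY
variable (l : ℕ) [Fact l.Prime] {V k : Type*} [CommRing V] [Field k] [CharP k l] (φ : V →+* ℂ) (hφ : Function.Injective φ) (ρ : V →+* k)
  (ζ : V) (hζ : φ ζ = Complex.exp (2 * Real.pi * Complex.I / l)) (hζ1 : ρ ζ = 1)

include hφ hζ hζ1

theorem pY_exists (n r s : ℕ) (h5 : 5 ≤ l) (hr : r = 0 ∨ r = 1) (hs : s = 0 ∨ s = 1) (hlr : l = 12 * n + 4 * r + 6 * s + 1)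
    (A B y : V) (hB : ρ B = 0) 
    (hinv : Inv (fun τ => (φ A - φ B * (Dl (act (gam l none) τ) / Dl τ)) * ∏ b : Fin l, (φ y - phi l τ (gam l (some b))))) :
    ∃ p : V[X], (∀ τ, (φ A - φ B * (Dl (act (gam l none) τ) / Dl τ)) * ∏ b : Fin l, (φ y - phi l τ (gam l (some b))) = p.eval₂ φ (kj τ)) ∧
    p.map ρ = C (ρ A) * (C (ρ y) ^ l - gpol k n r s) := by
  have hl : l.Prime := Fact.out
  have hl0 := hl.ne_zero
  have hlc : (l : ℂ) ≠ 0 := by exact_mod_cast hl0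
  have hll : l ^ 2 ≠ 0 := pow_ne_zero 2 hl0
  let d := toR V dZ
  let di := toR V dinvZ
  let a0 : PowerSeries V := PowerSeries.C A - PowerSeries.C B * (PowerSeries.X ^ (l ^ 2 - l) * (PowerSeries.expand (l ^ 2) hll (PowerSeries.rescale 1 d) * PowerSeries.expand l hl0 (PowerSeries.rescale 1 di)))
  let a1 : Fin l → PowerSeries V := fun b => PowerSeries.C y * PowerSeries.X ^ (l - 1) - PowerSeries.C (ζ ^ (b : ℕ)) * (PowerSeries.expand 1 one_ne_zero (PowerSeries.rescale (ζ ^ (b:ℕ)) d) * PowerSeries.expand l hl0 (PowerSeries.rescale 1 di))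
  let a := a0 * ∏ b, a1 b
  have hq0 : ∀ τ : ℍ, qParam l τ ≠ 0 := fun τ => by simp [qParam]
  have hz0 : φ ζ ≠ 0 := by rw [hζ]; exact Complex.exp_ne_zero _
  have hdi := hasExp_sub φ (l := l) hasExp_dinv (fun τ => τ) 1 l hl0 (fun τ => by rw [map_one, one_mul]; exact qP1 l hl0 τ)
  have hdn := hasExp_sub φ (l := l) hasExp_d (fun τ => act (gam l none) τ) 1 (l ^ 2) hll (fun τ => by rw [map_one, one_mul]; exact qP_none l hl τ)
  have hds := fun b : Fin l => hasExp_sub φ (l := l) hasExp_d (fun τ => act (gam l (some b)) τ) (ζ ^ (b:ℕ)) 1 one_ne_zero (fun τ => by rw [map_pow, hζ, pow_one]; exact qP_some l hl b τ)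
  have h0 : HasExp l (PowerSeries.map φ a0) (fun τ => φ A - φ B * (Dl (act (gam l none) τ) / Dl τ)) := by
    have := (HasExp.const l (φ A)).sub ((HasExp.const l (φ B)).mul (((HasExp.X l).pow (l ^ 2 - l)).mul (hdn.mul hdi)))
    simp only [a0, map_sub, map_mul, map_pow, PowerSeries.map_X, PowerSeries.map_C]
    refine this.congr fun τ => ?_
    rw [qP_none l hl, qP1 l hl0]
    have e : qParam l τ ^ (l ^ 2) = qParam l τ ^ (l ^ 2 - l) * qParam l τ ^ l := by
      rw [← pow_add, Nat.sub_add_cancel]; nlinarith [hl.two_le]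
    have := hq0 τ
    have := delta_ne τ
    rw [e]
    field_simp
  have h1 : ∀ b, HasExp l (PowerSeries.map φ (a1 b)) (fun τ => qParam l τ ^ (l - 1) * (φ y - phi l τ (gam l (some b)))) := by
    intro b
    have := ((HasExp.const l (φ y)).mul ((HasExp.X l).pow (l - 1))).sub ((HasExp.const l (φ (ζ ^ (b : ℕ)))).mul ((hds b).mul hdi))
    simp only [a1, map_sub, map_mul, map_pow, PowerSeries.map_X, PowerSeries.map_C] at this ⊢
    refine this.congr fun τ => ?_
    rw [qP_some l hl, qP1 l hl0, ← hζ]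
    have e1 : qParam l τ ^ l = qParam l τ ^ (l - 1) * qParam l τ := by
      rw [← pow_succ, Nat.sub_add_cancel hl.one_le]
    have hd : den (gam l (some b)) τ = l := by simp [den, gam]
    have := hq0 τ
    have := delta_ne τ
    rw [e1, phi, hd]
    field_simp
  have ha : HasExp l (PowerSeries.map φ a) (fun τ => qParam (1:ℕ) τ ^ (l - 1) * ((φ A - φ B * (Dl (act (gam l none) τ) / Dl τ)) * ∏ b : Fin l, (φ y - phi l τ (gam l (some b))))) := by
    have := h0.mul (HasExp.prod Finset.univ _ _ fun b _ => h1 b)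
    simp only [a, map_mul, map_prod]
    refine this.congr fun τ => ?_
    rw [Finset.prod_mul_distrib, Finset.prod_const, Finset.card_univ, Fintype.card_fin, qP1 l hl0]
    ring
  obtain ⟨b, hb, hbe⟩ := descent φ hφ l hl0 _ a (fun τ => by
    have h1 := hinv ModularGroup.T τ
    simp only at h1
    rw [h1]
    congr 2
    simp only [qParam, UpperHalfPlane.modular_T_smul]
    rw [UpperHalfPlane.coe_vadd, mul_add, add_div, Complex.exp_add]
    simp) ha
  obtain ⟨p, hp, hpe, hph⟩ := QEP' φ hφ (l - 1) _ b hinv hbe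
  refine ⟨p, hpe, ?_⟩
  have hfr := expand_frob (k := k) l hl0 dinvZ
  have hfr2 := expand_frob (k := k) l hl0 dZ
  set dk := toR k dZ with hdk
  set dik := toR k dinvZ with hdik
  have hdd : dk * dik = 1 := by rw [hdk, hdik, ← map_mul, dZ_mul_inv, map_one]
  set G := PowerSeries.C (ρ y) ^ l * PowerSeries.X ^ (l - 1) - dik ^ (l - 1) with hG
  have hpw : dk * dik ^ l = dik ^ (l - 1) := by
    rw [← Nat.sub_add_cancel hl.one_le, pow_succ, Nat.add_sub_cancel]
    linear_combination dik ^ (l - 1) * hdd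
  have r0 : PowerSeries.map ρ a0 = PowerSeries.C (ρ A) := by
    simp only [a0, map_sub, map_mul, PowerSeries.map_C, hB, map_zero, zero_mul, sub_zero]
  have r1 : ∀ b, PowerSeries.map ρ (a1 b) = PowerSeries.C (ρ y) * PowerSeries.X ^ (l - 1) - dik ^ (l - 1) := by
    intro b
    simp only [a1, d, di, PowerSeries.rescale_one, RingHom.id_apply, map_sub, map_mul, map_pow, PowerSeries.map_X, PowerSeries.map_expand, map_toR, PowerSeries.map_C, rescale_map, hζ1, one_pow]
    rw [← hdk, ← hdik, hfr]
    simp [hpw]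
  have ra : PowerSeries.map ρ a = PowerSeries.expand l hl0 (PowerSeries.C (ρ A) * G) := by
    simp only [a, map_mul, map_prod, r0, r1, Finset.prod_const, Finset.card_univ, Fintype.card_fin, G, map_sub, map_pow, PowerSeries.expand_C, hfr, PowerSeries.expand_X]
    have : CharP (PowerSeries k) l := charP_of_injective_ringHom (PowerSeries.C_injective (R := k)) l
    rw [sub_pow_char, mul_pow]; ring
  have hinj : PowerSeries.map ρ b = PowerSeries.C (ρ A) * G := by
    rw [hb, PowerSeries.map_expand] at ra
    generalize PowerSeries.C (ρ A) * G = G2 at ra ⊢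
    ext n
    have := congrArg (PowerSeries.coeff (l * n)) ra
    simpa [PowerSeries.coeff_expand, hl0] using this
  obtain ⟨c, hc⟩ := hZ_one l n r s h5 hr hs hlr k
  have hl1 : l - 1 = 4 * r + 6 * s + 12 * n := by omega
  rw [← sub_eq_zero]
  apply hom_inj (l - 1)
  · refine (natDegree_sub_le _ _).trans (max_le ((natDegree_map_le).trans hp) ?_)
    refine (natDegree_C_mul_le _ _).trans ((natDegree_sub_le _ _).trans (max_le ?_ ?_))
    · rw [← C_pow]; simp
    · rw [hl1]; exact gpol_deg n r s
  · have e : hom (l - 1) (gpol k n r s) = toR k (hZ n r s) ^ 12 * dik ^ (l - 1) := by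
      rw [hl1]; exact hom_gpol n r s
    rw [hom_sub, ← hom_map, ← hph, hinj, hom_C_mul, hom_sub, e, ← C_pow, hom_C, hc, hG, ← map_pow, Nat.sub_add_cancel hl.one_le]
    have : (1 : PowerSeries k) + PowerSeries.X ^ l * c - 1 ∣ (1 + PowerSeries.X ^ l * c) ^ 12 - 1 ^ 12 := sub_dvd_pow_sub_pow _ _ _
    obtain ⟨w, hw⟩ := this
    refine ⟨PowerSeries.C (ρ A) * dik ^ (l - 1) * c * w, ?_⟩
    linear_combination (PowerSeries.C (ρ A) * dik ^ (l - 1)) * hw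

end pY
end H7

namespace H7
open UpperHalfPlane hiding I
open Complex ModularForm
open scoped Manifold MatrixGroups ModularForm Topology
open Function.Periodic (qParam)

def Wt (k : ℤ) (f : ℍ → ℂ) : Prop := ∀ (γ : SL(2, ℤ)) (τ : ℍ), f (γ • τ) = denom γ τ ^ k * f τ

lemma Wt.slash {k : ℤ} {f : ℍ → ℂ} (h : Wt k f) (γ : SL(2, ℤ)) : f ∣[k] γ = f := by
  ext τ
  rw [slash_smul_fun]
  have : f (γ • τ) = _ := h γ τ
  rw [this, mul_comm, ← mul_assoc, ← zpow_add₀ (denom_ne_zero _ _)]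
  simp

lemma wt_form {k : ℤ} (f : ModularForm 𝒮ℒ k) : Wt k f := fun γ τ => form_smul (slash_form f γ) τ

lemma Wt.mul {k m : ℤ} {f g : ℍ → ℂ} (h : Wt k f) (h' : Wt m g) : Wt (k + m) (fun τ => f τ * g τ) := by
  intro γ τ
  simp only [h γ τ, h' γ τ]
  rw [zpow_add₀ (denom_ne_zero _ _)]; ring

lemma Wt.sub {k : ℤ} {f g : ℍ → ℂ} (h : Wt k f) (h' : Wt k g) : Wt k (fun τ => f τ - g τ) := by
  intro γ τ
  simp only [h γ τ, h' γ τ]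
  ring

lemma Wt.smul {k : ℤ} {f : ℍ → ℂ} (h : Wt k f) (c : ℂ) : Wt k (fun τ => c * f τ) := by
  intro γ τ
  simp only [h γ τ]
  ring

lemma Wt.pow {k : ℤ} {f : ℍ → ℂ} (h : Wt k f) (n : ℕ) : Wt (n * k) (fun τ => f τ ^ n) := by
  intro γ τ
  simp only [h γ τ]
  rw [mul_pow, mul_comm (n : ℤ), zpow_mul]; simp

lemma wt_delta : Wt 12 (fun τ => Dl τ) := fun γ τ => form_smul (slash_delta γ) τ

lemma Wt.div {k m : ℤ} {f g : ℍ → ℂ} (h : Wt k f) (h' : Wt m g) : Wt (k - m) (fun τ => f τ / g τ) := by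
  intro γ τ
  simp only [h γ τ, h' γ τ]
  rw [zpow_sub₀ (denom_ne_zero _ _)]; rw [mul_div_mul_comm]

lemma exists_46 (n : ℕ) (hn : n ≠ 1) : ∃ a b : ℕ, 4 * a + 6 * b = 2 * n := by
  rcases Nat.even_or_odd n with ⟨m, hm⟩ | ⟨m, hm⟩
  · exact ⟨m, 0, by omega⟩
  · exact ⟨m - 1, 1, by omega⟩

section scal
variable {τ₁ τ₂ : ℍ} {lam : ℂ}

lemma scal_form (h4 : E₄ τ₁ = lam ^ 4 * E₄ τ₂) (h6 : E₆ τ₁ = lam ^ 6 * E₆ τ₂) 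
    (hD : Dl τ₁ = lam ^ 12 * Dl τ₂) : ∀ (n : ℕ) (f : ℍ → ℂ) (a : PowerSeries ℂ), Wt (2 * n) f → HasExp 1 a f →
     f τ₁ = lam ^ (2 * n) * f τ₂ := by
  have hl : lam ≠ 0 := by
    rintro rfl
    exact delta_ne τ₁ (by rw [hD]; simp)
  intro n
  induction n using Nat.strong_induction_on with
  | _ n ih =>
  intro f a hf ha
  -- vanishing constant coefficient
  have key : ∀ (g : ℍ → ℂ) (b : PowerSeries ℂ), Wt (2 * n) g → HasExp 1 b g → PowerSeries.coeff 0 b = 0 →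
     g τ₁ = lam ^ (2 * n) * g τ₂ := by
    intro g b hg hb h0
    by_cases hn : n < 6
    · rw [form_zero_of_lt (by lia) g hg.slash hb h0]; simp
    · obtain ⟨b', rfl⟩ := PowerSeries.X_dvd_iff.2 (by simpa using h0 : PowerSeries.constantCoeff b = 0)
      have h1 := hb.shift.mul hasExp_dinv
      have h2 := ih (n - 6) (by omega) _ _ ?_ (h1.congr (g := fun τ => g τ / Dl τ) ?_)
      · have h3 : lam ^ (2 * n) = lam ^ (2 * (n - 6)) * lam ^ 12 := by rw [← pow_add]; congr 1; omega
        rw [div_eq_iff (delta_ne _), hD, mul_assoc] at h2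
        rw [h2, h3]
        field_simp [delta_ne τ₂]
      · have := hg.div wt_delta
        convert this using 1
        push_cast [Nat.cast_sub (by omega : 6 ≤ n)]; ring
      · intro τ
        have := qParam_ne (N := 1) τ
        have := delta_ne τ
        field_simp
  by_cases hn : n = 1
  · subst hn
    have wE4 := wt_form E₄
    have wE6 := wt_form E₆
    set c := PowerSeries.coeff 0 a
    have e1 : ∀ τ, f τ * E₄ τ - c * E₆ τ = 0 := by
      have := form_zero_of_lt (k := 6) (by norm_num) (fun τ => f τ * E₄ τ - c * E₆ τ) 
        (Wt.slash ((hf.mul wE4).sub (wE6.smul c)))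
        ((ha.mul hasExp_E4).sub ((HasExp.const 1 c).mul hasExp_E6)) (by simp [PowerSeries.coeff_mul, c])
      exact fun τ => congrFun this τ
    have e2 : ∀ τ, f τ * E₆ τ - c * E₄ τ ^ 2 = 0 := by
      have := form_zero_of_lt (k := 8) (by norm_num) (fun τ => f τ * E₆ τ - c * E₄ τ ^ 2) 
        (Wt.slash ((hf.mul wE6).sub ((wE4.pow 2).smul c)))
        ((ha.mul hasExp_E6).sub ((HasExp.const 1 c).mul (hasExp_E4.pow 2))) (by simp [PowerSeries.coeff_mul, c])
      exact fun τ => congrFun this τ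
    have e3 : ∀ τ, c * (E₄ τ ^ 3 - E₆ τ ^ 2) = 0 := by
      intro τ
      linear_combination (E₆ τ) * e1 τ - E₄ τ * e2 τ
    have e4 : c = 0 := by
      have := e3 τ₁
      have h := discriminant_eq_E₄_cube_sub_E₆_sq τ₁
      rcases mul_eq_zero.1 this with h' | h'
      · exact h'
      · exact absurd (by rw [h, h']; simp) (delta_ne τ₁)
    exact key f a hf ha e4
  · obtain ⟨p, q, hpq⟩ := exists_46 n hn
    set c := PowerSeries.coeff 0 a
    have := key (fun τ => f τ - c * (E₄ τ ^ p * E₆ τ ^ q)) _ ?_ 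
       (ha.sub ((HasExp.const 1 c).mul ((hasExp_E4.pow p).mul (hasExp_E6.pow q)))) ?_
    · have h3 : lam ^ (2 * n) = (lam ^ 4) ^ p * (lam ^ 6) ^ q := by rw [← pow_mul, ← pow_mul, ← pow_add, hpq]
      simp only [h4, h6, h3, mul_pow] at this ⊢
      linear_combination this
    · refine hf.sub (Wt.smul ?_ c)
      have := ((wt_form E₄).pow p).mul ((wt_form E₆).pow q)
      convert this using 1
      push_cast
      have : (4 * p + 6 * q : ℤ) = 2 * n := by exact_mod_cast hpq
      linarith
    · simp [c]

end scal

lemma exists_lam {τ₁ τ₂ : ℍ} (h : kj τ₁ = kj τ₂) : ∃ lam : ℂ, E₄ τ₁ = lam ^ 4 * E₄ τ₂ ∧ E₆ τ₁ = lam ^ 6 * E₆ τ₂ ∧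
    Dl τ₁ = lam ^ 12 * Dl τ₂ ∧ lam ≠ 0 := by
  obtain ⟨m, hm⟩ := IsAlgClosed.exists_pow_nat_eq (Dl τ₁ / Dl τ₂) (n := 12) (by norm_num)
  have d1 := delta_ne τ₁
  have d2 := delta_ne τ₂
  have hm0 : m ≠ 0 := by
    rintro rfl
    have := div_ne_zero d1 d2
    simp [← hm] at this
  have hm' : Dl τ₁ = m ^ 12 * Dl τ₂ := by rw [hm]; field_simp
  have k1 : E₄ τ₁ ^ 3 = (m ^ 4 * E₄ τ₂) ^ 3 := by
    have := h
    simp only [kj] at this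
    rw [div_eq_div_iff d1 d2, hm'] at this
    apply mul_right_cancel₀ d2
    linear_combination this
  have k2 : E₆ τ₁ ^ 2 = (m ^ 6 * E₆ τ₂) ^ 2 := by
    have := kj_sub τ₁
    rw [h, kj_sub τ₂, div_eq_div_iff d2 d1, hm'] at this
    apply mul_right_cancel₀ d2
    linear_combination -this
  obtain ⟨w, hw, hw3⟩ : ∃ w : ℂ, E₄ τ₁ = w * (m ^ 4 * E₄ τ₂) ∧ w ^ 3 = 1 := by
    by_cases h0 : E₄ τ₂ = 0
    · refine ⟨1, ?_, by simp⟩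
      rw [h0] at k1 ⊢
      simpa using k1
    · refine ⟨E₄ τ₁ / (m ^ 4 * E₄ τ₂), by field_simp, ?_⟩
      rw [div_pow, k1, div_self]
      positivity
  have hw0 : w ≠ 0 := by rintro rfl; simp at hw3
  have hw4 : w ^ 4 = w := by linear_combination w * hw3
  have hw6 : w ^ 6 = 1 := by linear_combination (w ^ 3 + 1) * hw3
  have hw12 : w ^ 12 = 1 := by linear_combination (w ^ 6 + 1) * hw6
  have i4 : Complex.I ^ 4 = 1 := Complex.I_pow_four
  have i2 : Complex.I ^ 2 = -1 := Complex.I_sq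
  rcases sq_eq_sq_iff_eq_or_eq_neg.1 k2 with h' | h'
  · refine ⟨m * w, ?_, ?_, ?_, mul_ne_zero hm0 hw0⟩
    · rw [mul_pow, hw4, hw]; ring
    · rw [mul_pow, hw6, h']; ring
    · rw [mul_pow, hw12, hm']; ring
  · refine ⟨m * w * Complex.I, ?_, ?_, ?_, mul_ne_zero (mul_ne_zero hm0 hw0) Complex.I_ne_zero⟩
    · rw [mul_pow, mul_pow, hw4, hw, i4]; ring
    · rw [mul_pow, mul_pow, hw6, h', show Complex.I ^ 6 = -1 by rw [show 6 = 4 + 2 from rfl, pow_add, i4, i2]; ring]; ring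
    · rw [mul_pow, mul_pow, hw12, hm', show Complex.I ^ 12 = 1 by rw [show 12 = 4 * 3 from rfl, pow_mul, i4]; ring]; ring


def pp (lam : ℂ) (hl : lam ≠ 0) (τ : ℍ) : PeriodPair where
  ω₁ := lam * τ
  ω₂ := lam
  indep := by
    rw [LinearIndependent.pair_iff]
    intro s t h
    have h1 : lam * (s * τ + t) = 0 := by
      simp only [real_smul] at h
      linear_combination h
    have h2 := (mul_eq_zero.1 h1).resolve_left hl
    have h3 := congrArg Complex.im h2
    have : s * τ.im = 0 := by simpa using h3
    have hs : s = 0 := (mul_eq_zero.1 this).resolve_right τ.im_ne_zero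
    subst hs
    simpa using h2

lemma pp_mem {lam : ℂ} {hl : lam ≠ 0} {τ : ℍ} {x : ℂ} : x ∈ (pp lam hl τ).lattice ↔ ∃ m n : ℤ, x = lam * (m * τ + n) := by
  rw [PeriodPair.mem_lattice]
  refine exists_congr fun m => exists_congr fun n => ?_
  simp only [pp]
  constructor <;> intro h
  · rw [← h]; ring
  · rw [h]; ring

lemma pp_G {lam : ℂ} {hl : lam ≠ 0} {τ : ℍ} {k : ℕ} (hk : 3 ≤ k) : (pp lam hl τ).G k =
    (lam ^ k)⁻¹ * (riemannZeta k * (2 * ModularForm.E hk τ)) := by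
  have h := tsum_eisSummand_eq_riemannZeta_mul_eisensteinSeries hk τ
  have h2 : 2 * ModularForm.E hk τ = EisensteinSeries.eisensteinSeriesSIF (N := 1) 0 k τ := by
    have : ModularForm.E hk τ = (1/2:ℂ) • EisensteinSeries.eisensteinSeriesSIF (N:=1) 0 k τ := rfl
    rw [this, smul_eq_mul]; ring
  rw [h2]
  rw [EisensteinSeries.eisensteinSeriesSIF_apply, ← h, ← tsum_mul_left]
  unfold PeriodPair.G
  rw [← (pp lam hl τ).latticeEquivProd.symm.toEquiv.tsum_eq, ← (finTwoArrowEquiv ℤ).tsum_eq]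
  apply tsum_congr
  intro v
  have : (((pp lam hl τ).latticeEquivProd.symm.toEquiv (finTwoArrowEquiv ℤ v) : (pp lam hl τ).lattice) : ℂ) = 
     lam * (v 0 * τ + v 1) := by
    have := (pp lam hl τ).latticeEquiv_symm_apply (finTwoArrowEquiv ℤ v)
    refine Eq.trans this ?_
    simp [pp]; ring
  rw [this, mul_pow, mul_inv]
  simp [EisensteinSeries.eisSummand]

lemma wp_eq_near (L1 L2 : PeriodPair) (h : ∀ k, 3 ≤ k → L1.G k = L2.G k) :
    L1.weierstrassPExcept 0 =ᶠ[𝓝 0] L2.weierstrassPExcept 0 := by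
  have h1 := L1.hasFPowerSeriesAt_weierstrassPExcept 0
  have h2 := L2.hasFPowerSeriesAt_weierstrassPExcept 0
  have e : (fun i : ℕ ↦ if i = 0 then L1.weierstrassPExcept 0 0 else ((i:ℂ) + 1) * L1.sumInvPow 0 (i + 2)) = 
     (fun i : ℕ ↦ if i = 0 then L2.weierstrassPExcept 0 0 else ((i:ℂ) + 1) * L2.sumInvPow 0 (i + 2)) := by
    funext i
    by_cases hi : i = 0
    · simp [hi]
    · simp only [hi, if_false]
      rw [L1.sumInvPow_zero, L2.sumInvPow_zero, h _ (by omega)]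
  rw [e] at h1
  have a1 := h1.eventually_hasSum
  have a2 := h2.eventually_hasSum
  filter_upwards [a1, a2] with y b1 b2
  simpa using b1.unique b2

lemma lat_countable (L : PeriodPair) : (L.lattice : Set ℂ).Countable := by
  have : Countable L.lattice := Countable.of_equiv _ L.latticeEquivProd.symm.toEquiv
  exact Set.countable_coe_iff.1 this

lemma wp_eq (L1 L2 : PeriodPair) (h : ∀ k, 3 ≤ k → L1.G k = L2.G k) (z : ℂ) (hz0 : z ≠ 0) (hz1 : z ∉ L1.lattice)
    (hz2 : z ∉ L2.lattice) :
    L1.weierstrassP z = L2.weierstrassP z := by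
  set S : Set ℂ := ((L1.lattice : Set ℂ) ∪ L2.lattice) \ {0} with hS
  have hc : S.Countable := ((lat_countable L1).union (lat_countable L2)).mono Set.diff_subset
  have hp := (hc.isConnected_compl_of_one_lt_rank (by rw [Complex.rank_real_complex]; norm_num)).isPreconnected
  have h1 := (L1.analyticOnNhd_weierstrassPExcept 0).mono (s := Sᶜ) (by
    rw [Set.compl_subset_compl]; intro x hx; exact ⟨Or.inl hx.1, hx.2⟩)
  have h2 := (L2.analyticOnNhd_weierstrassPExcept 0).mono (s := Sᶜ) (by
    rw [Set.compl_subset_compl]; intro x hx; exact ⟨Or.inr hx.1, hx.2⟩)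
  have h3 := h1.eqOn_of_preconnected_of_eventuallyEq h2 hp (z₀ := 0) (by simp [hS]) (wp_eq_near L1 L2 h)
  have h4 := h3 (x := z) (by
    rw [Set.mem_compl_iff, hS]; rintro ⟨h | h, -⟩
    · exact hz1 h
    · exact hz2 h)
  have e1 := L1.weierstrassPExcept_def 0 z
  have e2 := L2.weierstrassPExcept_def 0 z
  simp only [Submodule.coe_zero] at e1 e2
  rw [e1, e2] at h4
  simpa using h4

lemma lat_le (L1 L2 : PeriodPair) (h : ∀ k, 3 ≤ k → L1.G k = L2.G k) : L1.lattice ≤ L2.lattice := by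
  intro x hx
  by_contra hx2
  have h0 : x ≠ 0 := by rintro rfl; exact hx2 (zero_mem _)
  have o1 := L1.order_weierstrassP x hx
  have a2 := L2.analyticOnNhd_weierstrassP x hx2
  have o2 := a2.meromorphicOrderAt_nonneg
  rw [← meromorphicOrderAt_congr (f₁ := L1.weierstrassP), o1] at o2
  · exact absurd o2 (by decide)
  · have n1 := L1.compl_lattice_sdiff_singleton_mem_nhds x
    have n2 := L2.isClosed_lattice.isOpen_compl.mem_nhds hx2
    have n3 : ({0}ᶜ : Set ℂ) ∈ 𝓝 x := isOpen_compl_singleton.mem_nhds h0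
    rw [Filter.EventuallyEq, eventually_nhdsWithin_iff]
    filter_upwards [n1, n2, n3] with z z1 z2 z3 z4
    refine wp_eq L1 L2 h z z3 (fun hz => z1 ⟨hz, z4⟩) z2

lemma lin_indep (τ : ℍ) {m n m' n' : ℤ} (h : (m : ℂ) * τ + n = m' * τ + n') : m = m' ∧ n = n' := by
  have h3 := congrArg Complex.im h
  have : (m : ℝ) * τ.im = m' * τ.im := by simpa using h3
  have e : m = m' := by exact_mod_cast mul_right_cancel₀ τ.im_ne_zero this
  subst e
  refine ⟨rfl, ?_⟩
  have := add_left_cancel h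
  exact_mod_cast this

/-- injectivity of `j` modulo `SL₂(ℤ)` -/
theorem kj_inj {τ₁ τ₂ : ℍ} (h : kj τ₁ = kj τ₂) : ∃ A : SL(2, ℤ), τ₁ = A • τ₂ := by
  obtain ⟨lam, h4, h6, hD, hl⟩ := exists_lam h
  have hG : ∀ k, 3 ≤ k → (pp 1 one_ne_zero τ₁).G k = (pp lam⁻¹ (inv_ne_zero hl) τ₂).G k := by
    intro k hk
    rcases Nat.even_or_odd k with ⟨n, hn⟩ | ho
    · rw [pp_G hk, pp_G hk]
      have := scal_form h4 h6 hD n (ModularForm.E hk) _ (by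
        have := wt_form (ModularForm.E hk); convert this using 1; push_cast [hn]; ring) (hasExp_form _)
      rw [this]
      rw [show 2 * n = k by omega]
      simp
      ring
    · rw [PeriodPair.G_eq_zero_of_odd _ _ ho, PeriodPair.G_eq_zero_of_odd _ _ ho]
  have i1 := lat_le _ _ hG
  have i2 := lat_le _ _ (fun k hk => (hG k hk).symm)
  set μ := lam⁻¹ 
  have hμ : μ ≠ 0 := inv_ne_zero hl
  obtain ⟨a, b, hab⟩ := pp_mem.1 (i1 (pp_mem.2 ⟨1, 0, rfl⟩))
  obtain ⟨c, d, hcd⟩ := pp_mem.1 (i1 (pp_mem.2 ⟨0, 1, rfl⟩))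
  obtain ⟨e, f, hef⟩ := pp_mem.1 (i2 (pp_mem.2 ⟨1, 0, rfl⟩))
  obtain ⟨g, k, hgk⟩ := pp_mem.1 (i2 (pp_mem.2 ⟨0, 1, rfl⟩))
  simp only [Int.cast_one, Int.cast_zero, zero_mul, one_mul, zero_add, add_zero, mul_one] at hab hcd hef hgk
  have q1 : ((e * a + f * c : ℤ) : ℂ) * τ₂ + ((e * b + f * d : ℤ) : ℂ) = ((1 : ℤ) : ℂ) * τ₂ + ((0 : ℤ) : ℂ) := by
    apply mul_left_cancel₀ hμ
    push_cast
    linear_combination -hef - e * hab - f * hcd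
  have q2 : ((g * a + k * c : ℤ) : ℂ) * τ₂ + ((g * b + k * d : ℤ) : ℂ) = ((0 : ℤ) : ℂ) * τ₂ + ((1 : ℤ) : ℂ) := by
    apply mul_left_cancel₀ hμ
    push_cast
    linear_combination -hgk - g * hab - k * hcd
  obtain ⟨r1, r2⟩ := lin_indep _ q1
  obtain ⟨r3, r4⟩ := lin_indep _ q2
  have hdet : (e * k - f * g) * (a * d - b * c) = 1 := by
    linear_combination (g * b + k * d) * r1 + r4 - (g * a + k * c) * r2 
  have hdet' := Int.isUnit_iff.1 (IsUnit.of_mul_eq_one_right _ hdet)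
  set M : Mat := !![a, b; c, d] with hM
  have hMd : M.det = a * d - b * c := by rw [hM, Matrix.det_fin_two_of]
  have hM0 : M.det ≠ 0 := by rw [hMd]; omega
  have ht : (τ₁ : ℂ) = nmr M τ₂ / den M τ₂ := by
    rw [eq_div_iff (den_ne hM0 _), nmr, den]
    simp only [hM, Matrix.of_apply, Matrix.cons_val', Matrix.cons_val_zero, Matrix.cons_val_one, Matrix.cons_val_fin_one]
    apply mul_left_cancel₀ hμ
    linear_combination hab - τ₁ * hcd
  have him := im_mob M hM0 τ₂
  rw [← ht, coe_im] at him
  have hpos : (0:ℝ) < M.det * τ₂.im / Complex.normSq (den M τ₂) := by rw [← him]; exact τ₁.im_pos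
  have hdet1 : M.det = 1 := by
    rcases hdet' with h | h
    · rw [hMd, h]
    · exfalso
      rw [hMd, h] at hpos
      have : ((-1 : ℤ):ℝ) * τ₂.im / Complex.normSq (den M τ₂) ≤ 0 := by
        apply div_nonpos_of_nonpos_of_nonneg
        · push_cast; linarith [τ₂.im_pos]
        · exact Complex.normSq_nonneg _
      linarith
  have hex : ∃ A : SL(2, ℤ), (A : Mat) = M := ⟨⟨M, hdet1⟩, rfl⟩
  obtain ⟨A, hA⟩ := hex
  refine ⟨A, ?_⟩
  rw [← act_SL, hA]
  ext
  rw [act_coe (by simp [hdet1]), ht]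

end H7

namespace H7
open UpperHalfPlane hiding I
open Complex ModularForm
open scoped Manifold MatrixGroups ModularForm Topology
open Function.Periodic (qParam)

lemma fix_nmr {M : Mat} (h : 0 < M.det) {τ : ℍ} (hf : act M τ = τ) : nmr M τ = τ * den M τ := by
  have h1 := congrArg (fun x : ℍ => (x : ℂ)) hf
  simp only [act_coe h] at h1
  rwa [div_eq_iff (den_ne h.ne' _)] at h1

lemma fix_of_nmr {M : Mat} (h : 0 < M.det) {τ : ℍ} (hf : nmr M τ = τ * den M τ) : act M τ = τ := by
  ext
  rw [act_coe h, hf, mul_div_cancel_right₀ _ (den_ne h.ne' _)]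

lemma fix_quad {M : Mat} (h : 0 < M.det) {τ : ℍ} (hf : act M τ = τ) :
    (M 1 0 : ℂ) * τ ^ 2 + (M 1 1 - M 0 0 : ℤ) * τ + (- M 0 1 : ℤ) = 0 := by
  have := fix_nmr h hf
  rw [nmr, den] at this
  push_cast
  linear_combination -this

lemma fix_den {M : Mat} (h : 0 < M.det) {τ : ℍ} (hf : act M τ = τ) :
    den M τ ^ 2 - (M 0 0 + M 1 1 : ℤ) * den M τ + (M.det : ℤ) = 0 := by
  have := fix_nmr h hf
  rw [Matrix.det_fin_two]
  rw [nmr, den] at this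
  rw [den]
  push_cast
  linear_combination (- (M 1 0 : ℂ)) * this

lemma quad_uniq {τ : ℍ} {c e f c' e' f' : ℤ} (h : (c : ℂ) * τ ^ 2 + e * τ + f = 0) (h' : (c' : ℂ) * τ ^ 2 + e' * τ + f' = 0) :
    c * e' = c' * e ∧ c * f' = c' * f := by
  apply lin_indep τ
  push_cast
  linear_combination c * h' - c' * h

lemma quad_disc {τ : ℍ} {c e f : ℤ} (h : (c : ℂ) * τ ^ 2 + e * τ + f = 0) (hc : c ≠ 0) : e ^ 2 < 4 * c * f := by
  have h1 := congrArg Complex.re h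
  have h2 := congrArg Complex.im h
  simp [pow_two] at h1 h2
  have hy := τ.im_pos
  set x := τ.re
  set y := τ.im
  have h3 : y * (2 * c * x + e) = 0 := by linarith
  have h4 := (mul_eq_zero.1 h3).resolve_left hy.ne'
  have hc' : (c : ℝ) ^ 2 > 0 := by positivity
  have : (e : ℝ) ^ 2 - 4 * c * f = - 4 * (c ^ 2 * y ^ 2) := by
    linear_combination (4 * c * (-1)) * h1 + (e + 2 * c * x) * h4
  have h5 : (e : ℝ) ^ 2 < 4 * c * f := by
    have : 0 < (c : ℝ) ^ 2 * y ^ 2 := by positivity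
    linarith
  exact_mod_cast h5

lemma fix_c_ne {l : ℕ} (hl : l.Prime) {M : Mat} (h : M.det = l) {τ : ℍ} (hf : act M τ = τ) : M 1 0 ≠ 0 := by
  intro h0
  have hp : 0 < M.det := by rw [h]; exact_mod_cast hl.pos
  have h1 := fix_quad hp hf
  rw [h0] at h1
  have h2 := lin_indep τ (m := M 1 1 - M 0 0) (n := - M 0 1) (m' := 0) (n' := 0) (by push_cast at *; linear_combination h1)
  rw [Matrix.det_fin_two, h0, show M 1 1 = M 0 0 by omega] at h
  have h3 : (M 0 0).natAbs * (M 0 0).natAbs = l := by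
    zify; rw [abs_mul_abs_self]; linarith
  exact Nat.not_prime_mul (a := (M 0 0).natAbs) (b := (M 0 0).natAbs) (by rintro h; rw [h] at h3; exact hl.one_lt.ne h3)
    (by rintro h; rw [h] at h3; exact hl.one_lt.ne h3) (h3 ▸ hl)

lemma fix_disc {l : ℕ} (hl : l.Prime) {M : Mat} (h : M.det = l) {τ : ℍ} (hf : act M τ = τ) : 
   (M 0 0 + M 1 1) ^ 2 < 4 * (l : ℤ) := by
  have hp : 0 < M.det := by rw [h]; exact_mod_cast hl.pos
  have h1 := quad_disc (fix_quad hp hf) (fix_c_ne hl h hf)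
  rw [← h, Matrix.det_fin_two]
  nlinarith

lemma hasDerivAt_kj (τ : ℍ) : HasDerivAt (kj ∘ ofComplex) (2 * Real.pi * Complex.I * (-(E₄ τ ^ 2 * E₆ τ) / Dl τ)) (τ : ℂ) := by
  have hpi : (2 * Real.pi * Complex.I : ℂ) ≠ 0 := by simp [Real.pi_ne_zero]
  have h4 := (hasExp_E4.hasDerivAt τ.im_pos).differentiableAt.hasDerivAt
  have h6 := (hasExp_E6.hasDerivAt τ.im_pos).differentiableAt.hasDerivAt
  have r4 := ramanujan4 τ
  have r6 := ramanujan6 τ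
  unfold Derivative.normalizedDerivOfComplex at r4 r6
  rw [inv_mul_eq_iff_eq_mul₀ hpi] at r4 r6
  change HasDerivAt _ (deriv _ (τ:ℂ)) (τ:ℂ) at h4 h6
  rw [r4] at h4
  rw [r6] at h6
  have hd : Dl τ = (E₄ τ ^ 3 - E₆ τ ^ 2) / 1728 := by rw [discriminant_eq_E₄_cube_sub_E₆_sq]
  have hd0 := delta_ne τ
  have hfun : (kj ∘ ofComplex) = fun z => (E₄ ∘ ofComplex) z ^ 3 / (((E₄ ∘ ofComplex) z ^ 3 - (E₆ ∘ ofComplex) z ^ 2) / 1728) := by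
    funext z
    simp only [Function.comp, kj, discriminant_eq_E₄_cube_sub_E₆_sq]
  rw [hfun]
  have := (h4.pow 3).div (((h4.pow 3).sub (h6.pow 2)).div_const 1728) (by
    simp only [Function.comp, ofComplex_apply, Pi.pow_apply, Pi.sub_apply]; rw [← hd]; exact hd0)
  refine HasDerivAt.congr_deriv (f := fun z => (E₄ ∘ ofComplex) z ^ 3 / (((E₄ ∘ ofComplex) z ^ 3 - (E₆ ∘ ofComplex) z ^ 2) / 1728)) this ?_
  simp only [Function.comp, ofComplex_apply, Pi.pow_apply, Pi.sub_apply]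
  rw [← hd, ← mul_div_assoc (2 * Real.pi * Complex.I : ℂ) (-(E₄ τ ^ 2 * E₆ τ)), div_eq_div_iff (pow_ne_zero 2 hd0) hd0, hd]
  push_cast
  ring

noncomputable def dk (τ : ℍ) : ℂ := 2 * Real.pi * Complex.I * (-(E₄ τ ^ 2 * E₆ τ) / Dl τ)

lemma hasDerivAt_kj_act {M : Mat} (h : 0 < M.det) (τ : ℍ) :
    HasDerivAt (fun z => kj (act M (ofComplex z))) (dk (act M τ) * (M.det / den M τ ^ 2)) (τ : ℂ) := by
  have hd := den_ne h.ne' τ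
  have h1 : HasDerivAt (fun z : ℂ => ((M 0 0 : ℂ) * z + (M 0 1 : ℂ)) / ((M 1 0 : ℂ) * z + (M 1 1 : ℂ))) (M.det / den M τ ^ 2) (τ : ℂ) := by
    have := (((hasDerivAt_id (τ : ℂ)).const_mul (M 0 0 : ℂ)).add_const (M 0 1 : ℂ)).div
      (((hasDerivAt_id (τ : ℂ)).const_mul (M 1 0 : ℂ)).add_const (M 1 1 : ℂ)) (by simpa [den] using hd)
    refine HasDerivAt.congr_deriv (f := fun z : ℂ => ((M 0 0 : ℂ) * z + (M 0 1 : ℂ)) / ((M 1 0 : ℂ) * z + (M 1 1 : ℂ))) this ?_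
    rw [Matrix.det_fin_two, den]
    push_cast
    simp only [id]
    congr 1
    ring
  have h2 := hasDerivAt_kj (act M τ)
  rw [act_coe h] at h2
  have h3 := HasDerivAt.comp (τ : ℂ) (h₂ := kj ∘ ofComplex) (h := fun z : ℂ => ((M 0 0 : ℂ) * z + (M 0 1 : ℂ)) / ((M 1 0 : ℂ) * z + (M 1 1 : ℂ))) h2 h1
  refine h3.congr_of_eventuallyEq ?_
  have : {z : ℂ | 0 < z.im} ∈ 𝓝 (τ : ℂ) := (isOpen_lt continuous_const Complex.continuous_im).mem_nhds τ.im_pos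
  filter_upwards [this] with z hz
  simp only [Function.comp, act, nmr, den]
  rw [ofComplex_apply_of_im_pos hz]

lemma E6_I : E₆ UpperHalfPlane.I = 0 := by
  have h := wt_form E₆ ModularGroup.S UpperHalfPlane.I
  have h1 : ModularGroup.S • UpperHalfPlane.I = UpperHalfPlane.I := by
    rw [← act_SL]; ext
    rw [act_coe (SLdet _)]
    simp [nmr, den, ModularGroup.S]
  rw [h1, den_SL] at h
  have h2 : den ModularGroup.S UpperHalfPlane.I = Complex.I := by simp [den, ModularGroup.S]
  rw [h2] at h
  have : Complex.I ^ (6 : ℤ) = -1 := by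
    rw [show (6:ℤ) = ((6:ℕ):ℤ) from rfl, zpow_natCast, show 6 = 4 + 2 from rfl, pow_add, Complex.I_pow_four, Complex.I_sq]; ring
  rw [this] at h
  linear_combination (1/2) * h

lemma exists_rho : ∃ τ : ℍ, (τ : ℂ) ^ 2 + τ + 1 = 0 := by
  obtain ⟨w, hw⟩ := IsAlgClosed.exists_pow_nat_eq (-3 : ℂ) (n := 2) (by norm_num)
  have key : ∀ z : ℂ, z ^ 2 + z + 1 = 0 → z.im ≠ 0 := by
    intro z hz h0
    have := congrArg Complex.re hz
    simp [pow_two, h0] at this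
    nlinarith [sq_nonneg (z.re + 1/2)]
  have h1 : ((-1 + w) / 2) ^ 2 + (-1 + w) / 2 + 1 = 0 := by linear_combination (1/4) * hw
  have h2 : ((-1 - w) / 2) ^ 2 + (-1 - w) / 2 + 1 = 0 := by linear_combination (1/4) * hw
  rcases lt_or_gt_of_ne (key _ h1) with h | h
  · refine ⟨⟨(-1 - w) / 2, ?_⟩, h2⟩
    have e : (-1 - w) / 2 = -1 - (-1 + w) / 2 := by ring
    rw [e]
    simp at h ⊢
    linarith
  · exact ⟨⟨_, h⟩, h1⟩

lemma E4_rho {τ : ℍ} (hτ : (τ : ℂ) ^ 2 + τ + 1 = 0) : E₄ τ = 0 := by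
  have hex : ∃ A : SL(2, ℤ), (A : Mat) = !![0, -1; 1, 1] := ⟨⟨!![0, -1; 1, 1], by simp [Matrix.det_fin_two]⟩, rfl⟩
  obtain ⟨A, hA⟩ := hex
  have h := wt_form E₄ A τ
  have hd : den A τ = τ + 1 := by simp [den, hA]
  have hne : (τ : ℂ) + 1 ≠ 0 := by rw [← hd]; exact den_ne (SLdet A).ne' τ
  have h1 : A • τ = τ := by
    rw [← act_SL]
    apply fix_of_nmr (SLdet A)
    rw [hd]
    simp [nmr, hA]
    linear_combination -hτ
  rw [h1, den_SL, hd] at h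
  have h3 : ((τ : ℂ) + 1) ^ (4 : ℤ) = -τ - 1 := by
    have e : ((τ : ℂ) + 1) ^ (4 : ℕ) = -τ - 1 := by
      linear_combination ((τ:ℂ) ^ 2 + 3 * τ + 2 ) * hτ
    exact_mod_cast e
  rw [h3] at h
  have h4 : ((τ : ℂ) + 2) * E₄ τ = 0 := by linear_combination h
  rcases mul_eq_zero.1 h4 with h5 | h5
  · exfalso
    have := congrArg Complex.im h5
    simp at this
    exact τ.im_ne_zero this
  · exact h5


def Hm (l : ℕ) (τ : ℍ) : Prop := ∃ M : Mat, M.det = l ∧ M 0 0 + M 1 1 = 0 ∧ act M τ = τ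

lemma inv_mul_coe (A : SL(2, ℤ)) : ((A⁻¹ : SL(2, ℤ)) : Mat) * (A : Mat) = 1 := by
  rw [← Matrix.SpecialLinearGroup.coe_mul, inv_mul_cancel, Matrix.SpecialLinearGroup.coe_one]

lemma mul_inv_coe (A : SL(2, ℤ)) : (A : Mat) * ((A⁻¹ : SL(2, ℤ)) : Mat) = 1 := by
  rw [← Matrix.SpecialLinearGroup.coe_mul, mul_inv_cancel, Matrix.SpecialLinearGroup.coe_one]

lemma Hm_smul {l : ℕ} (hl : l.Prime) {A : SL(2, ℤ)} {τ : ℍ} (h : Hm l (A • τ)) : Hm l τ := by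
  obtain ⟨M, h1, h2, h3⟩ := h
  have hp : 0 < M.det := by rw [h1]; exact_mod_cast hl.pos
  have e1 : ((A⁻¹ : SL(2, ℤ)) : Mat) * (A : Mat) = 1 := inv_mul_coe A
  have e2 : (A : Mat) * ((A⁻¹ : SL(2, ℤ)) : Mat)= 1 := mul_inv_coe A
  refine ⟨((A⁻¹ : SL(2, ℤ)) : Mat) * (M * (A : Mat)), ?_, ?_, ?_⟩
  · rw [Matrix.det_mul, Matrix.det_mul, A.det_coe, (A⁻¹).det_coe, h1]; ring
  · rw [← Matrix.trace_fin_two, Matrix.trace_mul_comm, Matrix.mul_assoc, e2, Matrix.mul_one, Matrix.trace_fin_two, h2]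
  · rw [act_mul (SLdet _) (by rw [Matrix.det_mul]; exact mul_pos hp (SLdet _)), act_mul hp (SLdet _), act_SL A, h3, act_SL, inv_smul_smul]

lemma dk_ne {l : ℕ} (hl : l.Prime) (h5 : 5 ≤ l) {τ : ℍ} (h : Hm l τ) : dk τ ≠ 0 := by
  have hpi : (2 * Real.pi * Complex.I : ℂ) ≠ 0 := by simp [Real.pi_ne_zero]
  have hD := delta_ne τ
  rw [dk, mul_ne_zero_iff]
  refine ⟨hpi, div_ne_zero (neg_ne_zero.2 (mul_ne_zero (pow_ne_zero 2 ?_) ?_)) hD⟩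
  · intro h0
    obtain ⟨ρ, hρ⟩ := exists_rho
    have hk : kj τ = kj ρ := by rw [kj, kj, h0, E4_rho hρ]; simp
    obtain ⟨A, rfl⟩ := kj_inj hk
    obtain ⟨M, h1, h2, h3⟩ := Hm_smul hl h
    have hp : 0 < M.det := by rw [h1]; exact_mod_cast hl.pos
    have q := fix_quad hp h3
    obtain ⟨e1, e2⟩ := quad_uniq (c := 1) (e := 1) (f := 1) (by simpa using hρ) q
    rw [Matrix.det_fin_two] at h1
    have h6 : 3 * (M 0 0) ^ 2 = (l : ℤ) := by
      rw [← h1, show M 1 1 = - M 0 0 by omega, show M 1 0 = -2 * M 0 0 by omega, show M 0 1 = 2 * M 0 0 by omega]; ring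
    have h7 : (3 : ℤ) ∣ l := ⟨_, h6.symm⟩
    have h8 : 3 ∣ l := by exact_mod_cast h7
    have := (Nat.prime_dvd_prime_iff_eq Nat.prime_three hl).1 h8
    omega
  · intro h0
    have hk : kj τ = kj UpperHalfPlane.I := by
      have a := kj_sub τ
      have b := kj_sub UpperHalfPlane.I
      rw [h0] at a; rw [E6_I] at b
      simp at a b
      linear_combination a - b
    obtain ⟨A, rfl⟩ := kj_inj hk
    obtain ⟨M, h1, h2, h3⟩ := Hm_smul hl h
    have hp : 0 < M.det := by rw [h1]; exact_mod_cast hl.pos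
    have q := fix_quad hp h3
    obtain ⟨e1, e2⟩ := quad_uniq (c := 1) (e := 0) (f := 1) (by simp) q
    rw [Matrix.det_fin_two] at h1
    have h6 : (M 1 0) * M 1 0 = (l : ℤ) := by
      rw [← h1, show M 1 1 = 0 by omega, show M 0 1 = -M 1 0 by omega]; ring
    have h7 : (M 1 0).natAbs * (M 1 0).natAbs = l := by
      zify; rw [abs_mul_abs_self]; linarith
    exact Nat.not_prime_mul (a := (M 1 0).natAbs) (b := (M 1 0).natAbs) (by rintro h; rw [h] at h7; exact hl.one_lt.ne h7)
      (by rintro h; rw [h] at h7; exact hl.one_lt.ne h7) (h7 ▸ hl)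

lemma not_dvd_tr {l : ℕ} (h5 : 5 ≤ l) {t : ℤ} (ht : t ^ 2 < 4 * l) (h0 : t ≠ 0) : ¬ (l : ℤ) ∣ t := by
  intro h
  have h1 := Int.le_of_dvd (abs_pos.2 h0) ((dvd_abs _ _).2 h)
  have h2 := sq_abs t
  have : (5 : ℤ) ≤ l := by exact_mod_cast h5
  nlinarith

lemma fix_uniq {l : ℕ} (hl : l.Prime) (h5 : 5 ≤ l) {τ : ℍ} {M N : Mat} (h1 : M.det = l) (h2 : M 0 0 + M 1 1 = 0)
    (h3 : act M τ = τ) (k1 : N.det = l) (k3 : act N τ = τ) : N = M ∨ N = -M := by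
  have hp : 0 < M.det := by rw [h1]; exact_mod_cast hl.pos
  have kp : 0 < N.det := by rw [k1]; exact_mod_cast hl.pos
  have q := fix_quad hp h3
  have q' := fix_quad kp k3
  obtain ⟨e1, e2⟩ := quad_uniq q q'
  have hc := fix_c_ne hl h1 h3
  have hc' := fix_c_ne hl k1 k3
  have hd := fix_disc hl k1 k3
  rw [Matrix.det_fin_two] at h1 k1
  set t := N 0 0 + N 1 1 with ht
  have h11 : M 1 1 = - M 0 0 := by omega
  rw [h11] at e1 h1
  have key : M 1 0 ^ 2 * (4 * l - t ^ 2) = 4 * l * N 1 0 ^ 2 := by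
    have : (4 * l - t ^ 2 : ℤ) = - (N 1 1 - N 0 0) ^ 2 - 4 * N 0 1 * N 1 0 := by rw [← k1, ht]; ring
    rw [this]
    linear_combination (- (M 1 0 * (N 1 1 - N 0 0)) - N 1 0 * (- M 0 0 - M 0 0)) * e1 + 4 * N 1 0 * M 1 0 * e2 + 4 * N 1 0 ^ 2 * h1
  have t0 : t = 0 := by
    by_contra h0
    have nd := not_dvd_tr h5 hd h0
    haveI : Fact l.Prime := ⟨hl⟩
    have nd2 : ¬ (l : ℤ) ∣ (4 * l - t ^ 2) := by
      intro h
      have : (l : ℤ) ∣ t ^ 2 := by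
        have := dvd_sub (Dvd.intro_left (4 : ℤ) rfl : (l : ℤ) ∣ 4 * l) h
        simpa using this
      exact nd (Int.Prime.dvd_pow' hl this)
    have nd4 : ¬ (l : ℤ) ∣ 4 := by
      intro h; have := Int.le_of_dvd (by norm_num) h; omega
    have hN : (4 * l - t ^ 2 : ℤ) ≠ 0 := by omega
    have v := congrArg (padicValInt l) key
    have hl0 : (l : ℤ) ≠ 0 := by exact_mod_cast hl.ne_zero
    rw [padicValInt.mul (pow_ne_zero 2 hc) hN, padicValInt.mul (mul_ne_zero (by norm_num) hl0) (pow_ne_zero 2 hc'),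
      padicValInt.mul (by norm_num) hl0, padicValInt.eq_zero_of_not_dvd nd2, padicValInt.eq_zero_of_not_dvd nd4, padicValInt.self hl.one_lt, 
      pow_two, pow_two, padicValInt.mul hc hc, padicValInt.mul hc' hc'] at v
    omega
  rw [t0] at key
  have hl0 : (l : ℤ) ≠ 0 := by exact_mod_cast hl.ne_zero
  have hsq : N 1 0 ^ 2 = M 1 0 ^ 2 := by
    have : (4 * l : ℤ) ≠ 0 := by omega
    apply mul_left_cancel₀ this
    linear_combination -key
  have n11 : N 1 1 = - N 0 0 := by omega
  rw [n11] at e1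
  rcases sq_eq_sq_iff_eq_or_eq_neg.1 hsq with h | h
  · left
    rw [h] at e1 e2
    have f1 := mul_left_cancel₀ hc e1
    have f2 := mul_left_cancel₀ hc e2
    ext i j
    fin_cases i <;> fin_cases j <;> simp <;> omega
  · right
    rw [h] at e1 e2
    have f1 : -N 0 0 - N 0 0 = - (- M 0 0 - M 0 0) := mul_left_cancel₀ hc (by linarith)
    have f2 : - N 0 1 = M 0 1 := mul_left_cancel₀ hc (by linarith)
    ext i j
    fin_cases i <;> fin_cases j <;> simp <;> omega

lemma F_simple {l : ℕ} (hl : l.Prime) (h5 : 5 ≤ l) (P : ℂ[X]) (hP : ∀ τ, Ffun l τ = P.eval (kj τ)) {τ : ℍ} (h : Hm l τ) :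
    P.derivative.eval (kj τ) ≠ 0 := by
  intro h0
  have hdk := dk_ne hl h5 h
  obtain ⟨M, h1, h2, h3⟩ := h
  have hp : 0 < M.det := by rw [h1]; exact_mod_cast hl.pos
  obtain ⟨A, i0, rfl⟩ := gam_exists l hl M h1
  have hg := gam_det_pos l hl
  have d1 : HasDerivAt (fun z => Ffun l (ofComplex z)) 0 (τ : ℂ) := by
    have e : (fun z => Ffun l (ofComplex z)) = fun z => P.eval ((kj ∘ ofComplex) z) := by
      funext z; rw [hP]; rfl
    rw [e]
    have := HasDerivAt.comp (τ : ℂ) (h₂ := fun x => P.eval x) (h := kj ∘ ofComplex) (by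
      simp only [Function.comp, ofComplex_apply]; exact P.hasDerivAt _) (hasDerivAt_kj τ)
    rw [h0, zero_mul] at this
    exact this
  have d2 : HasDerivAt (fun z => Ffun l (ofComplex z)) (∑ i, (∏ j ∈ Finset.univ.erase i, (kj τ - kj (act (gam l j) τ))) • 
     (dk τ - dk (act (gam l i) τ) * ((gam l i).det / den (gam l i) τ ^ 2))) (τ : ℂ) := by
    have := HasDerivAt.fun_finsetProd (𝕜 := ℂ) (u := Finset.univ) (f := fun i z => kj (ofComplex z) - kj (act (gam l i) (ofComplex z)))
      (f' := fun i => (dk τ - dk (act (gam l i) τ) * ((gam l i).det / den (gam l i) τ ^ 2))) (x := (τ : ℂ)) (fun i _ => 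
        (hasDerivAt_kj τ).sub (hasDerivAt_kj_act (hg i) τ))
    simp only [ofComplex_apply] at this
    exact this
  have hz : kj τ - kj (act (gam l i0) τ) = 0 := by
    have h := kj_act_SL A (act (gam l i0) τ)
    rw [← act_mul (SLdet A) (hg i0), h3] at h
    rw [h, sub_self]
  have hnz : ∀ i, i ≠ i0 → kj τ - kj (act (gam l i) τ) ≠ 0 := by
    intro i hi hk
    obtain ⟨B, hB⟩ := kj_inj (sub_eq_zero.1 hk)
    rw [← act_SL, ← act_mul (SLdet B) (hg i)] at hB
    apply hi
    rcases fix_uniq hl h5 h1 h2 h3 (N := B * gam l i) (by rw [Matrix.det_mul, B.det_coe, gam_det]; ring) hB.symm with h | h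
    · apply gam_uniq l hl (A⁻¹ * B) i i0
      have : ((A⁻¹ : SL(2, ℤ)) : Mat) * (A : Mat) = 1 := inv_mul_coe A
      calc ((A⁻¹ * B : SL(2, ℤ)) : Mat) * gam l i = (A⁻¹ : SL(2, ℤ)) * (B * gam l i) := by
            rw [Matrix.SpecialLinearGroup.coe_mul, Matrix.mul_assoc]
        _ = _ := by rw [h, ← Matrix.mul_assoc, this, Matrix.one_mul]
    · apply gam_uniq l hl (-(A⁻¹ * B)) i i0
      have : ((A⁻¹ : SL(2, ℤ)) : Mat) * (A : Mat) = 1 := inv_mul_coe A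
      calc ((-(A⁻¹ * B) : SL(2, ℤ)) : Mat) * gam l i = -((A⁻¹ : SL(2, ℤ)) * (B * gam l i)) := by
            rw [Matrix.SpecialLinearGroup.coe_neg, Matrix.SpecialLinearGroup.coe_mul, Matrix.neg_mul, Matrix.mul_assoc]
        _ = _ := by rw [h, Matrix.mul_neg, neg_neg, ← Matrix.mul_assoc, this, Matrix.one_mul]
  have hs := d2.unique d1
  rw [Finset.sum_eq_single i0 (fun i _ hi => by
    rw [Finset.prod_eq_zero (Finset.mem_erase.2 ⟨hi.symm, Finset.mem_univ i0⟩) hz, zero_smul]) (by simp)] at hs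
  have hprod : (∏ j ∈ Finset.univ.erase i0, (kj τ - kj (act (gam l j) τ))) ≠ 0 := 
    Finset.prod_ne_zero_iff.2 fun j hj => hnz j (Finset.ne_of_mem_erase hj)
  rw [smul_eq_mul] at hs
  have hs2 := (mul_eq_zero.1 hs).resolve_left hprod
  -- derivative through M
  have e1 := hasDerivAt_kj_act (hg i0) τ
  have e2 := hasDerivAt_kj_act hp τ
  have ef : (fun z => kj (act (A * gam l i0) (ofComplex z))) = (fun z => kj (act (gam l i0) (ofComplex z))) := by
    funext z; rw [act_mul (SLdet A) (hg i0), kj_act_SL]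
  rw [ef] at e2
  rw [e1.unique e2, h3] at hs2
  have hα := fix_den hp h3
  rw [h2] at hα
  have hα2 : den (A * gam l i0) τ ^ 2 = - ((A * gam l i0 : Mat).det : ℂ) := by
    rw [Int.cast_zero] at hα; linear_combination hα
  have hdn : ((A * gam l i0 : Mat).det : ℂ) ≠ 0 := by exact_mod_cast hp.ne'
  rw [hα2, div_neg, div_self hdn] at hs2
  apply hdk
  linear_combination (1/2) * hs2

end H7

namespace H7
open UpperHalfPlane hiding I
open Complex ModularForm
open scoped Manifold MatrixGroups ModularForm Topology

def Hset (l : ℕ) : Set ℂ := {c | ∃ τ, kj τ = c ∧ Hm l τ}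

lemma phi_fix {l : ℕ} {M : Mat} {τ : ℍ} (hf : act M τ = τ) :
    phi l τ M = (l : ℂ) ^ 12 / den M τ ^ 12 := by
  rw [phi, hf, mul_div_assoc, div_self (delta_ne τ), mul_one]

lemma Yfun_zero {l : ℕ} (hl : l.Prime) {M : Mat} (h1 : M.det = l) {τ : ℍ} (hf : act M τ = τ) :
    Yfun l ((l : ℂ) ^ 12 / den M τ ^ 12) τ = 0 := by
  rw [← phi_fix hf]
  obtain ⟨A, i, rfl⟩ := gam_exists l hl M h1
  rw [phi_left _ _ _ _ (gam_det_pos l hl i)]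
  exact Finset.prod_eq_zero (Finset.mem_univ i) (sub_self _)

lemma Yfun_opt {l : ℕ} (y : ℂ) (τ : ℍ) : Yfun l y τ =
    (y - (l : ℂ) ^ 12 * (Dl (act (gam l none) τ) / Dl τ)) * ∏ b : Fin l, (y - phi l τ (gam l (some b))) := by
  rw [Yfun, Fintype.prod_option]
  congr 2
  rw [phi]
  simp [den, gam, mul_div_assoc]

section
variable (l : ℕ) [Fact l.Prime] {V k : Type*} [CommRing V] [Field k] [CharP k l]
  (φ : V →+* ℂ) (hφ : Function.Injective φ) (ρ : V →+* k) (ζ : V)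
  (hζ : φ ζ = Complex.exp (2 * Real.pi * Complex.I / l)) (hζ1 : ρ ζ = 1)
  (hintg : ∀ (p : V[X]) (z : ℂ), p.Monic → p.eval₂ φ z = 0 → ∃ y, φ y = z)
  (n r s : ℕ) (h5 : 5 ≤ l) (hr : r = 0 ∨ r = 1) (hs : s = 0 ∨ s = 1) (hlr : l = 12 * n + 4 * r + 6 * s + 1)
include hφ hζ hζ1 h5 hr hs hlr

lemma gbar_zero {τ : ℍ} (h : Hm l τ) (v : V) (hv : φ v = kj τ) : (gpol k n r s).eval (ρ v) = 0 := by
  have hl : l.Prime := Fact.out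
  have hl0 : (l : ℂ) ≠ 0 := by exact_mod_cast hl.ne_zero
  obtain ⟨M, h1, h2, h3⟩ := h
  have hp : 0 < M.det := by rw [h1]; exact_mod_cast hl.pos
  have hα := fix_den hp h3
  rw [h2, h1, Int.cast_zero] at hα
  have hα2 : den M τ ^ 2 = - (l : ℂ) := by push_cast at hα; linear_combination hα
  have hα12 : (l : ℂ) ^ 12 / den M τ ^ 12 = (l : ℂ) ^ 6 := by
    rw [show 12 = 2 * 6 from rfl, pow_mul (den M τ), hα2]; field_simp
  have hY := Yfun_zero hl h1 h3
  rw [hα12] at hY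
  have e : ∀ τ, (φ 1 - φ ((l : V) ^ 6) * (Dl (act (gam l none) τ) / Dl τ)) * ∏ b : Fin l, (φ ((l : V) ^ 6) - phi l τ (gam l (some b)))
      = Yfun l ((l : ℂ) ^ 6) τ / (l : ℂ) ^ 6 := by
    intro τ
    rw [Yfun_opt, map_one, map_pow, map_natCast]
    field_simp
  have hB : ρ ((l : V) ^ 6) = 0 := by simp
  obtain ⟨p, hp1, hp2⟩ := pY_exists l φ hφ ρ ζ hζ hζ1 n r s h5 hr hs hlr 1 ((l : V) ^ 6) ((l : V) ^ 6) hB (by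
    intro γ τ
    simp only [e, Yfun_inv l hl _ γ τ])
  have h6 : p.eval v = 0 := by
    apply hφ
    rw [map_zero, ← eval₂_hom, hv, ← hp1, e, hY, zero_div]
  have h7 : (p.map ρ).eval (ρ v) = 0 := by rw [eval_map, eval₂_hom, h6, map_zero]
  rw [hp2, hB] at h7
  simpa [hl.ne_zero] using h7

include hintg

lemma gbar_ne {τ : ℍ} {M : Mat} (h1 : M.det = l) (h2 : M 0 0 + M 1 1 ≠ 0) (h3 : act M τ = τ) (v : V) (hv : φ v = kj τ) :
    (gpol k n r s).eval (ρ v) ≠ 0 := by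
  have hl : l.Prime := Fact.out
  have hl0 : (l : ℂ) ≠ 0 := by exact_mod_cast hl.ne_zero
  have hp : 0 < M.det := by rw [h1]; exact_mod_cast hl.pos
  have nd := not_dvd_tr h5 (fix_disc hl h1 h3) h2
  set t := M 0 0 + M 1 1 with ht
  -- key step: a root y with unit residue
  have key : ∀ (N : Mat) (y : V), N.det = l → act N τ = τ → φ y ^ 12 = (l : ℂ) ^ 12 / den N τ ^ 12 → ρ y ≠ 0 →
      (gpol k n r s).eval (ρ v) ≠ 0 := by
    intro N y n1 n2 hy hy0
    have hY := Yfun_zero hl n1 n2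
    rw [← hy] at hY
    have hB : ρ ((l : V) ^ 12) = 0 := by simp
    have e : ∀ τ, (φ (y ^ 12) - φ ((l : V) ^ 12) * (Dl (act (gam l none) τ) / Dl τ)) * ∏ b : Fin l, (φ (y ^ 12) - phi l τ (gam l (some b)))
      = Yfun l (φ y ^ 12) τ := by
      intro τ
      rw [Yfun_opt, map_pow, map_pow, map_natCast]
    obtain ⟨p, hp1, hp2⟩ := pY_exists l φ hφ ρ ζ hζ hζ1 n r s h5 hr hs hlr (y ^ 12) ((l : V) ^ 12) (y ^ 12) hB (by
      intro γ τ
      simp only [e, Yfun_inv l hl _ γ τ])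
    have h6 : p.eval v = 0 := by
      apply hφ
      rw [map_zero, ← eval₂_hom, hv, ← hp1, e, hY]
    have h7 : (p.map ρ).eval (ρ v) = 0 := by rw [eval_map, eval₂_hom, h6, map_zero]
    rw [hp2] at h7
    simp [hy0] at h7
    rw [sub_eq_zero] at h7
    rw [← h7]
    positivity
  have hα := fix_den hp h3
  rw [h1] at hα
  push_cast at hα
  have hd := den_ne hp.ne' τ
  have ir : ∀ z : ℂ, z ^ 2 - t * z + l = 0 → ∃ y, φ y = z := by
    intro z hz
    refine hintg (X ^ 2 + (C (-(t : V)) * X + C (l : V))) z ?_ ?_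
    · apply monic_X_pow_add
      compute_degree!
    · rw [eval₂_add, eval₂_pow, eval₂_X, eval₂_add, eval₂_mul, eval₂_C, eval₂_X, eval₂_C, map_neg, map_intCast, map_natCast]
      linear_combination hz
  obtain ⟨a, ha⟩ := ir (den M τ) (by rw [ht]; push_cast; linear_combination hα)
  obtain ⟨b, hb⟩ := ir (t - den M τ) (by rw [ht]; push_cast; linear_combination hα)
  have hab : den M τ * (t - den M τ) = l := by rw [ht]; push_cast; linear_combination -hα
  have hab0 : a * b = (l : V) := by apply hφ; rw [map_mul, ha, hb, hab, map_natCast]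
  have hs0 : a + b = (t : V) := by apply hφ; rw [map_add, ha, hb, map_intCast]; ring
  have hts : (t : k) ≠ 0 := by rwa [Ne, CharP.intCast_eq_zero_iff k l]
  have hab' : ρ a * ρ b = 0 := by rw [← map_mul, hab0]; simp
  have hs' : ρ a + ρ b = (t : k) := by rw [← map_add, hs0]; simp
  have hbd : t - den M τ ≠ 0 := by intro h; rw [h, mul_zero] at hab; exact hl0 hab.symm
  rcases mul_eq_zero.1 hab' with h0 | h0
  · -- b is a unit
    refine key M b h1 h3 ?_ (by intro h; rw [h0, h] at hs'; simp at hs'; exact hts hs'.symm)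
    rw [hb, ← hab, mul_pow]; field_simp
  · -- a is a unit, use the adjugate
    have n1 : (M.adjugate).det = l := by rw [Matrix.det_adjugate, h1]; simp
    have hdn : den M.adjugate τ = t - den M τ := by
      rw [Matrix.adjugate_fin_two, den, den, ht]; simp; ring
    have hnm : nmr M.adjugate τ = τ * den M.adjugate τ := by
      have := fix_nmr hp h3
      rw [hdn]
      rw [Matrix.adjugate_fin_two, nmr, ht]
      rw [nmr] at this
      simp
      linear_combination -this
    refine key M.adjugate a n1 (fix_of_nmr (by rw [n1]; exact_mod_cast hl.pos) hnm) ?_ (by intro h; rw [h0, h] at hs'; simp at hs'; exact hts hs'.symm)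
    rw [hdn, ha, ← hab, mul_pow]; field_simp

end

lemma gpol_map (n r s : ℕ) (R S : Type*) [CommRing R] [CommRing S] (f : R →+* S) :
    (gpol R n r s).map f = gpol S n r s := by
  have : f 1728 = 1728 := map_ofNat f 1728
  simp [gpol, Polynomial.map_sum, this]

end H7

namespace H7
open UpperHalfPlane hiding I
open Complex ModularForm
open scoped Manifold MatrixGroups ModularForm Topology

lemma F_zero_iff {l : ℕ} (hl : l.Prime) (τ : ℍ) : Ffun l τ = 0 ↔ ∃ M : Mat, M.det = l ∧ act M τ = τ := by
  constructor
  · intro h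
    obtain ⟨i, -, hi⟩ := Finset.prod_eq_zero_iff.1 h
    obtain ⟨A, hA⟩ := kj_inj (sub_eq_zero.1 hi)
    refine ⟨A * gam l i, ?_, ?_⟩
    · rw [Matrix.det_mul, A.2, one_mul, gam_det]
    · rw [act_mul (SLdet A) (gam_det_pos l hl i), act_SL, ← hA]
  · rintro ⟨M, h1, h2⟩
    obtain ⟨A, i, rfl⟩ := gam_exists l hl M h1
    refine Finset.prod_eq_zero (Finset.mem_univ i) ?_
    rw [act_mul (SLdet A) (gam_det_pos l hl i), act_SL] at h2
    rw [sub_eq_zero]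
    nth_rw 1 [← h2]
    rw [kj_smul]

section
variable (l : ℕ) [Fact l.Prime] {V k : Type*} [CommRing V] [Field k] [CharP k l]
  (φ : V →+* ℂ) (hφ : Function.Injective φ) (ρ : V →+* k) (ζ : V)
  (hζ : φ ζ = Complex.exp (2 * Real.pi * Complex.I / l)) (hζ1 : ρ ζ = 1)
  (hintg : ∀ (p : V[X]) (z : ℂ), p.Monic → p.eval₂ φ z = 0 → ∃ y, φ y = z)
  (n r s : ℕ) (h5 : 5 ≤ l) (hr : r = 0 ∨ r = 1) (hs : s = 0 ∨ s = 1) (hlr : l = 12 * n + 4 * r + 6 * s + 1)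
include hφ hζ hζ1 h5 hr hs hlr hintg

open Classical in
lemma ss_count_abs : 2 * (Finset.univ.filter fun j : ZMod l => (gpol (ZMod l) n r s).eval j = 0).card = (Hset l).ncard := by
  have hl : l.Prime := Fact.out
  obtain ⟨p, hp1, hp2, hp3, hp4⟩ := pF_exists l φ hφ ρ ζ hζ hζ1
  set P := p.map φ with hP
  have hP3 : ∀ τ, Ffun l τ = P.eval (kj τ) := fun τ => by rw [hp3, hP, eval_map]
  have hpd : p.natDegree = 2 * l := le_antisymm hp1 (le_natDegree_of_ne_zero (by
    rw [hp2]; intro h; have := congrArg φ h; simp at this))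
  have hpm : (-p).Monic := by
    rw [Monic, leadingCoeff, natDegree_neg, hpd, coeff_neg, hp2, neg_neg]
  have hPd : P.natDegree = 2 * l := by rw [hP, natDegree_map_eq_of_injective hφ, hpd]
  have hPl : P.leadingCoeff = -1 := by
    rw [leadingCoeff, hPd, hP, coeff_map, hp2, map_neg, map_one]
  have hP0 : P ≠ 0 := by intro h; rw [h] at hPl; simp at hPl
  have lift : ∀ z : ℂ, z ∈ P.roots → ∃ y, φ y = z := by
    intro z hz
    refine hintg (-p) z hpm ?_
    rw [eval₂_neg, ← eval_map, ← hP]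
    rw [(mem_roots hP0).1 hz, neg_zero]
  choose! g hg using lift
  set R := P.roots.map g with hR
  have hRφ : R.map φ = P.roots := by
    rw [hR, Multiset.map_map]
    conv_rhs => rw [← Multiset.map_id P.roots]
    exact Multiset.map_congr rfl fun z hz => hg z hz
  have hpR : p = C (-1) * (R.map fun v => X - C v).prod := by
    apply map_injective φ hφ
    rw [Polynomial.map_mul, map_C, map_neg, map_one, Polynomial.map_multiset_prod, Multiset.map_map]
    have := (IsAlgClosed.splits P).eq_prod_roots
    rw [hPl, ← hRφ, Multiset.map_map] at this
    rw [← hP, this]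
    congr 3
    ext v
    simp
  have hRρ : R.map ρ = 2 • (Finset.univ : Finset (ZMod l)).val.map (ZMod.castHom dvd_rfl k) := by
    have h1 := hp4
    rw [hpR, Polynomial.map_mul, map_C, map_neg, map_one, Polynomial.map_multiset_prod, Multiset.map_map] at h1
    have h2 : ((R.map ρ).map fun v => X - C v).prod = (X ^ l - X) ^ 2 := by
      rw [Multiset.map_map]
      rw [C_neg, C_1, neg_mul, one_mul, neg_inj] at h1
      rw [← h1]
      congr 2
      ext v
      simp
    have h3 : (X ^ l - X : k[X]) = ((X ^ l - X : (ZMod l)[X])).map (ZMod.castHom dvd_rfl k) := by simp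
    have h4 : (X ^ l - X : (ZMod l)[X]) = ∏ a : ZMod l, (X - C a) := by
      have hr := FiniteField.roots_X_pow_card_sub_X (ZMod l)
      rw [ZMod.card] at hr
      have hd := FiniteField.X_pow_card_sub_X_natDegree_eq (ZMod l) hl.one_lt
      have := prod_multiset_X_sub_C_of_monic_of_roots_card_eq (p := (X ^ l - X : (ZMod l)[X]))
        (monic_X_pow_sub (by rw [degree_X]; exact_mod_cast hl.one_lt)) (by rw [hr, hd]; simp [ZMod.card])
      rw [hr] at this
      exact this.symm
    have h5 : (X ^ l - X : k[X]).roots = (Finset.univ : Finset (ZMod l)).val.map (ZMod.castHom dvd_rfl k) := by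
      rw [h3, h4, Polynomial.map_prod]
      simp only [Polynomial.map_sub, map_X, map_C]
      rw [← roots_multiset_prod_X_sub_C ((Finset.univ : Finset (ZMod l)).val.map (ZMod.castHom dvd_rfl k)), Multiset.map_map]
      rfl
    rw [← roots_multiset_prod_X_sub_C (R.map ρ), h2, roots_pow, h5]
  set m := (R.filter fun v => (gpol k n r s).eval (ρ v) = 0).map φ with hm
  have hmem : ∀ z, z ∈ m ↔ z ∈ Hset l := by
    intro z
    rw [hm, Multiset.mem_map]
    simp only [Multiset.mem_filter]
    constructor
    · rintro ⟨v, ⟨hv, hv0⟩, rfl⟩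
      have : φ v ∈ P.roots := by rw [← hRφ]; exact Multiset.mem_map_of_mem φ hv
      obtain ⟨τ, hτ⟩ := kj_surj (φ v)
      rw [mem_roots hP0, IsRoot, ← hτ, ← hP3, F_zero_iff hl] at this
      obtain ⟨M, h1, h3⟩ := this
      refine ⟨τ, hτ, M, h1, ?_, h3⟩
      by_contra h2
      exact gbar_ne l φ hφ ρ ζ hζ hζ1 hintg n r s h5 hr hs hlr h1 h2 h3 v hτ.symm hv0
    · rintro ⟨τ, rfl, hH⟩
      have : kj τ ∈ P.roots := by
        rw [mem_roots hP0, IsRoot, ← hP3, F_zero_iff hl]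
        obtain ⟨M, h1, -, h3⟩ := hH
        exact ⟨M, h1, h3⟩
      rw [← hRφ, Multiset.mem_map] at this
      obtain ⟨v, hv, hv2⟩ := this
      exact ⟨v, ⟨hv, gbar_zero l φ hφ ρ ζ hζ hζ1 n r s h5 hr hs hlr hH v hv2⟩, hv2⟩
  have hnd : m.Nodup := by
    rw [Multiset.nodup_iff_count_le_one]
    intro z
    by_cases hz : z ∈ m
    · have hle : m ≤ P.roots := by
        rw [← hRφ, hm]; exact Multiset.map_le_map (Multiset.filter_le _ _)
      refine (Multiset.count_le_of_le z hle).trans ?_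
      rw [count_roots]
      obtain ⟨τ, rfl, hH⟩ := (hmem z).1 hz
      by_contra hlt
      push Not at hlt
      exact F_simple hl h5 P hP3 hH ((one_lt_rootMultiplicity_iff_isRoot hP0).1 hlt).2
    · rw [Multiset.count_eq_zero_of_notMem hz]; exact zero_le
  have e1 : (Hset l).ncard = m.card := by
    have : Hset l = (m.toFinset : Set ℂ) := by ext z; simp [hmem]
    rw [this, Set.ncard_coe_finset, Multiset.toFinset_card_of_nodup hnd]
  have e2 : m.card = ((R.map ρ).filter fun x => (gpol k n r s).eval x = 0).card := by
    clear_value R m; rw [hm, Multiset.card_map, Multiset.filter_map, Multiset.card_map]; rfl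
  rw [e1, e2, hRρ, Multiset.filter_nsmul, Multiset.card_nsmul, Multiset.filter_map, Multiset.card_map]
  congr 1
  rw [Finset.card_def, Finset.filter_val]
  congr 1
  refine Multiset.filter_congr fun a _ => ?_
  simp only [Function.comp]
  rw [← gpol_map n r s (ZMod l) k (ZMod.castHom dvd_rfl k), eval_map, eval₂_hom]
  exact (map_eq_zero_iff _ (RingHom.injective _)).symm

end

open Classical in
theorem ss_count (l : ℕ) [Fact l.Prime] (n r s : ℕ) (h5 : 5 ≤ l) (hr : r = 0 ∨ r = 1) (hs : s = 0 ∨ s = 1)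
    (hlr : l = 12 * n + 4 * r + 6 * s + 1) :
    2 * (Finset.univ.filter fun j : ZMod l => (gpol (ZMod l) n r s).eval j = 0).card = (Hset l).ncard := by
  have hl : l.Prime := Fact.out
  let Z : Subring ℂ := ⊥
  have hne : Ideal.span {((l : ℕ) : Z)} ≠ ⊤ := by
    rw [Ne, Ideal.span_singleton_eq_top]
    rintro ⟨u, hu⟩
    have h1 : ((u⁻¹ : Zˣ) : Z) * (l : Z) = 1 := by rw [← hu]; simp
    obtain ⟨z, hz⟩ := Subring.mem_bot.1 ((u⁻¹ : Zˣ) : Z).2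
    have h2 := congrArg (Subtype.val) h1
    simp only [Subring.coe_mul, ← hz] at h2
    have h3 : z * (l : ℤ) = 1 := by
      have : ((z * (l : ℤ) : ℤ) : ℂ) = 1 := by push_cast; simpa using h2
      exact_mod_cast this
    have := Int.isUnit_iff.1 (IsUnit.of_mul_eq_one_right _ h3)
    have := hl.two_le
    omega
  obtain ⟨B, hB1, hB2⟩ := Ideal.image_subset_nonunits_valuationSubring (A := Z) (Ideal.span {((l : ℕ) : Z)}) hne
  have hlB : ((l : ℕ) : ℂ) ∈ B.nonunits := hB2 ⟨((l : ℕ) : Z), Ideal.subset_span rfl, by simp⟩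
  let k := IsLocalRing.ResidueField B
  let ρ : B →+* k := IsLocalRing.residue B
  have hk : ((l : ℕ) : k) = 0 := by
    have : ρ ((l : ℕ) : B) = 0 := by
      rw [IsLocalRing.residue_eq_zero_iff, IsLocalRing.mem_maximalIdeal]
      have := (ValuationSubring.coe_mem_nonunits_iff (a := ((l : ℕ) : B))).1 (by simpa using hlB)
      exact this
    rw [map_natCast] at this
    exact this
  haveI : CharP k l := by
    rw [CharP.charP_iff_prime_eq_zero hl]; exact hk
  have hintg : ∀ (p : B[X]) (z : ℂ), p.Monic → p.eval₂ (algebraMap B ℂ) z = 0 → ∃ y, algebraMap B ℂ y = z := by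
    intro p z h1 h2
    exact IsIntegrallyClosed.isIntegral_iff.1 ⟨p, h1, h2⟩
  obtain ⟨ζ, hζ⟩ := hintg (X ^ l - C 1) (Complex.exp (2 * Real.pi * Complex.I / l)) (monic_X_pow_sub_C 1 hl.ne_zero) (by
    rw [eval₂_sub, eval₂_pow, eval₂_X, eval₂_C, map_one, (Complex.isPrimitiveRoot_exp l hl.ne_zero).pow_eq_one, sub_self])
  have hφ : Function.Injective (algebraMap B ℂ) := Subtype.val_injective
  have hζ1 : ρ ζ = 1 := by
    have h1 : ζ ^ l = 1 := by
      apply hφ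
      rw [map_pow, hζ, map_one, (Complex.isPrimitiveRoot_exp l hl.ne_zero).pow_eq_one]
    have h2 : (ρ ζ - 1) ^ l = 0 := by
      rw [sub_pow_char, ← map_pow, h1]; simp
    exact sub_eq_zero.1 (pow_eq_zero_iff hl.ne_zero |>.1 h2)
  exact ss_count_abs l (algebraMap B ℂ) hφ ρ ζ hζ hζ1 hintg n r s h5 hr hs hlr

end H7

namespace H7
open UpperHalfPlane hiding I
open Complex ModularForm
open scoped Manifold MatrixGroups ModularForm Topology

/-- membership in the lattice `ℤθ + ℤ` -/
def Lm {K : Type*} [Field K] (θ z : K) : Prop := ∃ m n : ℤ, z = m * θ + n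
/-- homothety of the lattices -/
def Homo {K : Type*} [Field K] (θ θ' : K) : Prop := ∃ x : K, x ≠ 0 ∧ ∀ z, Lm θ z ↔ Lm θ' (x * z)

section
variable {K : Type*} [Field K] (σ : K →+* ℂ)

lemma Lm.add {θ z w : K} (h : Lm θ z) (h' : Lm θ w) : Lm θ (z + w) := by
  obtain ⟨a, b, rfl⟩ := h; obtain ⟨c, d, rfl⟩ := h'
  exact ⟨a + c, b + d, by push_cast; ring⟩
lemma Lm.zsmul {θ z : K} (h : Lm θ z) (k : ℤ) : Lm θ (k * z) := by
  obtain ⟨a, b, rfl⟩ := h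
  exact ⟨k * a, k * b, by push_cast; ring⟩
lemma Lm.self (θ : K) : Lm θ θ := ⟨1, 0, by simp⟩
lemma Lm.one (θ : K) : Lm θ 1 := ⟨0, 1, by simp⟩
lemma Lm.stab {θ w z : K} (h1 : Lm θ (w * θ)) (h2 : Lm θ w) (h : Lm θ z) : Lm θ (w * z) := by
  obtain ⟨a, b, rfl⟩ := h
  have := (h1.zsmul a).add (h2.zsmul b)
  convert this using 1; ring

lemma Homo.symm {θ θ' : K} (h : Homo θ θ') : Homo θ' θ := by
  obtain ⟨x, hx, h⟩ := h
  exact ⟨x⁻¹, inv_ne_zero hx, fun z => by rw [h, mul_inv_cancel_left₀ hx]⟩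
lemma Homo.trans {θ θ' θ'' : K} (h : Homo θ θ') (h' : Homo θ' θ'') : Homo θ θ'' := by
  obtain ⟨x, hx, h⟩ := h
  obtain ⟨y, hy, h'⟩ := h'
  exact ⟨y * x, mul_ne_zero hy hx, fun z => by rw [h, h', mul_assoc]⟩

lemma Lm_indep {θ : K} (hθ : 0 < (σ θ).im) {m n m' n' : ℤ} (h : (m : K) * θ + n = m' * θ + n') : m = m' ∧ n = n' := by
  have := congrArg σ h
  simp only [map_add, map_mul, map_intCast] at this
  exact lin_indep ⟨σ θ, hθ⟩ this

lemma kj_of_homo {θ θ' : K} (hθ : 0 < (σ θ).im) (hθ' : 0 < (σ θ').im) (h : Homo θ θ') :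
    kj ⟨σ θ, hθ⟩ = kj ⟨σ θ', hθ'⟩ := by
  obtain ⟨x, hx, h⟩ := h
  obtain ⟨a, b, h1⟩ := (h θ).1 (Lm.self θ)
  obtain ⟨c, d, h2⟩ := (h 1).1 (Lm.one θ)
  obtain ⟨e, f, h3⟩ := (h (x⁻¹ * θ')).2 (by rw [mul_inv_cancel_left₀ hx]; exact Lm.self _)
  obtain ⟨g, k, h4⟩ := (h (x⁻¹ * 1)).2 (by rw [mul_inv_cancel_left₀ hx]; exact Lm.one _)
  rw [mul_one] at h2
  have h3' : θ' = x * (e * θ + f) := by rw [← h3, mul_inv_cancel_left₀ hx]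
  have h4' : 1 = x * (g * θ + k) := by rw [← h4, mul_inv_cancel_left₀ hx]
  obtain ⟨i1, i2⟩ := Lm_indep σ hθ' (m := 1) (n := 0) (m' := e * a + f * c) (n' := e * b + f * d) (by
    push_cast; linear_combination h3' + (e : K) * h1 + (f : K) * h2)
  obtain ⟨i3, i4⟩ := Lm_indep σ hθ' (m := 0) (n := 1) (m' := g * a + k * c) (n' := g * b + k * d) (by
    push_cast; linear_combination h4' + (g : K) * h1 + (k : K) * h2)
  let M : Mat := !![a, b; c, d]
  have hM : M.det = a * d - b * c := by simp [M, Matrix.det_fin_two]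
  have hu : M.det * (e * k - f * g) = 1 := by rw [hM]; linear_combination (-(g * b + k * d)) * i1 - i4 + (g * a + k * c) * i2
  have hne : M.det ≠ 0 := by intro h; rw [h, zero_mul] at hu; exact zero_ne_one hu
  have hd := den_ne hne ⟨σ θ', hθ'⟩
  have hq : σ θ = nmr M ⟨σ θ', hθ'⟩ / den M ⟨σ θ', hθ'⟩ := by
    rw [eq_div_iff hd]
    have e1 := congrArg σ h1
    have e2 := congrArg σ h2
    simp only [map_add, map_mul, map_intCast] at e1 e2
    simp only [den, nmr, M]
    simp
    rw [← e1, ← e2, mul_comm]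
  have him := im_mob M hne ⟨σ θ', hθ'⟩
  rw [← hq] at him
  have hns : 0 < Complex.normSq (den M ⟨σ θ', hθ'⟩) := Complex.normSq_pos.2 hd
  have hpos : 0 < M.det := by
    rw [him] at hθ
    have h5 : 0 < (M.det : ℝ) * UpperHalfPlane.im ⟨σ θ', hθ'⟩ := by
      by_contra hc
      push Not at hc
      exact absurd hθ (not_lt.2 (div_nonpos_of_nonpos_of_nonneg hc hns.le))
    have : 0 < (M.det : ℝ) := pos_of_mul_pos_left h5 (UpperHalfPlane.im_pos _).le
    exact_mod_cast this
  have h1' : M.det = 1 := by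
    rcases Int.isUnit_iff.1 (IsUnit.of_mul_eq_one _ hu) with h | h
    · exact h
    · omega
  have hex : ∃ A : SL(2,ℤ), (A : Mat) = M := ⟨⟨M, h1'⟩, rfl⟩
  obtain ⟨A, hA⟩ := hex
  rw [← kj_smul A ⟨σ θ', hθ'⟩, ← act_SL, hA]
  congr 1
  ext
  rw [act_coe hpos, ← hq]

lemma homo_of_kj {θ θ' : K} (hθ : 0 < (σ θ).im) (hθ' : 0 < (σ θ').im) (h : kj ⟨σ θ, hθ⟩ = kj ⟨σ θ', hθ'⟩) : Homo θ θ' := by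
  obtain ⟨A, hA⟩ := kj_inj h
  rw [← act_SL] at hA
  have h1 := congrArg (fun z : ℍ => (z : ℂ)) hA
  simp only [act_coe (SLdet A)] at h1
  have hd := den_ne (SLdet A).ne' ⟨σ θ', hθ'⟩
  rw [eq_div_iff hd] at h1
  have hdet : (A : Mat).det = 1 := A.2
  generalize (A : Mat) = M at *
  set x : K := M 1 0 * θ' + M 1 1 with hx
  have hdx : den M ⟨σ θ', hθ'⟩ = σ x := by simp [den, hx]
  have h2 : θ * x = M 0 0 * θ' + M 0 1 := by
    apply σ.injective
    rw [map_mul, ← hdx]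
    simpa [nmr] using h1
  have hx0 : x ≠ 0 := by intro h; rw [hdx, h, map_zero] at hd; exact hd rfl
  rw [Matrix.det_fin_two] at hdet
  have hdK : (M 0 0 : K) * M 1 1 - M 0 1 * M 1 0 = 1 := by
    have := congrArg (Int.cast : ℤ → K) hdet
    push_cast at this
    exact this
  refine ⟨x, hx0, fun z => ⟨?_, ?_⟩⟩
  · rintro ⟨m, n, rfl⟩
    refine ⟨m * M 0 0 + n * M 1 0, m * M 0 1 + n * M 1 1, ?_⟩
    push_cast
    linear_combination (m : K) * h2 + n * hx
  · rintro ⟨m, n, h3⟩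
    refine ⟨m * M 1 1 - n * M 1 0, - m * M 0 1 + n * M 0 0, ?_⟩
    apply mul_left_cancel₀ hx0
    rw [h3]
    push_cast
    linear_combination (-((m : K) * M 1 1 - n * M 1 0)) * h2 - (- m * M 0 1 + n * M 0 0 : K) * hx - (m * θ' + n) * hdK

end

section
variable {K : Type*} [Field K] [NumberField K] (hdeg : Module.finrank ℚ K = 2) {l : ℕ} (hl : l.Prime) (h5 : 5 ≤ l)
  (α : K) (hα : α ^ 2 = -(l : K)) (σ : K →+* ℂ)

include hl hα in
lemma al_re : (σ α).re = 0 ∧ (σ α).im ^ 2 = l := by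
  have h := congrArg σ hα
  rw [map_pow, map_neg, map_natCast] at h
  have h1 := congrArg Complex.re h
  have h2 := congrArg Complex.im h
  simp [pow_two] at h1 h2
  have hl0 : (0 : ℝ) < l := by exact_mod_cast hl.pos
  have hi : (σ α).im ≠ 0 := by intro h0; rw [h0] at h1; nlinarith [mul_self_nonneg (σ α).re]
  have hr : (σ α).re = 0 := by
    have : (σ α).re * (σ α).im = 0 := by linarith
    exact (mul_eq_zero.1 this).resolve_right hi
  refine ⟨hr, ?_⟩
  rw [hr] at h1; linarith

include hl hα in
lemma al_im_ne : (σ α).im ≠ 0 := by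
  have := (al_re hl α hα σ).2
  intro h; rw [h] at this
  have h0 : (0 : ℝ) < l := by exact_mod_cast hl.pos
  simp at this; linarith

lemma rat_re (p q : ℚ) : (σ ((p : K) + q * α)) = (p : ℂ) + q * σ α := by
  rw [map_add, map_mul, map_ratCast, map_ratCast]

include hl hα in
lemma al_indep {p q p' q' : ℚ} (h : (p : K) + q * α = p' + q' * α) : p = p' ∧ q = q' := by
  obtain ⟨σ⟩ : Nonempty (K →+* ℂ) := inferInstance
  have h1 := congrArg σ h
  rw [rat_re, rat_re] at h1
  have h2 := congrArg Complex.re h1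
  have h3 := congrArg Complex.im h1
  have hr := (al_re hl α hα σ).1
  have hi := al_im_ne hl α hα σ
  simp [hr] at h2 h3
  exact ⟨by exact_mod_cast h2, h3.resolve_right hi⟩

include hdeg hl hα in
lemma al_span (x : K) : ∃ p q : ℚ, x = (p : K) + q * α := by
  have hli : LinearIndependent ℚ ![(1 : K), α] := by
    rw [LinearIndependent.pair_iff]
    intro s t h
    have h' : ((s : ℚ) : K) + (t : ℚ) * α = (0 : ℚ) + (0 : ℚ) * α := by
      simpa [Algebra.smul_def] using h
    exact al_indep hl α hα h'
  have hs := hli.span_eq_top_of_card_eq_finrank (by simp [hdeg])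
  have hx : x ∈ Submodule.span ℚ (Set.range ![(1 : K), α]) := by rw [hs]; trivial
  rw [Matrix.range_cons, Matrix.range_cons, Matrix.range_empty, Set.union_empty] at hx
  obtain ⟨p, q, h⟩ := Submodule.mem_span_pair.1 hx
  exact ⟨p, q, by rw [← h]; simp [Algebra.smul_def]⟩

lemma rat_int {q : ℚ} (h : IsIntegral ℤ ((q : ℚ) : ℂ)) : ∃ a : ℤ, (a : ℚ) = q := by
  have h1 : IsIntegral ℤ q := by
    have : IsIntegral ℤ (algebraMap ℚ ℂ q) := by simpa using h
    exact (isIntegral_algebraMap_iff (algebraMap ℚ ℂ).injective).1 this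
  obtain ⟨a, ha⟩ := IsIntegrallyClosed.isIntegral_iff.1 h1
  exact ⟨a, by simpa using ha⟩

include hdeg hl hα in
lemma quad_int {x : K} (hx : IsIntegral ℤ x) : ∃ a b : ℤ, 2 * x = a + b * α ∧ (4 : ℤ) ∣ a ^ 2 + l * b ^ 2 := by
  obtain ⟨σ⟩ : Nonempty (K →+* ℂ) := inferInstance
  obtain ⟨p, q, rfl⟩ := al_span hdeg hl α hα x
  obtain ⟨hr, hi⟩ := al_re hl α hα σ
  have h1 := map_isIntegral_int σ hx
  have h2 := map_isIntegral_int (starRingEnd ℂ) h1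
  have hb2 : (σ α) ^ 2 = - (l : ℂ) := by rw [← map_pow, hα]; simp
  have hc : (starRingEnd ℂ) (σ α) = - σ α := by
    apply Complex.ext <;> simp [hr]
  obtain ⟨a, ha⟩ := rat_int (q := 2 * p) (by
    have := IsIntegral.add h1 h2
    have e : σ (p + q * α) + (starRingEnd ℂ) (σ (p + q * α)) = ((2 * p : ℚ) : ℂ) := by
      rw [rat_re, map_add, map_mul, hc]; simp; ring
    rwa [e] at this)
  obtain ⟨N, hN⟩ := rat_int (q := p ^ 2 + l * q ^ 2) (by
    have := IsIntegral.mul h1 h2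
    have e : σ (p + q * α) * (starRingEnd ℂ) (σ (p + q * α)) = ((p ^ 2 + l * q ^ 2 : ℚ) : ℂ) := by
      rw [rat_re, map_add, map_mul, hc]; simp; linear_combination -(q : ℂ) ^ 2 * hb2
    rwa [e] at this)
  have e1 : (l : ℚ) * (2 * q) ^ 2 = ((4 * N - a ^ 2 : ℤ) : ℚ) := by push_cast; rw [hN, ha]; ring
  obtain ⟨u, hu⟩ : ∃ u : ℤ, (u : ℚ) = l * (2 * q) := by
    have : IsIntegral ℤ ((l : ℚ) * (2 * q)) := by
      refine ⟨X ^ 2 - C ((l : ℤ) * (4 * N - a ^ 2)), monic_X_pow_sub_C _ two_ne_zero, ?_⟩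
      rw [eval₂_sub, eval₂_pow, eval₂_X, eval₂_C, mul_pow]
      simp at e1 ⊢
      rw [← e1]; ring
    obtain ⟨a, ha⟩ := IsIntegrallyClosed.isIntegral_iff.1 this
    exact ⟨a, by simpa using ha⟩
  have e2 : u ^ 2 = l * (4 * N - a ^ 2) := by
    have : (u : ℚ) ^ 2 = l * ((4 * N - a ^ 2 : ℤ) : ℚ) := by rw [← e1, hu]; ring
    exact_mod_cast this
  have e3 : (l : ℤ) ∣ u := (Nat.prime_iff_prime_int.1 hl).dvd_of_dvd_pow (Dvd.intro _ e2.symm)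
  obtain ⟨b, rfl⟩ := e3
  have hl0 : (l : ℚ) ≠ 0 := by exact_mod_cast hl.ne_zero
  have hb : (b : ℚ) = 2 * q := by
    apply mul_left_cancel₀ hl0
    rw [← hu]; push_cast; ring
  refine ⟨a, b, ?_, N, ?_⟩
  · have h3 : (a : K) = 2 * (p : K) := by
      have := congrArg (Rat.cast : ℚ → K) ha; push_cast at this; exact this
    have h4 : (b : K) = 2 * (q : K) := by
      have := congrArg (Rat.cast : ℚ → K) hb; push_cast at this; exact this
    rw [h3, h4]; ring
  · have : ((a ^ 2 + l * b ^ 2 : ℤ) : ℚ) = ((4 * N : ℤ) : ℚ) := by push_cast; rw [ha, hb, hN]; ring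
    exact_mod_cast this

include hl hα in
lemma mem_Hset (c : ℂ) : c ∈ Hset l ↔ ∃ (θ : K) (hθ : 0 < (σ θ).im), Lm θ (α * θ) ∧ Lm θ α ∧ kj ⟨σ θ, hθ⟩ = c := by
  have hb2 : (σ α) ^ 2 = - (l : ℂ) := by rw [← map_pow, hα]; simp
  constructor
  · rintro ⟨τ, rfl, M, h1, h2, h3⟩
    have hp : 0 < M.det := by rw [h1]; exact_mod_cast hl.pos
    -- choose the sign
    obtain ⟨M', h0, hd, hn⟩ : ∃ M' : Mat, M' 1 0 ≠ 0 ∧ den M' τ = σ α ∧ nmr M' τ = τ * den M' τ := by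
      have hα' := fix_den hp h3
      rw [h2, h1, Int.cast_zero] at hα'
      have hc := fix_c_ne hl h1 h3
      have : (den M τ - σ α) * (den M τ + σ α) = 0 := by push_cast at hα'; linear_combination hα' - hb2
      have hn := fix_nmr hp h3
      rcases mul_eq_zero.1 this with h | h
      · exact ⟨M, hc, sub_eq_zero.1 h, hn⟩
      · refine ⟨-M, by simpa using hc, ?_, ?_⟩
        · rw [den] at h ⊢; simp; linear_combination -h
        · rw [den, nmr] at hn ⊢; simp; linear_combination -hn
    have h0K : (M' 1 0 : K) ≠ 0 := by exact_mod_cast h0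
    have hτ : σ ((α - M' 1 1) / M' 1 0) = τ := by
      rw [map_div₀, map_sub, map_intCast, map_intCast, div_eq_iff (by exact_mod_cast h0), ← hd, den]; ring
    set θ := (α - M' 1 1) / M' 1 0 with hθ
    have hθi : 0 < (σ θ).im := by rw [hτ]; exact τ.im_pos
    refine ⟨θ, hθi, ⟨M' 0 0, M' 0 1, ?_⟩, ⟨M' 1 0, M' 1 1, ?_⟩, ?_⟩
    · apply σ.injective
      rw [hd, nmr] at hn
      simp only [map_add, map_mul, map_intCast, hτ]
      rw [hn]; ring
    · rw [hθ]; field_simp; ring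
    · congr 1; ext; exact hτ
  · rintro ⟨θ, hθ, ⟨a, b, h1⟩, ⟨c, d, h2⟩, rfl⟩
    refine ⟨_, rfl, !![a, b; c, d], ?_⟩
    have key : ((a * d - b * c - l : ℤ) : ℚ) = 0 ∧ ((-(a + d) : ℤ) : ℚ) = 0 := by
      refine al_indep hl α hα (p' := 0) (q' := 0) ?_
      push_cast
      have hcl : (a - α) * (d - α) - b * (c : K) = 0 := by
        have e1 : (α - a) * θ = b := by rw [sub_mul, h1]; ring
        have e2 : c * θ = α - d := by linear_combination -h2
        rw [← e1]
        linear_combination (α - a) * -e2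
      linear_combination hcl - hα
    have k1 : a * d - b * c - l = 0 := by exact_mod_cast key.1
    have k2 : -(a + d) = 0 := by exact_mod_cast key.2
    have hdet : (!![a, b; c, d] : Mat).det = l := by rw [Matrix.det_fin_two_of]; linarith
    refine ⟨hdet, by simp; linarith, fix_of_nmr (by rw [hdet]; exact_mod_cast hl.pos) ?_⟩
    have e1 := congrArg σ h1
    have e2 := congrArg σ h2
    simp only [map_add, map_mul, map_intCast] at e1 e2
    simp [nmr, den]
    rw [← e1, ← e2]; ring

end
end H7

namespace H7
open UpperHalfPlane hiding I
open Complex ModularForm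
open scoped Manifold MatrixGroups ModularForm Topology
open NumberField nonZeroDivisors

/-- stability of the lattice under multiplication by `ω` -/
def Stb {K : Type*} [Field K] (ω θ : K) : Prop := Lm θ (ω * θ) ∧ Lm θ ω

section
variable {K : Type*} [Field K] [NumberField K] (hdeg : Module.finrank ℚ K = 2) {l : ℕ} (hl : l.Prime) (h5 : 5 ≤ l)
  (α : K) (hα : α ^ 2 = -(l : K)) (σ : K →+* ℂ)

lemma lift_int {x : K} (h : IsIntegral ℤ x) : ∃ y : 𝓞 K, ((y : 𝓞 K) : K) = x := ⟨⟨x, h⟩, rfl⟩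

/-- the lattice of `θ` is homothetic to the ideal `I` -/
def IL (I : Ideal (𝓞 K)) (θ w : K) : Prop := w ≠ 0 ∧ ∀ z, Lm θ z ↔ ∃ y ∈ I, ((y : 𝓞 K) : K) = w * z

include hdeg hl hα in
lemma ideal_lattice (I : Ideal (𝓞 K)) (hI : I ≠ ⊥) : ∃ θ w : K, 0 < (σ θ).im ∧ IL I θ w := by
  have hfr : Module.finrank ℤ I = 2 := by
    have := Ideal.finrank_eq_finrank (Module.Free.chooseBasis ℤ (𝓞 K)) I hI
    rw [RingOfIntegers.rank, hdeg] at this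
    exact this
  let b : Module.Basis (Fin 2) ℤ I := Module.finBasisOfFinrankEq ℤ I hfr
  set u : K := ((b 0 : 𝓞 K) : K) with hu
  set v : K := ((b 1 : 𝓞 K) : K) with hv
  have hmem : ∀ z : K, (∃ y ∈ I, ((y : 𝓞 K) : K) = z) ↔ ∃ m n : ℤ, z = m * u + n * v := by
    intro z
    constructor
    · rintro ⟨y, hy, rfl⟩
      refine ⟨b.repr ⟨y, hy⟩ 0, b.repr ⟨y, hy⟩ 1, ?_⟩
      have := b.sum_repr ⟨y, hy⟩
      rw [Fin.sum_univ_two] at this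
      have h2 := congrArg (fun t : I => ((t : 𝓞 K) : K)) this
      simp only at h2
      rw [← h2]
      simp [hu, hv]
    · rintro ⟨m, n, rfl⟩
      refine ⟨((m • b 0 + n • b 1 : I) : 𝓞 K), (m • b 0 + n • b 1 : I).2, ?_⟩
      simp [hu, hv]
  have hind : ∀ m n : ℤ, (m : K) * u + n * v = 0 → m = 0 ∧ n = 0 := by
    intro m n h
    have h2 : m • b 0 + n • b 1 = 0 := by
      apply Subtype.ext
      apply RingOfIntegers.coe_injective
      simpa [hu, hv] using h
    have := (Fintype.linearIndependent_iff.1 b.linearIndependent) ![m, n] (by simpa [Fin.sum_univ_two] using h2)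
    exact ⟨this 0, this 1⟩
  have hv0 : v ≠ 0 := by
    intro h
    have := hind 0 1 (by simp [h])
    omega
  obtain ⟨p, q, hpq⟩ := al_span hdeg hl α hα (u / v)
  have him : (σ (u / v)).im ≠ 0 := by
    rw [hpq, rat_re]
    simp
    refine ⟨?_, al_im_ne hl α hα σ⟩
    rintro rfl
    simp at hpq
    rw [div_eq_iff hv0] at hpq
    have := hind p.den (-p.num) (by
      rw [hpq]
      have : (p : K) * p.den = p.num := by exact_mod_cast Rat.mul_den_eq_num p
      push_cast
      linear_combination v * this)
    have := p.den_nz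
    omega
  rcases lt_or_gt_of_ne him with h | h
  · refine ⟨-(u / v), v, by simpa using h, hv0, fun z => ?_⟩
    rw [hmem]
    constructor
    · rintro ⟨m, n, rfl⟩
      exact ⟨-m, n, by push_cast; field_simp⟩
    · rintro ⟨m, n, h⟩
      refine ⟨-m, n, ?_⟩
      apply mul_left_cancel₀ hv0
      rw [h]; push_cast; field_simp
  · refine ⟨(u / v), v, h, hv0, fun z => ?_⟩
    rw [hmem]
    constructor
    · rintro ⟨m, n, rfl⟩
      exact ⟨m, n, by field_simp⟩
    · rintro ⟨m, n, h⟩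
      refine ⟨m, n, ?_⟩
      apply mul_left_cancel₀ hv0
      rw [h]; field_simp

lemma IL.stb {I : Ideal (𝓞 K)} {θ w : K} (h : IL I θ w) {ω : K} (hω : IsIntegral ℤ ω) : Stb ω θ := by
  have key : ∀ z, Lm θ z → Lm θ (ω * z) := by
    intro z hz
    obtain ⟨y, hy, h1⟩ := (h.2 z).1 hz
    obtain ⟨o, ho⟩ := lift_int hω
    refine (h.2 _).2 ⟨o * y, I.mul_mem_left _ hy, ?_⟩
    have e : ((o * y : 𝓞 K) : K) = (o : K) * (y : K) := by simp
    rw [e, h1, ho]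
    ring
  refine ⟨key _ (Lm.self θ), ?_⟩
  have := key _ (Lm.one θ)
  rwa [mul_one] at this

lemma lattice_ideal {θ : K} (hst : ∀ x z : K, IsIntegral ℤ x → Lm θ z → Lm θ (x * z)) :
    ∃ (I : Ideal (𝓞 K)) (w : K), I ≠ ⊥ ∧ IL I θ w := by
  obtain ⟨m, hm0, hm⟩ : ∃ m : ℤ, m ≠ 0 ∧ IsIntegral ℤ ((m : K) * θ) := by
    obtain ⟨y, hy, h⟩ := exists_integral_multiples ℤ ℚ ({θ} : Finset K)
    refine ⟨y, hy, ?_⟩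
    simpa [Algebra.smul_def] using h θ (by simp)
  have hmK : (m : K) ≠ 0 := by exact_mod_cast hm0
  let I : Ideal (𝓞 K) :=
    { carrier := {y | Lm θ ((y : K) / m)}
      add_mem' := by
        intro a b ha hb
        have := Lm.add ha hb
        simp only [Set.mem_setOf_eq, map_add] at this ⊢
        rwa [← add_div] at this
      zero_mem' := ⟨0, 0, by simp⟩
      smul_mem' := by
        intro c x hx
        have := hst c _ c.2 hx
        simp only [Set.mem_setOf_eq, smul_eq_mul, map_mul] at this ⊢
        rwa [mul_div_assoc] }
  have hI : ∀ y : 𝓞 K, y ∈ I ↔ Lm θ ((y : K) / m) := fun y => Iff.rfl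
  refine ⟨I, m, ?_, hmK, fun z => ⟨?_, ?_⟩⟩
  · intro h
    have : ((m : ℤ) : 𝓞 K) ∈ I := by rw [hI]; exact ⟨0, 1, by simp [hmK]⟩
    rw [h, Ideal.mem_bot] at this
    exact hm0 (by exact_mod_cast this)
  · rintro ⟨a, b, rfl⟩
    have hi : IsIntegral ℤ ((m : K) * (a * θ + b)) := by
      have : (m : K) * (a * θ + b) = a * (m * θ) + ((m * b : ℤ) : K) := by push_cast; ring
      rw [this]
      exact (((isIntegral_algebraMap (R := ℤ) (A := K) (x := a))).mul hm).add (isIntegral_algebraMap (R := ℤ) (A := K) (x := m * b))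
    obtain ⟨o, ho⟩ := lift_int hi
    refine ⟨o, ?_, ho⟩
    rw [hI, ho, mul_div_cancel_left₀ _ hmK]
    exact ⟨a, b, rfl⟩
  · rintro ⟨y, hy, h⟩
    rw [hI, h, mul_div_cancel_left₀ _ hmK] at hy
    exact hy

lemma mk0_iff {I J : (Ideal (𝓞 K))⁰} {θ w θ' w' : K} (h : IL (I : Ideal (𝓞 K)) θ w) (h' : IL (J : Ideal (𝓞 K)) θ' w') :
    ClassGroup.mk0 I = ClassGroup.mk0 J ↔ Homo θ θ' := by
  rw [ClassGroup.mk0_eq_mk0_iff_exists_fraction_ring K]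
  obtain ⟨hw, h⟩ := h
  obtain ⟨hw', h'⟩ := h'
  have e1 : ∀ z, z ∈ ((I : Ideal (𝓞 K)) : FractionalIdeal (𝓞 K)⁰ K) ↔ Lm θ (z / w) := by
    intro z
    rw [FractionalIdeal.mem_coeIdeal, h, mul_div_cancel₀ _ hw]
  have e2 : ∀ z, z ∈ ((J : Ideal (𝓞 K)) : FractionalIdeal (𝓞 K)⁰ K) ↔ Lm θ' (z / w') := by
    intro z
    rw [FractionalIdeal.mem_coeIdeal, h', mul_div_cancel₀ _ hw']
  constructor
  · rintro ⟨u, hu, h3⟩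
    refine ⟨u * w / w', by positivity, fun z => ?_⟩
    have : u * w / w' * z = (u * (w * z)) / w' := by ring
    rw [this, ← e2, ← h3, FractionalIdeal.mem_singleton_mul]
    constructor
    · intro hz
      exact ⟨w * z, by rwa [e1, mul_div_cancel_left₀ _ hw], rfl⟩
    · rintro ⟨y, hy, h4⟩
      have := mul_left_cancel₀ hu h4
      rwa [← this, e1, mul_div_cancel_left₀ _ hw] at hy
  · rintro ⟨x, hx, h3⟩
    refine ⟨x * w' / w, by positivity, ?_⟩
    ext z
    rw [FractionalIdeal.mem_singleton_mul]
    constructor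
    · rintro ⟨y, hy, rfl⟩
      rw [e1, h3] at hy
      rw [e2]
      convert hy using 1
      field_simp
    · intro hz
      refine ⟨z * w / (x * w'), ?_, by field_simp⟩
      rw [e2] at hz
      rw [e1, h3]
      convert hz using 1
      field_simp

include hdeg hl hα in
/-- representatives of the ideal classes -/
lemma cg_fam (ω : K) (hω : IsIntegral ℤ ω) (hspan : ∀ x : K, IsIntegral ℤ x → ∃ m n : ℤ, x = m + n * ω) :
    ∃ t : ClassGroup (𝓞 K) → K, (∀ c, 0 < (σ (t c)).im) ∧ (∀ c, Stb ω (t c)) ∧ (∀ c d, Homo (t c) (t d) → c = d) ∧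
      ∀ θ, Stb ω θ → ∃ c, Homo θ (t c) := by
  have hex : ∀ c : ClassGroup (𝓞 K), ∃ (I : (Ideal (𝓞 K))⁰) (θ w : K), ClassGroup.mk0 I = c ∧ 0 < (σ θ).im ∧ IL (I : Ideal (𝓞 K)) θ w := by
    intro c
    obtain ⟨I, rfl⟩ := ClassGroup.mk0_surjective c
    obtain ⟨θ, w, h1, h2⟩ := ideal_lattice hdeg hl α hα σ I (mem_nonZeroDivisors_iff_ne_zero.1 I.2)
    exact ⟨I, θ, w, rfl, h1, h2⟩
  choose I t w h1 h2 h3 using hex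
  refine ⟨t, h2, fun c => (h3 c).stb hω, fun c d h => ?_, fun θ hθ => ?_⟩
  · rw [← h1 c, ← h1 d, mk0_iff (h3 c) (h3 d)]; exact h
  · obtain ⟨J, u, hJ, hu⟩ := lattice_ideal (θ := θ) (by
      intro x z hx hz
      obtain ⟨m, n, rfl⟩ := hspan x hx
      have := (hz.zsmul m).add ((Lm.stab hθ.1 hθ.2 hz).zsmul n)
      convert this using 1; ring)
    let J' : (Ideal (𝓞 K))⁰ := ⟨J, mem_nonZeroDivisors_iff_ne_zero.2 hJ⟩
    refine ⟨ClassGroup.mk0 J', ?_⟩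
    rw [← mk0_iff (I := J') hu (h3 _), h1]

end
end H7

namespace H7
open UpperHalfPlane hiding I
open Complex ModularForm
open scoped Manifold MatrixGroups ModularForm Topology
open NumberField nonZeroDivisors

section
variable {K : Type*} [Field K]

lemma stb_iff {ω θ : K} : Stb ω θ ↔ ∀ z, Lm θ z → Lm θ (ω * z) := by
  constructor
  · intro h z hz; exact Lm.stab h.1 h.2 hz
  · intro h
    refine ⟨h _ (Lm.self θ), ?_⟩
    have := h _ (Lm.one θ)
    rwa [mul_one] at this

lemma Homo.stb {ω θ θ' : K} (h : Homo θ θ') (hs : Stb ω θ') : Stb ω θ := by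
  obtain ⟨x, hx, h⟩ := h
  rw [stb_iff] at hs ⊢
  intro z hz
  rw [h] at hz ⊢
  have := hs _ hz
  convert this using 1; ring

def cA : Fin 4 → ℤ := ![0, 1, 0, 1]
def cB : Fin 4 → ℤ := ![0, 0, 1, 1]
def fS : Fin 4 → ℤ := ![1, 1, 2, 2]
def Sg (i : Fin 4) (θ : K) : K := ![θ, 2 * θ, θ / 2, (θ + 1) / 2] i
def Sub (i : Fin 4) (θ y : K) : Prop := ∃ m n : ℤ, y = m * θ + n ∧ 2 ∣ cA i * m + cB i * n

lemma Lm_Sg [CharZero K] (i : Fin 4) (θ z : K) : Lm (Sg i θ) z ↔ Sub i θ (fS i * z) := by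
  have h2 : (2 : K) ≠ 0 := two_ne_zero
  fin_cases i
  · simp [Lm, Sg, Sub, cA, cB, fS]
  · simp [Lm, Sg, Sub, cA, cB, fS]
    constructor
    · rintro ⟨m, n, rfl⟩; exact ⟨2 * m, ⟨n, by push_cast; ring⟩, by simp⟩
    · rintro ⟨m, ⟨n, rfl⟩, ⟨k, rfl⟩⟩; exact ⟨k, n, by push_cast; ring⟩
  · simp [Lm, Sg, Sub, cA, cB, fS]
    constructor
    · rintro ⟨m, n, rfl⟩; exact ⟨m, 2 * n, by push_cast; field_simp, by simp⟩
    · rintro ⟨m, n, h, ⟨k, rfl⟩⟩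
      refine ⟨m, k, ?_⟩
      push_cast at h
      apply mul_left_cancel₀ h2
      rw [h]; field_simp
  · simp [Lm, Sg, Sub, cA, cB, fS]
    constructor
    · rintro ⟨m, n, rfl⟩; exact ⟨m, m + 2 * n, by push_cast; field_simp; ring, ⟨m + n, by ring⟩⟩
    · rintro ⟨m, n, h, ⟨k, hk⟩⟩
      obtain rfl : n = 2 * k - m := by linarith
      refine ⟨m, k - m, ?_⟩
      push_cast at h ⊢
      apply mul_left_cancel₀ h2
      rw [h]; field_simp; ring

lemma fS_ne [CharZero K] (i : Fin 4) : (fS i : K) ≠ 0 := by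
  fin_cases i <;> simp [fS]

lemma stb_Sg [CharZero K] (i : Fin 4) (ω θ : K) : Stb ω (Sg i θ) ↔ ∀ y, Sub i θ y → Sub i θ (ω * y) := by
  rw [stb_iff]
  have hf := fS_ne (K := K) i
  constructor
  · intro h y hy
    have := h (y / fS i) (by rwa [Lm_Sg, mul_div_cancel₀ _ hf])
    rw [Lm_Sg] at this
    convert this using 1; field_simp
  · intro h z hz
    rw [Lm_Sg] at hz ⊢
    convert h _ hz using 1; ring

lemma Sub.lm {i : Fin 4} {θ y : K} (h : Sub i θ y) : Lm θ y := by
  obtain ⟨m, n, h, -⟩ := h; exact ⟨m, n, h⟩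

lemma Sub_dich (i : Fin 4) {θ y g : K} (hy : Lm θ y) (hg : Lm θ g) (h1 : ¬ Sub i θ y) (h2 : ¬ Sub i θ g) :
    Sub i θ (y - g) := by
  obtain ⟨m, n, rfl⟩ := hy
  obtain ⟨m', n', rfl⟩ := hg
  have e1 : ¬ 2 ∣ cA i * m + cB i * n := fun h => h1 ⟨m, n, rfl, h⟩
  have e2 : ¬ 2 ∣ cA i * m' + cB i * n' := fun h => h2 ⟨m', n', rfl, h⟩
  refine ⟨m - m', n - n', by push_cast; ring, ?_⟩
  have : cA i * (m - m') + cB i * (n - n') = (cA i * m + cB i * n) - (cA i * m' + cB i * n') := by ring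
  rw [this]; omega

/-- saturation -/
lemma sat_iff [CharZero K] (i : Fin 4) {ω θ : K} (hs : Stb ω θ) (hn : ¬ Stb ω (Sg i θ)) (z : K) :
    Lm θ (fS i * z) ↔ ∃ z1 z2, Lm (Sg i θ) z1 ∧ Lm (Sg i θ) z2 ∧ z = z1 + ω * z2 := by
  have hf := fS_ne (K := K) i
  constructor
  · intro hz
    by_cases h1 : Sub i θ (fS i * z)
    · exact ⟨z, 0, by rwa [Lm_Sg], ⟨0, 0, by simp⟩, by simp⟩
    · rw [stb_Sg] at hn
      push Not at hn
      obtain ⟨g, hg, hg2⟩ := hn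
      have := Sub_dich i hz (Lm.stab hs.1 hs.2 hg.lm) h1 hg2
      refine ⟨z - ω * (g / fS i), g / fS i, ?_, ?_, by ring⟩
      · rw [Lm_Sg]; convert this using 1; field_simp
      · rwa [Lm_Sg, mul_div_cancel₀ _ hf]
  · rintro ⟨z1, z2, h1, h2, rfl⟩
    rw [Lm_Sg] at h1 h2
    have := h1.lm.add (Lm.stab hs.1 hs.2 h2.lm)
    convert this using 1; ring

/-- two nonstable sublattices that are homothetic -/
lemma sat_homo [CharZero K] {i j : Fin 4} {ω θ θ' : K} (hs : Stb ω θ) (hn : ¬ Stb ω (Sg i θ)) (hs' : Stb ω θ')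
    (hn' : ¬ Stb ω (Sg j θ')) {x : K} (hx : x ≠ 0) (h : ∀ z, Lm (Sg i θ) z ↔ Lm (Sg j θ') (x * z)) (z : K) :
    Lm θ z ↔ Lm θ' (fS j * x / fS i * z) := by
  have hf := fS_ne (K := K) i
  have e : (fS j * x / fS i * z : K) = fS j * (x * (z / fS i)) := by ring
  have e' : z = fS i * (z / fS i) := by field_simp
  rw [e, sat_iff j hs' hn']
  conv_lhs => rw [e']
  rw [sat_iff i hs hn]
  constructor
  · rintro ⟨z1, z2, h1, h2, h3⟩
    exact ⟨x * z1, x * z2, (h _).1 h1, (h _).1 h2, by rw [h3]; ring⟩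
  · rintro ⟨z1, z2, h1, h2, h3⟩
    refine ⟨x⁻¹ * z1, x⁻¹ * z2, (h _).2 (by rwa [mul_inv_cancel_left₀ hx]), (h _).2 (by rwa [mul_inv_cancel_left₀ hx]), ?_⟩
    apply mul_left_cancel₀ hx
    rw [h3]; field_simp

/-- sublattices between `2T` and `T` -/
lemma classify [CharZero K] {θ T Y : K} (hY : Y ≠ 0) (h1 : ∀ z, Lm θ z → Lm T (Y * z)) (h2 : ∀ z, Lm T z → Lm θ (2 * z / Y)) :
    ∃ i, Homo θ (Sg i T) := by
  -- L' z := Lm θ (z / Y)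
  have hadd : ∀ a b, Lm θ (a / Y) → Lm θ (b / Y) → Lm θ ((a + b) / Y) := by
    intro a b ha hb; rw [add_div]; exact ha.add hb
  have hsub : ∀ a b, Lm θ ((a + b) / Y) → Lm θ (b / Y) → Lm θ (a / Y) := by
    intro a b ha hb
    have := ha.add (hb.zsmul (-1))
    convert this using 1; push_cast; ring
  have h2' : ∀ m n : ℤ, 2 ∣ m → 2 ∣ n → Lm θ ((m * T + n) / Y) := by
    rintro _ _ ⟨m, rfl⟩ ⟨n, rfl⟩
    convert h2 (m * T + n) ⟨m, n, rfl⟩ using 1; push_cast; ring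
  have main : ∀ i, (∀ m n : ℤ, Lm θ ((m * T + n) / Y) ↔ 2 ∣ cA i * m + cB i * n) → Homo θ (Sg i T) := by
    intro i hi
    have hf := fS_ne (K := K) i
    refine ⟨Y / fS i, div_ne_zero hY hf, fun z => ?_⟩
    rw [Lm_Sg, show (fS i : K) * (Y / fS i * z) = Y * z by field_simp]
    constructor
    · intro hz
      obtain ⟨m, n, h⟩ := h1 z hz
      refine ⟨m, n, h, ?_⟩
      rw [← hi, ← h, mul_div_cancel_left₀ _ hY]; exact hz
    · rintro ⟨m, n, h, h3⟩
      rw [← hi, ← h, mul_div_cancel_left₀ _ hY] at h3; exact h3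
  -- reduce mod 2
  have red : ∀ m n m' n' : ℤ, 2 ∣ m - m' → 2 ∣ n - n' → Lm θ ((m * T + n) / Y) → Lm θ ((m' * T + n') / Y) := by
    intro m n m' n' hm hn h
    have := h2' (m - m') (n - n') hm hn
    refine hsub _ _ ?_ this
    convert h using 1; push_cast; ring
  have par : ∀ m : ℤ, 2 ∣ m - 0 ∨ 2 ∣ m - 1 := by intro m; omega
  by_cases hT : Lm θ (((1 : ℤ) * T + (0 : ℤ)) / Y)
  · by_cases h1' : Lm θ (((0 : ℤ) * T + (1 : ℤ)) / Y)
    · refine ⟨0, main 0 fun m n => ?_⟩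
      simp only [cA, cB]; simp
      have := (hT.zsmul m).add (h1'.zsmul n)
      convert this using 1; push_cast; ring
    · refine ⟨2, main 2 fun m n => ?_⟩
      simp only [cA, cB]; simp
      constructor
      · intro h
        rcases par n with hn | hn
        · simpa using hn
        · exfalso
          apply h1'
          have : Lm θ (((0 : ℤ) * T + (n : ℤ)) / Y) := by
            have := h.add (hT.zsmul (-m))
            convert this using 1; push_cast; ring
          exact red _ _ _ _ (by simp) hn this
      · intro hn
        have : Lm θ ((m * T + (0 : ℤ)) / Y) := by
          convert hT.zsmul m using 1; push_cast; ring
        exact red _ _ _ _ (by simp) (by omega) this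
  · by_cases h1' : Lm θ (((0 : ℤ) * T + (1 : ℤ)) / Y)
    · refine ⟨1, main 1 fun m n => ?_⟩
      simp only [cA, cB]; simp
      constructor
      · intro h
        rcases par m with hm | hm
        · simpa using hm
        · exfalso
          apply hT
          have : Lm θ ((m * T + (0 : ℤ)) / Y) := by
            have := h.add (h1'.zsmul (-n))
            convert this using 1; push_cast; ring
          exact red _ _ _ _ hm (by simp) this
      · intro hm
        have : Lm θ (((0 : ℤ) * T + n) / Y) := by
          convert h1'.zsmul n using 1; push_cast; ring
        exact red _ _ _ _ (by omega) (by simp) this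
    · by_cases h11 : Lm θ (((1 : ℤ) * T + (1 : ℤ)) / Y)
      · refine ⟨3, main 3 fun m n => ?_⟩
        simp only [cA, cB]; simp
        constructor
        · intro h
          rcases par m with hm | hm <;> rcases par n with hn | hn
          · omega
          · exact absurd (red _ _ _ _ hm hn h) h1'
          · exact absurd (red _ _ _ _ hm hn h) hT
          · omega
        · intro hmn
          rcases par m with hm | hm
          · exact h2' m n (by omega) (by omega)
          · exact red _ _ _ _ (by omega) (by omega) h11
      · refine ⟨0, Y / 2, div_ne_zero hY two_ne_zero, fun z => ?_⟩
        change _ ↔ Lm T _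
        constructor
        · intro hz
          obtain ⟨m, n, h⟩ := h1 z hz
          have hz' : Lm θ ((m * T + n) / Y) := by rw [← h, mul_div_cancel_left₀ _ hY]; exact hz
          rcases par m with hm | hm <;> rcases par n with hn | hn
          · rw [sub_zero] at hm hn
            obtain ⟨a, rfl⟩ := hm
            obtain ⟨b, rfl⟩ := hn
            refine ⟨a, b, ?_⟩
            have : (2 : K) ≠ 0 := two_ne_zero
            apply mul_left_cancel₀ this
            push_cast at h
            linear_combination h
          · exact absurd (red _ _ _ _ hm hn hz') h1'
          · exact absurd (red _ _ _ _ hm hn hz') hT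
          · exact absurd (red _ _ _ _ hm hn hz') h11
        · intro hz
          have := h2 _ hz
          convert this using 1; field_simp

end
end H7

namespace H7
open UpperHalfPlane hiding I
open Complex ModularForm
open scoped Manifold MatrixGroups ModularForm Topology
open NumberField nonZeroDivisors

section
variable {K : Type*} [Field K] [NumberField K] (hdeg : Module.finrank ℚ K = 2) {l : ℕ} (hl : l.Prime) (h5 : 5 ≤ l)
  (α : K) (hα : α ^ 2 = -(l : K)) (σ : K →+* ℂ)

lemma dvd4 {a : ℤ} : (a : ZMod 4) = 0 ↔ (4 : ℤ) ∣ a := by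
  have := ZMod.intCast_zmod_eq_zero_iff_dvd a 4
  exact_mod_cast this

set_option synthInstance.maxHeartbeats 400000 in
set_option maxRecDepth 4000 in
set_option synthInstance.maxSize 1000 in
lemma par_dec : ∀ p q u v : ZMod 4, p + v = 2 → p * v - q * u = 0 →
    (2 * p = 0 ∧ 2 * v = 0 ∧ 2 * q = 0 ∧ 2 * u = 0) ∨ (2 * p = 0 ∧ 2 * v = 0 ∧ q = 0) ∨ (2 * p = 0 ∧ 2 * v = 0 ∧ u = 0) ∨
    (2 * (p + u) = 0 ∧ q + v - p - u = 0 ∧ 2 * (v - u) = 0) := by decide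

include hl hα in
/-- matrix of `2ω` : trace and determinant -/
lemma mat_tr {θ : K} {p q u v k e : ℤ} (hk : k ≠ 0) {w : K} (hw : 2 * w = k * (1 + α)) (h1 : w * θ = p * θ + q) (h2 : w = u * θ + v)
    (he : 4 * e = k ^ 2 * (1 + l)) : p + v = k ∧ p * v - q * u = e := by
  have hcl : w ^ 2 - (p + v) * w + (p * v - q * u) = 0 := by
    have e1 : (w - p) * θ = q := by rw [sub_mul, h1]; ring
    have e2 : u * θ = w - v := by linear_combination -h2
    rw [← e1]
    linear_combination (w - p) * -e2
  have key : ((k ^ 2 * (1 - l) - 2 * (p + v) * k + 4 * (p * v - q * u) : ℤ) : ℚ) = 0 ∧ ((2 * k ^ 2 - 2 * (p + v) * k : ℤ) : ℚ) = 0 := by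
    refine al_indep hl α hα (p' := 0) (q' := 0) ?_
    push_cast
    linear_combination 4 * hcl + (-2 * w - k * (1 + α) + 2 * (p + v)) * hw - (k : K) ^ 2 * hα
  have k1 : k ^ 2 * (1 - l) - 2 * (p + v) * k + 4 * (p * v - q * u) = 0 := by exact_mod_cast key.1
  have k2 : 2 * k ^ 2 - 2 * (p + v) * k = 0 := by exact_mod_cast key.2
  have k3 : p + v = k := by
    have : 2 * k * (k - (p + v)) = 0 := by linarith
    rcases mul_eq_zero.1 this with h | h
    · omega
    · linarith
  refine ⟨k3, ?_⟩
  rw [k3] at k1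
  nlinarith

include hl hα in
lemma sat_ex (h3 : l % 4 = 3) {θ ω : K} (hω : 2 * ω = 1 + α) (hs : Stb α θ) :
    ∃ θ' y : K, y ≠ 0 ∧ Stb ω θ' ∧ (∀ z, Lm θ z → Lm θ' (y * z)) ∧ (∀ z, Lm θ' z → Lm θ (2 * z / y)) := by
  obtain ⟨⟨a, q, h1⟩, ⟨u, d, h2⟩⟩ := hs
  obtain ⟨p, rfl⟩ : ∃ p, p - 1 = a := ⟨a + 1, by ring⟩
  obtain ⟨v, rfl⟩ : ∃ v, v - 1 = d := ⟨d + 1, by ring⟩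
  push_cast at h1 h2
  have g1 : 2 * ω * θ = p * θ + q := by rw [hω]; linear_combination h1
  have g2 : 2 * ω = u * θ + v := by rw [hω]; linear_combination h2
  obtain ⟨t1, t2⟩ := mat_tr hl α hα (k := 2) (e := 1 + l) two_ne_zero (w := 2 * ω) (by rw [hω]; push_cast; ring) g1 g2 (by ring)
  have t3 := par_dec p q u v (by exact_mod_cast congrArg (Int.cast : ℤ → ZMod 4) t1) (by
    have : (4 : ℤ) ∣ p * v - q * u := by rw [t2]; omega
    have := dvd4.2 this
    exact_mod_cast this)
  have c2 : (2 : K) ≠ 0 := two_ne_zero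
  have c4 : (4 : K) ≠ 0 := by norm_num
  norm_cast at t3
  simp only [dvd4] at t3
  rcases t3 with ⟨i1, i2, i3, i4⟩ | ⟨i1, i2, i3⟩ | ⟨i1, i2, i3⟩ | ⟨i1, i2, i3⟩
  · obtain ⟨p, rfl⟩ : 2 ∣ p := by omega
    obtain ⟨q, rfl⟩ : 2 ∣ q := by omega
    obtain ⟨u, rfl⟩ : 2 ∣ u := by omega
    obtain ⟨v, rfl⟩ : 2 ∣ v := by omega
    push_cast at g1 g2
    refine ⟨θ, 1, one_ne_zero, ⟨⟨p, q, ?_⟩, ⟨u, v, ?_⟩⟩, fun z hz => by rwa [one_mul], fun z hz => by simpa using hz.zsmul 2⟩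
    · apply mul_left_cancel₀ c2; linear_combination g1
    · apply mul_left_cancel₀ c2; linear_combination g2
  · obtain ⟨p, rfl⟩ : 2 ∣ p := by omega
    obtain ⟨q, rfl⟩ : 4 ∣ q := by omega
    obtain ⟨v, rfl⟩ : 2 ∣ v := by omega
    push_cast at g1 g2
    refine ⟨θ / 2, 1, one_ne_zero, ⟨⟨p, q, ?_⟩, ⟨u, v, ?_⟩⟩, ?_, ?_⟩
    · apply mul_left_cancel₀ c4; linear_combination g1
    · apply mul_left_cancel₀ c2; linear_combination g2
    · rintro z ⟨m, n, rfl⟩; exact ⟨2 * m, n, by push_cast; ring⟩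
    · rintro z ⟨m, n, rfl⟩; exact ⟨m, 2 * n, by push_cast; ring⟩
  · obtain ⟨p, rfl⟩ : 2 ∣ p := by omega
    obtain ⟨u, rfl⟩ : 4 ∣ u := by omega
    obtain ⟨v, rfl⟩ : 2 ∣ v := by omega
    push_cast at g1 g2
    refine ⟨2 * θ, 2, two_ne_zero, ⟨⟨p, q, ?_⟩, ⟨u, v, ?_⟩⟩, ?_, ?_⟩
    · linear_combination g1
    · apply mul_left_cancel₀ c2; linear_combination g2
    · rintro z ⟨m, n, rfl⟩; exact ⟨m, 2 * n, by push_cast; ring⟩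
    · rintro z ⟨m, n, rfl⟩; exact ⟨2 * m, n, by push_cast; ring⟩
  · obtain ⟨a, ha⟩ : 2 ∣ p + u := by omega
    obtain ⟨b, hb⟩ : 4 ∣ q + v - p - u := by omega
    obtain ⟨c, hc⟩ : 2 ∣ v - u := by omega
    have ha' : (p : K) + u = 2 * a := by exact_mod_cast congrArg (Int.cast : ℤ → K) ha
    have hb' : (q : K) + v - p - u = 4 * b := by exact_mod_cast congrArg (Int.cast : ℤ → K) hb
    have hc' : (v : K) - u = 2 * c := by exact_mod_cast congrArg (Int.cast : ℤ → K) hc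
    refine ⟨(θ + 1) / 2, 1, one_ne_zero, ⟨⟨a, b, ?_⟩, ⟨u, c, ?_⟩⟩, ?_, ?_⟩
    · apply mul_left_cancel₀ c4; linear_combination g1 + g2 + (θ + 1) * ha' + hb'
    · apply mul_left_cancel₀ c2; linear_combination g2 + hc'
    · rintro z ⟨m, n, rfl⟩; exact ⟨2 * m, n - m, by push_cast; ring⟩
    · rintro z ⟨m, n, rfl⟩; exact ⟨m, m + 2 * n, by push_cast; ring⟩

lemma int_of_stb {θ x : K} (h : ∀ z, Lm θ z → Lm θ (x * z)) : IsIntegral ℤ x := by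
  obtain ⟨a, b, h1⟩ := h _ (Lm.self θ)
  obtain ⟨c, d, h2⟩ := h _ (Lm.one θ)
  rw [mul_one] at h2
  refine ⟨X ^ 2 + (C (-(a + d)) * X + C (a * d - b * c)), ?_, ?_⟩
  · apply monic_X_pow_add; compute_degree!
  · simp only [eval₂_add, eval₂_pow, eval₂_X, eval₂_mul, eval₂_C]
    rw [algebraMap_int_eq, eq_intCast, eq_intCast]
    push_cast
    have e1 : (x - a) * θ = b := by rw [sub_mul, h1]; ring
    have e2 : c * θ = x - d := by linear_combination -h2
    rw [← e1]
    linear_combination (x - a) * -e2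

include hdeg hl hα h5 in
lemma unit_pm {θ x : K} (hx : x ≠ 0) (h : ∀ z, Lm θ z ↔ Lm θ (x * z)) : x = 1 ∨ x = -1 := by
  obtain ⟨a, b, e1, d1⟩ := quad_int hdeg hl α hα (int_of_stb fun z hz => (h z).1 hz)
  obtain ⟨a', b', e2, d2⟩ := quad_int hdeg hl α hα (x := x⁻¹) (int_of_stb (θ := θ) fun z hz => (h _).2 (by rwa [mul_inv_cancel_left₀ hx]))
  have hprod : ((a : K) + b * α) * (a' + b' * α) = 4 := by
    rw [← e1, ← e2]; field_simp; norm_num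
  have key : ((a * a' - l * b * b' : ℤ) : ℚ) = 4 ∧ ((a * b' + a' * b : ℤ) : ℚ) = 0 := by
    refine al_indep hl α hα ?_
    push_cast
    linear_combination hprod - b * b' * hα
  have k1 : a * a' - l * b * b' = 4 := by exact_mod_cast key.1
  have k2 : a * b' + a' * b = 0 := by exact_mod_cast key.2
  obtain ⟨N, hN⟩ := d1
  obtain ⟨N', hN'⟩ := d2
  have hNN : N * N' = 1 := by
    have : (a ^ 2 + l * b ^ 2) * (a' ^ 2 + l * b' ^ 2) = (a * a' - l * b * b') ^ 2 + l * (a * b' + a' * b) ^ 2 := by ring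
    rw [hN, hN', k1, k2] at this
    linarith
  have hN0 : 0 ≤ N := by nlinarith [sq_nonneg a, sq_nonneg b, mul_nonneg (Int.natCast_nonneg l) (sq_nonneg b)]
  have hN1 : N = 1 := by
    rcases Int.isUnit_iff.1 (IsUnit.of_mul_eq_one _ hNN) with h | h
    · exact h
    · omega
  rw [hN1] at hN
  have hl5 : (5 : ℤ) ≤ l := by exact_mod_cast h5
  have hb : b = 0 := by
    by_contra hb
    have : 1 ≤ b ^ 2 := by have := sq_pos_of_ne_zero hb; omega
    nlinarith [sq_nonneg a]
  rw [hb] at hN e1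
  have ha : (a - 2) * (a + 2) = 0 := by linarith
  have c2 : (2 : K) ≠ 0 := two_ne_zero
  rcases mul_eq_zero.1 ha with h | h
  · left; apply mul_left_cancel₀ c2; rw [e1, show a = 2 by omega]; simp
  · right; apply mul_left_cancel₀ c2; rw [e1, show a = -2 by omega]; simp

lemma Sub_iff {θ : K} (hθ : 0 < (σ θ).im) (i : Fin 4) (m n : ℤ) : Sub i θ (m * θ + n) ↔ 2 ∣ cA i * m + cB i * n := by
  constructor
  · rintro ⟨m', n', h, h2⟩
    obtain ⟨rfl, rfl⟩ := Lm_indep σ hθ h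
    exact h2
  · intro h; exact ⟨m, n, rfl, h⟩

lemma par2 : ∀ p q u v e : ZMod 2, p + v = 1 → p * v - q * u = e →
   (e = 1 → u = 1 ∧ q = 1 ∧ p + q + (u + v) = 1) ∧ (e = 0 → (u = 1 ∧ q = 0 ∧ p + q + (u + v) = 0) ∨ (u = 0 ∧ q = 1 ∧ p + q + (u + v) = 0) ∨ (u = 0 ∧ q = 0 ∧ p + q + (u + v) = 1)) := by decide

lemma dvd2 {a : ℤ} : (a : ZMod 2) = 0 ↔ (2 : ℤ) ∣ a := by
  have := ZMod.intCast_zmod_eq_zero_iff_dvd a 2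
  exact_mod_cast this
lemma dvd2' {a : ℤ} : (a : ZMod 2) = 1 ↔ ¬ (2 : ℤ) ∣ a := by
  rw [← dvd2]
  generalize (a : ZMod 2) = b
  revert b; decide

include hl hα in
open Classical in
lemma count_i {θ ω : K} (hω : 2 * ω = 1 + α) (hθ : 0 < (σ θ).im) (hs : Stb ω θ) {e : ℕ} (he : 4 * e = 1 + l) :
    (Finset.univ.filter fun i : Fin 4 => i = 0 ∨ ¬ Stb ω (Sg i θ)).card = if e % 2 = 1 then 4 else 2 := by
  obtain ⟨⟨p, q, h1⟩, ⟨u, v, h2⟩⟩ := hs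
  obtain ⟨t1, t2⟩ := mat_tr hl α hα (k := 1) (e := e) one_ne_zero (w := ω) (by rw [hω]; simp) h1 h2 (by push_cast; linarith)
  have hst : ∀ i, Stb ω (Sg i θ) ↔ ∀ m n : ℤ, 2 ∣ cA i * m + cB i * n → 2 ∣ cA i * (m * p + n * u) + cB i * (m * q + n * v) := by
    intro i
    rw [stb_Sg]
    have e : ∀ m n : ℤ, ω * (m * θ + n) = ((m * p + n * u : ℤ) : K) * θ + ((m * q + n * v : ℤ) : K) := by
      intro m n; push_cast; linear_combination (m : K) * h1 + n * h2
    constructor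
    · intro h m n hmn
      have := h _ ((Sub_iff σ hθ i m n).2 hmn)
      rwa [e, Sub_iff σ hθ] at this
    · rintro h y ⟨m, n, rfl, hmn⟩
      rw [e, Sub_iff σ hθ]
      exact h m n hmn
  have s1 : Stb ω (Sg 1 θ) ↔ 2 ∣ u := by
    rw [hst]; simp [cA, cB]
    constructor
    · intro h; have := h 0 1 (by simp); simpa using this
    · intro h m n hm; exact dvd_add (hm.mul_right _) (h.mul_left _)
  have s2 : Stb ω (Sg 2 θ) ↔ 2 ∣ q := by
    rw [hst]; simp [cA, cB]
    constructor
    · intro h; have := h 1 0 (by simp); simpa using this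
    · intro h m n hm; exact dvd_add (h.mul_left _) (hm.mul_right _)
  have s3 : Stb ω (Sg 3 θ) ↔ 2 ∣ p + q + (u + v) := by
    rw [hst]; simp [cA, cB]
    constructor
    · intro h; have := h 1 1 (by simp); 
      convert this using 1; ring
    · intro h m n hm
      have : m * p + n * u + (m * q + n * v) = m * (p + q + (u + v)) + (m + n) * (u + v) - 2 * (m * (u + v)) := by ring
      rw [this]
      exact dvd_sub (dvd_add (h.mul_left _) (hm.mul_right _)) (Dvd.intro _ rfl)
  have hp := par2 p q u v (e : ℤ) (by exact_mod_cast congrArg (Int.cast : ℤ → ZMod 2) t1) (by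
    exact_mod_cast congrArg (Int.cast : ℤ → ZMod 2) t2)
  norm_cast at hp
  simp only [dvd2, dvd2'] at hp
  have huniv : (Finset.univ : Finset (Fin 4)) = {0, 1, 2, 3} := rfl
  rw [huniv]
  simp only [Finset.filter_insert, Finset.filter_singleton, s1, s2, s3]
  by_cases he2 : e % 2 = 1
  · obtain ⟨a, b, c⟩ := hp.1 (by have := (dvd2' (a := (e:ℤ))).2 (by omega); exact_mod_cast this)
    simp [he2, a, b, c]
  · rw [if_neg he2]
    rcases hp.2 (by have := (dvd2 (a := (e:ℤ))).2 (by omega); exact_mod_cast this) with ⟨a, b, c⟩ | ⟨a, b, c⟩ | ⟨a, b, c⟩ <;> simp [a, b, c]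

end
end H7

namespace H7
open UpperHalfPlane hiding I
open Complex ModularForm
open scoped Manifold MatrixGroups ModularForm Topology
open NumberField nonZeroDivisors

section
variable {K : Type*} [Field K] [NumberField K] (hdeg : Module.finrank ℚ K = 2) {l : ℕ} (hl : l.Prime) (h5 : 5 ≤ l)
  (α : K) (hα : α ^ 2 = -(l : K)) (σ : K →+* ℂ)

include hl hα in
lemma Hset_of_fam {ι : Type*} [Fintype ι] (t : ι → K) (h1 : ∀ c, 0 < (σ (t c)).im) (h2 : ∀ c, Stb α (t c))
    (h3 : ∀ c d, Homo (t c) (t d) → c = d) (h4 : ∀ θ, Stb α θ → ∃ c, Homo θ (t c)) : (Hset l).ncard = Fintype.card ι := by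
  have : Hset l = Set.range (fun c => kj ⟨σ (t c), h1 c⟩) := by
    ext z
    rw [mem_Hset hl α hα σ]
    constructor
    · rintro ⟨θ, hθ, a, b, rfl⟩
      obtain ⟨c, hc⟩ := h4 θ ⟨a, b⟩
      exact ⟨c, (kj_of_homo σ hθ (h1 c) hc).symm⟩
    · rintro ⟨c, rfl⟩
      exact ⟨t c, h1 c, (h2 c).1, (h2 c).2, rfl⟩
  rw [this, ← Set.image_univ, Set.ncard_image_of_injective, Set.ncard_univ, Nat.card_eq_fintype_card]
  intro c d h
  exact h3 c d (homo_of_kj σ (h1 c) (h1 d) h)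

include hdeg hl hα in
lemma Hset_card1 (h1 : l % 4 = 1) : (Hset l).ncard = classNumber K := by
  obtain ⟨σ⟩ : Nonempty (K →+* ℂ) := inferInstance
  have hintg : IsIntegral ℤ α := by
    refine IsIntegral.of_pow (n := 2) (by norm_num) ?_
    rw [hα]
    have h := (isIntegral_algebraMap (R := ℤ) (x := (l : ℤ)) (A := K)).neg
    simpa using h
  have hspan : ∀ x : K, IsIntegral ℤ x → ∃ m n : ℤ, x = m + n * α := by
    intro x hx
    obtain ⟨a, b, e, d⟩ := quad_int hdeg hl α hα hx
    have hab : 2 ∣ a ∧ 2 ∣ b := by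
      have hd := dvd4.2 d
      have hl4 : (l : ZMod 4) = 1 := by
        have : ((l % 4 : ℕ) : ZMod 4) = l := ZMod.natCast_mod l 4
        rw [← this, h1]; simp
      push_cast at hd
      rw [hl4] at hd
      have key : ∀ a b : ZMod 4, a ^ 2 + 1 * b ^ 2 = 0 → 2 * a = 0 ∧ 2 * b = 0 := by decide
      obtain ⟨ka, kb⟩ := key _ _ hd
      have := (dvd4 (a := 2 * a)).1 (by push_cast; exact ka)
      have := (dvd4 (a := 2 * b)).1 (by push_cast; exact kb)
      omega
    obtain ⟨⟨m, rfl⟩, ⟨n, rfl⟩⟩ := hab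
    refine ⟨m, n, ?_⟩
    apply mul_left_cancel₀ (two_ne_zero (α := K))
    rw [e]; push_cast; ring
  obtain ⟨t, t1, t2, t3, t4⟩ := cg_fam hdeg hl α hα σ α hintg hspan
  exact Hset_of_fam hl α hα σ t t1 t2 t3 t4

lemma Sg_im {θ : K} (h : 0 < (σ θ).im) (i : Fin 4) : 0 < (σ (Sg i θ)).im := by
  fin_cases i
  · simpa [Sg] using h
  · simpa [Sg, map_ofNat] using h
  · simp only [Sg]; simpa [map_ofNat] using h
  · simp only [Sg]; simpa [map_ofNat] using h

lemma Sg_alpha {θ ω : K} (hω : 2 * ω = 1 + α) (h : Stb ω θ) (i : Fin 4) : Stb α (Sg i θ) := by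
  rw [stb_Sg]
  rintro _ ⟨m, n, rfl, hd⟩
  obtain ⟨a, b, hab⟩ := Lm.stab h.1 h.2 ⟨m, n, rfl⟩
  refine ⟨2 * a - m, 2 * b - n, ?_, ?_⟩
  · push_cast
    linear_combination 2 * hab - ((m : K) * θ + n) * hω
  · have : cA i * (2 * a - m) + cB i * (2 * b - n) = 2 * (cA i * a + cB i * b) - (cA i * m + cB i * n) := by ring
    rw [this]; exact dvd_sub (Dvd.intro _ rfl) hd

lemma cAB : ∀ i j : Fin 4, i ≠ 0 → j ≠ 0 → (2 ∣ cA i * 1 + cB i * 0 ↔ 2 ∣ cA j * 1 + cB j * 0) →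
    (2 ∣ cA i * 0 + cB i * 1 ↔ 2 ∣ cA j * 0 + cB j * 1) → i = j := by decide

lemma Sg_zero (θ : K) : Sg 0 θ = θ := rfl

include hdeg hl hα h5 in
open Classical in
lemma Hset_card3 (h3 : l % 4 = 3) : (Hset l).ncard = (if l % 8 = 3 then 4 else 2) * classNumber K := by
  obtain ⟨σ⟩ : Nonempty (K →+* ℂ) := inferInstance
  obtain ⟨e, he⟩ : ∃ e, 4 * e = 1 + l := ⟨(1 + l) / 4, by omega⟩
  obtain ⟨ω, hω⟩ : ∃ ω : K, 2 * ω = 1 + α := ⟨(1 + α) / 2, by ring⟩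
  have heK : 4 * (e : K) = 1 + l := by exact_mod_cast congrArg (Nat.cast : ℕ → K) he
  have hintg : IsIntegral ℤ ω := by
    refine ⟨X ^ 2 + (C (-1) * X + C (e : ℤ)), ?_, ?_⟩
    · monicity!
    · simp only [eval₂_add, eval₂_mul, eval₂_pow, eval₂_X, eval₂_C]
      simp
      apply mul_left_cancel₀ (show (4 : K) ≠ 0 by norm_num)
      linear_combination heK + hα + (2 * ω + α - 1) * hω
  have hspan : ∀ x : K, IsIntegral ℤ x → ∃ m n : ℤ, x = m + n * ω := by
    intro x hx
    obtain ⟨a, b, e, d⟩ := quad_int hdeg hl α hα hx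
    have hab : 2 ∣ a - b := by
      have hd := dvd4.2 d
      have hl4 : (l : ZMod 4) = 3 := by
        have : ((l % 4 : ℕ) : ZMod 4) = l := ZMod.natCast_mod l 4
        rw [← this, h3]; simp
      push_cast at hd
      rw [hl4] at hd
      have key : ∀ a b : ZMod 4, a ^ 2 + 3 * b ^ 2 = 0 → 2 * (a - b) = 0 := by decide
      have := (dvd4 (a := 2 * (a - b))).1 (by push_cast; exact key _ _ hd)
      omega
    obtain ⟨m, hm⟩ := hab
    have hm' : a = b + 2 * m := by linarith
    subst hm'
    refine ⟨m, b, ?_⟩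
    apply mul_left_cancel₀ (two_ne_zero (α := K))
    rw [e]; push_cast; linear_combination -(b : K) * hω
  obtain ⟨t, t1, t2, t3, t4⟩ := cg_fam hdeg hl α hα σ ω hintg hspan
  let ι := Σ c : ClassGroup (𝓞 K), {i : Fin 4 // i = 0 ∨ ¬ Stb ω (Sg i (t c))}
  have hcard : Fintype.card ι = (if l % 8 = 3 then 4 else 2) * classNumber K := by
    rw [Fintype.card_sigma]
    have : ∀ c : ClassGroup (𝓞 K), Fintype.card {i : Fin 4 // i = 0 ∨ ¬ Stb ω (Sg i (t c))} = if l % 8 = 3 then 4 else 2 := by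
      intro c
      rw [Fintype.card_subtype, count_i hl α hα σ hω (t1 c) (t2 c) he]
      have : e % 2 = 1 ↔ l % 8 = 3 := by omega
      simp only [this]
    rw [Finset.sum_congr rfl fun c _ => this c, Finset.sum_const, smul_eq_mul, mul_comm, Finset.card_univ]
    rfl
  rw [← hcard]
  refine Hset_of_fam hl α hα σ (fun p : ι => Sg p.2.1 (t p.1)) (fun p => Sg_im σ (t1 _) _) (fun p => Sg_alpha α hω (t2 _) _) ?_ ?_
  · rintro ⟨c, i, hi⟩ ⟨d, j, hj⟩ h
    dsimp only at h
    by_cases hi0 : i = 0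
    · subst hi0
      have hj0 : j = 0 := by
        rcases hj with hj | hj
        · exact hj
        · exact (hj (h.symm.stb (t2 c))).elim
      subst hj0
      obtain rfl := t3 c d h
      rfl
    · have hi' := hi.resolve_left hi0
      have hj0 : j ≠ 0 := by
        rintro rfl
        exact hi' (h.stb (t2 d))
      have hj' := hj.resolve_left hj0
      obtain ⟨x, hx, hh⟩ := h
      have hs := sat_homo (t2 c) hi' (t2 d) hj' hx hh
      have hf := fS_ne (K := K) i
      have hy : (fS j * x / fS i : K) ≠ 0 := div_ne_zero (mul_ne_zero (fS_ne j) hx) hf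
      obtain rfl := t3 c d ⟨_, hy, hs⟩
      have hpm := unit_pm hdeg hl h5 α hα hy hs
      have hsub : ∀ y, Sub i (t c) y ↔ Sub j (t c) (fS j * x / fS i * y) := by
        intro y
        have := hh (y / fS i)
        rw [Lm_Sg, Lm_Sg] at this
        convert this using 2
        · field_simp
        · field_simp
      have hsub2 : ∀ m n : ℤ, 2 ∣ cA i * m + cB i * n ↔ 2 ∣ cA j * m + cB j * n := by
        intro m n
        rw [← Sub_iff σ (t1 c), hsub]
        rcases hpm with h | h
        · rw [h, one_mul, Sub_iff σ (t1 c)]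
        · rw [h, show (-1 : K) * (m * t c + n) = ((-m : ℤ) : K) * t c + ((-n : ℤ) : K) by push_cast; ring, Sub_iff σ (t1 c)]
          rw [show cA j * -m + cB j * -n = -(cA j * m + cB j * n) by ring, dvd_neg]
      have hij : i = j := by
        exact cAB i j hi0 hj0 (hsub2 1 0) (hsub2 0 1)
      subst hij
      rfl
  · intro θ hθ
    by_cases hst : Stb ω θ
    · obtain ⟨c, hc⟩ := t4 θ hst
      exact ⟨⟨c, 0, Or.inl rfl⟩, hc⟩
    · obtain ⟨θ', y, hy, hs, b1, b2⟩ := sat_ex hl α hα h3 hω hθ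
      obtain ⟨c, x, hx, hc⟩ := t4 θ' hs
      obtain ⟨i, hi⟩ := classify (θ := θ) (T := t c) (Y := x * y) (mul_ne_zero hx hy) (fun z hz => by
        rw [mul_assoc]; exact (hc _).1 (b1 z hz)) (fun z hz => by
        have := b2 (x⁻¹ * z) ((hc _).2 (by rwa [mul_inv_cancel_left₀ hx]))
        convert this using 1
        field_simp)
      exact ⟨⟨c, i, Or.inr fun h => hst (hi.stb h)⟩, hi⟩

include hdeg hα h5 in
lemma Hset_card [Fact l.Prime] : ((Hset l).ncard : ℤ) =
    if l % 4 = 1 then (classNumber K : ℤ) else (3 - legendreSym l 2) * (classNumber K : ℤ) := by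
  have hl : l.Prime := Fact.out
  have hodd : l % 2 = 1 := hl.eq_two_or_odd.resolve_left (by omega)
  split_ifs with h
  · rw [Hset_card1 hdeg hl α hα h]
  · have h3 : l % 4 = 3 := by omega
    rw [Hset_card3 hdeg hl h5 α hα h3, legendreSym.at_two (by omega), ZMod.χ₈_nat_eq_if_mod_eight]
    rcases (by omega : l % 8 = 3 ∨ l % 8 = 7) with h8 | h8 <;> simp [h8, hodd]

end
end H7

namespace H7

section
variable {l : ℕ} [Fact l.Prime]

noncomputable def fc (Q R : ZMod l) : (ZMod l)[X] := X ^ 3 + (C (-3 * Q) * X + C (2 * R))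

noncomputable def Vc (Q R : ZMod l) : ZMod l := ((fc Q R) ^ ((l - 1) / 2)).coeff (l - 1)

lemma fc_eval (Q R x : ZMod l) : (fc Q R).eval x = x ^ 3 - 3 * Q * x + 2 * R := by
  simp [fc]; ring

lemma fc_deg (Q R : ZMod l) : (fc Q R).natDegree = 3 := by
  unfold fc; compute_degree!

lemma fc_monic (Q R : ZMod l) : (fc Q R).Monic := by
  unfold fc; monicity!

lemma sum_pow_mid {i : ℕ} (h5 : 5 ≤ l) (hi : i < 2 * (l - 1)) : ∑ x : ZMod l, x ^ i = if i = l - 1 then -1 else 0 := by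
  have hc : Fintype.card (ZMod l) = l := ZMod.card l
  rcases lt_trichotomy i (l - 1) with h | h | h
  · rw [if_neg (by omega), FiniteField.sum_pow_lt_card_sub_one _ i (by rwa [hc])]
  · rw [if_pos h]
    have : ∀ x : ZMod l, x ^ i = if x = 0 then 0 else 1 := by
      intro x
      split_ifs with hx
      · rw [hx, zero_pow (by omega)]
      · rw [h, ZMod.pow_card_sub_one_eq_one hx]
    simp only [this]
    rw [Finset.sum_ite]
    simp [Finset.filter_ne', Finset.card_erase_of_mem]
    rw [Nat.cast_sub (by omega)]; simp
  · rw [if_neg (by omega)]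
    have : ∀ x : ZMod l, x ^ i = x ^ (i - (l - 1)) := by
      intro x
      by_cases hx : x = 0
      · rw [hx, zero_pow (by omega), zero_pow (by omega)]
      · conv_lhs => rw [show i = (l - 1) + (i - (l - 1)) by omega, pow_add, ZMod.pow_card_sub_one_eq_one hx, one_mul]
    simp only [this]
    rw [FiniteField.sum_pow_lt_card_sub_one _ _ (by rw [hc]; omega)]

lemma sum_eval {p : (ZMod l)[X]} (h5 : 5 ≤ l) (hp : p.natDegree < 2 * (l - 1)) : ∑ x : ZMod l, p.eval x = - p.coeff (l - 1) := by
  simp only [eval_eq_sum_range' hp]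
  rw [Finset.sum_comm]
  simp only [← Finset.mul_sum]
  rw [Finset.sum_congr rfl fun i hi => by rw [sum_pow_mid h5 (Finset.mem_range.1 hi)]]
  simp only [mul_ite, mul_zero, mul_neg, mul_one]
  rw [Finset.sum_ite_eq' , if_pos (Finset.mem_range.2 (by omega))]

noncomputable def Sc (Q R : ZMod l) : ℤ := ∑ x : ZMod l, quadraticChar (ZMod l) (x ^ 3 - 3 * Q * x + 2 * R)

lemma Sc_cast (h5 : 5 ≤ l) (Q R : ZMod l) : (Sc Q R : ZMod l) = - Vc Q R := by
  have hl : l.Prime := Fact.out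
  have hodd : l % 2 = 1 := hl.eq_two_or_odd.resolve_left (by omega)
  rw [Vc, ← sum_eval h5, Sc]
  · push_cast
    refine Finset.sum_congr rfl fun x _ => ?_
    rw [eval_pow, fc_eval, quadraticChar_eq_pow_of_char_ne_two' (by rw [ZMod.ringChar_zmod_n]; omega), ZMod.card]
    congr 1; omega
  · rw [natDegree_pow, fc_deg]; omega

lemma Sc_ne (h5 : 5 ≤ l) (Q R : ZMod l) (ε : ZMod l) (hε : ε ≠ 0)
    (h : ∀ x, ((fc Q R).eval x) ^ ((l - 1) / 2) = ε) : False := by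
  have hl : l.Prime := Fact.out
  have hodd : l % 2 = 1 := hl.eq_two_or_odd.resolve_left (by omega)
  set m := (l - 1) / 2 with hm
  set f := fc Q R with hf
  have hdf : f.natDegree = 3 := fc_deg Q R
  have hmz : (m : ZMod l) ≠ 0 := by
    intro h
    rw [ZMod.natCast_eq_zero_iff] at h
    have := Nat.le_of_dvd (by omega) h
    omega
  have hdvd : (X ^ l - X : (ZMod l)[X]) ∣ f ^ m - C ε := by
    have h2 : (X ^ l - X : (ZMod l)[X]) = ∏ a : ZMod l, (X - C a) := by
      have h1 := FiniteField.roots_X_pow_card_sub_X (ZMod l)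
      rw [ZMod.card] at h1
      have hdeg := FiniteField.X_pow_card_sub_X_natDegree_eq (ZMod l) (p := l) (Nat.Prime.one_lt hl)
      have hmon : (X ^ l - X : (ZMod l)[X]).Monic := monic_X_pow_sub (by rw [degree_X]; exact_mod_cast hl.one_lt)
      have := prod_multiset_X_sub_C_of_monic_of_roots_card_eq hmon (by rw [h1, hdeg]; simp)
      rw [h1] at this
      exact this.symm
    rw [h2]
    refine Finset.prod_dvd_of_coprime ?_ ?_
    · intro a _ b _ hab
      exact isCoprime_X_sub_C_of_isUnit_sub (sub_ne_zero.2 hab).isUnit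
    · intro a _
      rw [dvd_iff_isRoot]; simp [h a]
  obtain ⟨g, hg⟩ := hdvd
  have hder := congrArg derivative hg
  have hlz : ((l : ℕ) : (ZMod l)[X]) = 0 := by
    have : ((l : ℕ) : (ZMod l)[X]) = C (l : ZMod l) := by simp
    rw [this]; simp
  simp only [derivative_sub, derivative_mul, derivative_C, derivative_X_pow, derivative_X, derivative_pow] at hder
  have hd2 : (X ^ l - X : (ZMod l)[X]) ∣ C ((m : ZMod l) * ε) * derivative f + f * g := by
    refine ⟨f * derivative g - C (m : ZMod l) * g * derivative f, ?_⟩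
    have e1 : f ^ m = f * f ^ (m - 1) := by
      rw [← pow_succ']; congr 1; omega
    have e2 : C (l : ZMod l) = 0 := by simp
    rw [e2] at hder
    rw [e1] at hg
    simp only [C_mul]
    linear_combination f * hder - C (m : ZMod l) * derivative f * hg
  have hg0 : g ≠ 0 := by
    rintro rfl
    rw [mul_zero, sub_eq_zero] at hg
    have := congrArg natDegree hg
    rw [natDegree_pow, hdf, natDegree_C] at this
    omega
  have hdX : (X ^ l - X : (ZMod l)[X]).natDegree = l := FiniteField.X_pow_card_sub_X_natDegree_eq (ZMod l) (p := l) (Nat.Prime.one_lt hl)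
  have hgd : g.natDegree + l = 3 * m := by
    have := congrArg natDegree hg
    rw [natDegree_sub_C, natDegree_pow, hdf, natDegree_mul (by rintro h; rw [h] at hdX; simp at hdX; omega) hg0, hdX] at this
    omega
  have hd3 : (derivative f).natDegree ≤ 2 := by
    have := natDegree_derivative_le f; omega
  have hz : C ((m : ZMod l) * ε) * derivative f + f * g = 0 := by
    refine eq_zero_of_dvd_of_natDegree_lt hd2 ?_
    rw [hdX]
    refine lt_of_le_of_lt (natDegree_add_le _ _) (max_lt ?_ ?_)
    · refine lt_of_le_of_lt (natDegree_C_mul_le _ _) (by omega)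
    · refine lt_of_le_of_lt natDegree_mul_le (by omega)
  have : (f * g).natDegree ≤ 2 := by
    rw [show f * g = - (C ((m : ZMod l) * ε) * derivative f) by linear_combination hz, natDegree_neg]
    exact (natDegree_C_mul_le _ _).trans hd3
  rw [natDegree_mul (by rintro h; rw [h] at hdf; simp at hdf) hg0, hdf] at this
  omega

lemma Sc_zero (h5 : 5 ≤ l) (Q R : ZMod l) (hV : Vc Q R = 0) : Sc Q R = 0 := by
  have hl : l.Prime := Fact.out
  have hodd : l % 2 = 1 := hl.eq_two_or_odd.resolve_left (by omega)
  have hch : ringChar (ZMod l) ≠ 2 := by rw [ZMod.ringChar_zmod_n]; omega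
  have h := Sc_cast h5 Q R
  rw [hV, neg_zero, ZMod.intCast_zmod_eq_zero_iff_dvd] at h
  have hle : ∀ y : ZMod l, -1 ≤ quadraticChar (ZMod l) y ∧ quadraticChar (ZMod l) y ≤ 1 := by
    intro y
    rcases quadraticChar_isQuadratic (ZMod l) y with h | h | h <;> rw [h] <;> norm_num
  have hsum1 : Sc Q R ≤ l := by
    have : Sc Q R ≤ ∑ x : ZMod l, (1 : ℤ) := Finset.sum_le_sum fun x _ => (hle _).2
    simpa using this
  have hsum2 : -(l : ℤ) ≤ Sc Q R := by
    have : ∑ x : ZMod l, (-1 : ℤ) ≤ Sc Q R := Finset.sum_le_sum fun x _ => (hle _).1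
    simpa using this
  have hpow : ∀ y : ZMod l, y ^ ((l - 1) / 2) = (quadraticChar (ZMod l) y : ZMod l) := by
    intro y
    rw [quadraticChar_eq_pow_of_char_ne_two' hch, ZMod.card]
    congr 1; omega
  obtain ⟨k, hk⟩ := h
  have hl0 : (0 : ℤ) < l := by omega
  have hk1 : k ≤ 1 := by nlinarith
  have hk2 : -1 ≤ k := by nlinarith
  rcases (by omega : k = 0 ∨ k = 1 ∨ k = -1) with rfl | rfl | rfl
  · simpa using hk
  · exfalso
    have hall : ∀ x ∈ Finset.univ, quadraticChar (ZMod l) (x ^ 3 - 3 * Q * x + 2 * R) = (fun _ => 1) x := by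
      rw [← Finset.sum_eq_sum_iff_of_le (fun x _ => (hle _).2)]
      simpa [Sc] using hk
    refine Sc_ne h5 Q R 1 one_ne_zero fun x => ?_
    rw [hpow, fc_eval, hall x (Finset.mem_univ x)]; simp
  · exfalso
    have hall : ∀ x ∈ Finset.univ, (fun _ => (-1 : ℤ)) x = quadraticChar (ZMod l) (x ^ 3 - 3 * Q * x + 2 * R) := by
      rw [← Finset.sum_eq_sum_iff_of_le (fun x _ => (hle _).1)]
      simpa [Sc] using hk.symm
    refine Sc_ne h5 Q R (-1) (by simp) fun x => ?_
    rw [hpow, fc_eval, ← hall x (Finset.mem_univ x)]; simp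

/-- number of affine points -/
lemma aff_card (h5 : 5 ≤ l) (Q R : ZMod l) (hV : Vc Q R = 0) :
    (Finset.univ.filter fun p : ZMod l × ZMod l => p.2 ^ 2 = p.1 ^ 3 - 3 * Q * p.1 + 2 * R).card = l := by
  classical
  have hl : l.Prime := Fact.out
  have hch : ringChar (ZMod l) ≠ 2 := by rw [ZMod.ringChar_zmod_n]; omega
  have e : ∀ x : ZMod l, (((Finset.univ.filter fun p : ZMod l × ZMod l => p.2 ^ 2 = p.1 ^ 3 - 3 * Q * p.1 + 2 * R).filter fun p => p.1 = x).card : ℤ) =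
      quadraticChar (ZMod l) (x ^ 3 - 3 * Q * x + 2 * R) + 1 := by
    intro x
    rw [← quadraticChar_card_sqrts hch]
    norm_cast
    refine Finset.card_bij' (fun p _ => p.2) (fun y _ => (x, y)) ?_ ?_ ?_ ?_ 
    · rintro ⟨a, b⟩ h; simp at h ⊢; obtain ⟨h, rfl⟩ := h; exact h
    · intro y h; simp at h ⊢; exact h
    · rintro ⟨a, b⟩ h; simp at h ⊢; exact h.2.symm
    · intro y h; simp
  have := Finset.card_eq_sum_card_fiberwise (f := fun p : ZMod l × ZMod l => p.1) (t := Finset.univ)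
    (s := Finset.univ.filter fun p : ZMod l × ZMod l => p.2 ^ 2 = p.1 ^ 3 - 3 * Q * p.1 + 2 * R) (by intro _ _; simp)
  have h2 := congrArg (Nat.cast : ℕ → ℤ) this
  rw [Nat.cast_sum] at h2
  simp only [e] at h2
  rw [Finset.sum_add_distrib] at h2
  have h3 := Sc_zero h5 Q R hV
  rw [Sc] at h3
  rw [h3] at h2
  simp at h2
  exact_mod_cast h2

end
end H7

namespace H7

section
variable {l : ℕ} [Fact l.Prime] {n r s : ℕ} (h5 : 5 ≤ l) (hr : r = 0 ∨ r = 1) (hs : s = 0 ∨ s = 1) (hlr : l = 12 * n + 4 * r + 6 * s + 1)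

lemma nat_ne {k : ℕ} (h0 : 0 < k) (h : k < l) : (k : ZMod l) ≠ 0 := by
  intro h'
  rw [ZMod.natCast_eq_zero_iff] at h'
  exact absurd (Nat.le_of_dvd h0 h') (by omega)

lemma fact_ne {k : ℕ} (h : k < l) : ((k.factorial : ℕ) : ZMod l) ≠ 0 := by
  intro h'
  rw [ZMod.natCast_eq_zero_iff, Nat.Prime.dvd_factorial Fact.out] at h'
  omega

lemma choose_ne {k i : ℕ} (h : k < l) (hi : i ≤ k) : ((k.choose i : ℕ) : ZMod l) ≠ 0 := by
  intro h'
  have := Nat.choose_mul_factorial_mul_factorial hi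
  apply fact_ne h
  rw [← this]; push_cast; rw [h']; ring

include h5 in
lemma two_ne' : (2 : ZMod l) ≠ 0 := by exact_mod_cast nat_ne (l := l) (k := 2) (by norm_num) (by omega)
include h5 in
lemma three_ne' : (3 : ZMod l) ≠ 0 := by exact_mod_cast nat_ne (l := l) (k := 3) (by norm_num) (by omega)

/-- coefficients of the Hasse invariant -/
def vc (l n r s i : ℕ) : ZMod l := ((6 * n + 2 * r + 3 * s).choose (4 * n + r + 2 * s - i) : ZMod l) * ((2 * n + r + s + i).choose (r + 3 * i) : ZMod l) *
  (-3) ^ (r + 3 * i) * 2 ^ (s + 2 * (n - i))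

include hr hs hlr in
lemma Vc_eq (Q R : ZMod l) : Vc Q R = ∑ i ∈ Finset.range (n + 1), vc l n r s i * (Q ^ (r + 3 * i) * R ^ (s + 2 * (n - i))) := by
  have hm : (l - 1) / 2 = 6 * n + 2 * r + 3 * s := by omega
  have hm2 : l - 1 = 2 * (6 * n + 2 * r + 3 * s) := by omega
  rw [Vc, hm, hm2, fc, add_pow, finset_sum_coeff]
  have hterm : ∀ i ∈ Finset.range (6 * n + 2 * r + 3 * s + 1), (((X : (ZMod l)[X]) ^ 3) ^ i * (C (-3 * Q) * X + C (2 * R)) ^ (6 * n + 2 * r + 3 * s - i) *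
      (((6 * n + 2 * r + 3 * s).choose i : ℕ) : (ZMod l)[X])).coeff (2 * (6 * n + 2 * r + 3 * s)) =
      if 3 * i ≤ 2 * (6 * n + 2 * r + 3 * s) ∧ (6 * n + 2 * r + 3 * s) ≤ 2 * i then
        ((6 * n + 2 * r + 3 * s).choose i : ZMod l) * ((6 * n + 2 * r + 3 * s - i).choose (2 * (6 * n + 2 * r + 3 * s) - 3 * i) : ZMod l) *
        ((-3 * Q) ^ (2 * (6 * n + 2 * r + 3 * s) - 3 * i) * (2 * R) ^ (2 * i - (6 * n + 2 * r + 3 * s))) else 0 := by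
    intro i hi
    rw [Finset.mem_range] at hi
    rw [← C_eq_natCast, coeff_mul_C, ← pow_mul, coeff_X_pow_mul']
    by_cases h1 : 3 * i ≤ 2 * (6 * n + 2 * r + 3 * s)
    · rw [if_pos h1, add_pow, finset_sum_coeff]
      have : ∀ k ∈ Finset.range (6 * n + 2 * r + 3 * s - i + 1), ((C (-3 * Q) * X) ^ k * (C (2 * R)) ^ (6 * n + 2 * r + 3 * s - i - k) *
        (((6 * n + 2 * r + 3 * s - i).choose k : ℕ) : (ZMod l)[X])).coeff (2 * (6 * n + 2 * r + 3 * s) - 3 * i) =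
        if 2 * (6 * n + 2 * r + 3 * s) - 3 * i = k then (-3 * Q) ^ k * (2 * R) ^ (6 * n + 2 * r + 3 * s - i - k) * ((6 * n + 2 * r + 3 * s - i).choose k : ZMod l) else 0 := by
        intro k _
        rw [← C_eq_natCast, coeff_mul_C, ← C_pow, coeff_mul_C, mul_pow, ← C_pow, coeff_C_mul, coeff_X_pow]
        split_ifs <;> ring
      rw [Finset.sum_congr rfl this, Finset.sum_ite_eq]
      by_cases h2 : (6 * n + 2 * r + 3 * s) ≤ 2 * i
      · rw [if_pos (Finset.mem_range.2 (by omega)), if_pos ⟨h1, h2⟩]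
        rw [show 6 * n + 2 * r + 3 * s - i - (2 * (6 * n + 2 * r + 3 * s) - 3 * i) = 2 * i - (6 * n + 2 * r + 3 * s) by omega]
        ring
      · rw [if_neg (by rw [Finset.mem_range]; omega), if_neg (by tauto)]; simp
    · rw [if_neg h1, if_neg (by tauto)]; simp
  rw [Finset.sum_congr rfl hterm, ← Finset.sum_filter]
  symm
  refine Finset.sum_bij' (fun i _ => 4 * n + r + 2 * s - i) (fun i _ => 4 * n + r + 2 * s - i) ?_ ?_ ?_ ?_ ?_
  · intro i hi; simp only [Finset.mem_filter, Finset.mem_range] at hi ⊢; omega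
  · intro i hi; simp only [Finset.mem_filter, Finset.mem_range] at hi ⊢; rcases hr with rfl | rfl <;> rcases hs with rfl | rfl <;> omega
  · intro i hi; simp only [Finset.mem_filter, Finset.mem_range] at hi ⊢; omega
  · intro i hi; simp only [Finset.mem_filter, Finset.mem_range] at hi ⊢; rcases hr with rfl | rfl <;> rcases hs with rfl | rfl <;> omega
  · intro i hi; simp only [Finset.mem_filter, Finset.mem_range] at hi ⊢
    rw [vc, show 6 * n + 2 * r + 3 * s - (4 * n + r + 2 * s - i) = 2 * n + r + s + i by omega,
      show 2 * (6 * n + 2 * r + 3 * s) - 3 * (4 * n + r + 2 * s - i) = r + 3 * i by omega,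
      show 2 * (4 * n + r + 2 * s - i) - (6 * n + 2 * r + 3 * s) = s + 2 * (n - i) by omega, mul_pow, mul_pow]
    ring

include h5 hlr in
lemma vc_fac {i : ℕ} (hi : i ≤ n) : vc l n r s i * (((4 * n + r + 2 * s - i).factorial : ZMod l) * ((r + 3 * i).factorial : ZMod l) * ((s + 2 * (n - i)).factorial : ZMod l)) =
    ((6 * n + 2 * r + 3 * s).factorial : ZMod l) * ((-3) ^ (r + 3 * i) * 2 ^ (s + 2 * (n - i))) := by
  have e1 := Nat.choose_mul_factorial_mul_factorial (show 4 * n + r + 2 * s - i ≤ 6 * n + 2 * r + 3 * s by omega)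
  have e2 := Nat.choose_mul_factorial_mul_factorial (show r + 3 * i ≤ 2 * n + r + s + i by omega)
  rw [show 6 * n + 2 * r + 3 * s - (4 * n + r + 2 * s - i) = 2 * n + r + s + i by omega] at e1
  rw [show 2 * n + r + s + i - (r + 3 * i) = s + 2 * (n - i) by omega] at e2
  have e1' := congrArg (Nat.cast : ℕ → ZMod l) e1
  have e2' := congrArg (Nat.cast : ℕ → ZMod l) e2
  push_cast at e1' e2'
  rw [← e1', ← e2', vc]; ring

include h5 hlr in
lemma vc_ne {i : ℕ} (hi : i ≤ n) : vc l n r s i ≠ 0 := by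
  intro h
  have := vc_fac h5 hlr hi
  rw [h, zero_mul] at this
  have h1 := fact_ne (l := l) (k := 6 * n + 2 * r + 3 * s) (by omega)
  have h2 : (-3 : ZMod l) ^ (r + 3 * i) ≠ 0 := pow_ne_zero _ (neg_ne_zero.2 (three_ne' h5))
  have h3 : (2 : ZMod l) ^ (s + 2 * (n - i)) ≠ 0 := pow_ne_zero _ (two_ne' h5)
  exact mul_ne_zero h1 (mul_ne_zero h2 h3) this.symm

include hlr in
lemma l_cast : (12 * n + 4 * r + 6 * s + 1 : ZMod l) = 0 := by
  have : ((12 * n + 4 * r + 6 * s + 1 : ℕ) : ZMod l) = 0 := by rw [← hlr]; simp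
  exact_mod_cast this

include h5 hr hlr in
lemma vc_rec {i : ℕ} (hi : i < n) : ((i : ZMod l) + 1) * (144 * i + 96 + 96 * r) * vc l n r s (i + 1) =
    (12 * i + 4 * r + 1) * (12 * i + 4 * r + 7) * vc l n r s i := by
  have f1 := vc_fac h5 hlr (show i ≤ n by omega)
  have f2 := vc_fac h5 hlr (show i + 1 ≤ n by omega)
  obtain ⟨N, rfl⟩ : ∃ N, n = i + 1 + N := ⟨n - i - 1, by omega⟩
  have hlc := l_cast hlr
  push_cast at hlc
  rw [show 4 * (i + 1 + N) + r + 2 * s - i = (3 * i + 3 + 4 * N + r + 2 * s) + 1 by omega, show i + 1 + N - i = N + 1 by omega, show s + 2 * (N + 1) = s + 2 * N + 1 + 1 by ring] at f1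
  rw [show 4 * (i + 1 + N) + r + 2 * s - (i + 1) = (3 * i + 3 + 4 * N + r + 2 * s) by omega, show i + 1 + N - (i + 1) = N by omega, show r + 3 * (i + 1) = r + 3 * i + 1 + 1 + 1 by ring] at f2
  simp only [Nat.factorial_succ] at f1 f2
  push_cast at f1 f2
  have g1 := fact_ne (l := l) (k := 3 * i + 3 + 4 * N + r + 2 * s) (by omega)
  have g2 := fact_ne (l := l) (k := r + 3 * i) (by omega)
  have g3 := fact_ne (l := l) (k := s + 2 * N) (by omega)
  have g4 := nat_ne (l := l) (k := r + 3 * i + 1) (by omega) (by omega)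
  push_cast at g4
  set v1 := vc l (i + 1 + N) r s (i + 1)
  set v0 := vc l (i + 1 + N) r s i
  generalize (((3 * i + 3 + 4 * N + r + 2 * s).factorial : ℕ) : ZMod l) = A at *
  generalize (((r + 3 * i).factorial : ℕ) : ZMod l) = B at *
  generalize (((s + 2 * N).factorial : ℕ) : ZMod l) = D at *
  generalize (((6 * (i + 1 + N) + 2 * r + 3 * s).factorial : ℕ) : ZMod l) = M at *
  have key : 4 * ((r : ZMod l) + 3 * i + 1) * ((r : ZMod l) + 3 * i + 2) * (r + 3 * i + 3) * v1 = -27 * (3 * i + 3 + 4 * N + r + 2 * s + 1) * (s + 2 * N + 2) * (s + 2 * N + 1) * v0 := by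
    apply mul_right_cancel₀ (mul_ne_zero (mul_ne_zero g1 g2) g3)
    simp only [pow_succ] at f1 f2
    linear_combination 4 * f2 + 27 * f1
  have hr' : (r : ZMod l) * (r - 1) = 0 := by rcases hr with rfl | rfl <;> simp
  have e1 : -27 * (3 * i + 3 + 4 * N + r + 2 * s + 1 : ZMod l) = 9 * (r + 3 * i + 1) := by linear_combination -9 * hlc
  have key2 : 4 * ((r : ZMod l) + 3 * i + 2) * (r + 3 * i + 3) * v1 = 9 * (s + 2 * N + 2) * (s + 2 * N + 1) * v0 := by
    rw [e1] at key
    have g4' : (r : ZMod l) + 3 * i + 1 ≠ 0 := g4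
    apply mul_left_cancel₀ g4'
    linear_combination key
  have e2 : 6 * (s + 2 * N + 2 : ZMod l) = -(12 * i + 4 * r + 1) := by linear_combination hlc
  have e3 : 6 * (s + 2 * N + 1 : ZMod l) = -(12 * i + 4 * r + 7) := by linear_combination hlc
  linear_combination 4 * key2 - 16 * v1 * hr' + 6 * (s + 2 * N + 1 : ZMod l) * v0 * e2 - (12 * i + 4 * r + 1) * v0 * e3

/-! ### the differential equation -/

noncomputable def Wp (l n r s : ℕ) : (ZMod l)[X] := ∑ i ∈ Finset.range (n + 1), C (vc l n r s i) * X ^ i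

lemma Wp_coeff (i : ℕ) : (Wp l n r s).coeff i = if i ≤ n then vc l n r s i else 0 := by
  rw [Wp, finset_sum_coeff]
  simp only [coeff_C_mul, coeff_X_pow, mul_ite, mul_one, mul_zero]
  rw [Finset.sum_ite_eq]
  simp [Nat.lt_succ_iff]

lemma coeff_XE (p : (ZMod l)[X]) (i : ℕ) : (X * derivative p).coeff i = i * p.coeff i := by
  rcases i with _ | i
  · simp
  · rw [coeff_X_mul, coeff_derivative]; push_cast; ring

include hs hlr in
lemma Wp_top : ((12 * n + 4 * r + 1) * (12 * n + 4 * r + 7) : ZMod l) = 0 := by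
  have hlc := l_cast hlr
  rcases hs with rfl | rfl
  · have : (12 * n + 4 * r + 1 : ZMod l) = 0 := by linear_combination hlc
    rw [this]; ring
  · have : (12 * n + 4 * r + 7 : ZMod l) = 0 := by linear_combination hlc
    rw [this]; ring

include h5 hr hs hlr in
lemma Wp_ode : 144 * X * (1 - X) * derivative (derivative (Wp l n r s)) + ((96 + 96 * (r : (ZMod l)[X])) - (240 + 96 * (r : (ZMod l)[X])) * X) * derivative (Wp l n r s) 
    - (4 * (r : (ZMod l)[X]) + 1) * (4 * (r : (ZMod l)[X]) + 7) * Wp l n r s = 0 := by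
  set W := Wp l n r s with hW
  have e : 144 * X * (1 - X) * derivative (derivative W) + ((96 + 96 * (r : (ZMod l)[X])) - (240 + 96 * (r : (ZMod l)[X])) * X) * derivative W 
    - (4 * (r : (ZMod l)[X]) + 1) * (4 * (r : (ZMod l)[X]) + 7) * W = C 144 * derivative (X * derivative W) - C 144 * (X * derivative (X * derivative W)) + C (96 * (r : ZMod l) - 48) * derivative W
     - C (96 * r + 96 : ZMod l) * (X * derivative W) - C ((4 * r + 1) * (4 * r + 7) : ZMod l) * W := by
    simp only [derivative_mul, derivative_X, C_mul, C_add, C_sub, map_ofNat, map_natCast, C_1]; ring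
  rw [e]
  ext i
  simp only [coeff_add, coeff_sub, coeff_C_mul, coeff_XE, coeff_derivative, coeff_zero]
  rw [hW, Wp_coeff, Wp_coeff]
  push_cast
  rcases lt_trichotomy i n with h | h | h
  · rw [if_pos (by omega), if_pos (by omega)]
    linear_combination vc_rec h5 hr hlr h
  · rw [if_neg (by omega), if_pos (by omega), h]
    linear_combination - vc l n r s n * Wp_top hs hlr
  · rw [if_neg (by omega), if_neg (by omega)]; ring

include h5 hr hs hlr in
lemma Up_rec (i : ℕ) : -144 * ((i : ZMod l) + 1) ^ 2 * ((Wp l n r s).comp (X + 1)).coeff (i + 1) =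
    (12 * i + 4 * r + 1) * (12 * i + 4 * r + 7) * ((Wp l n r s).comp (X + 1)).coeff i := by
  have ode := Wp_ode h5 hr hs hlr
  set W := Wp l n r s with hW
  set U := W.comp (X + 1) with hU
  have d1 : derivative U = (derivative W).comp (X + 1) := by rw [hU, derivative_comp]; simp
  have d2 : derivative (derivative U) = (derivative (derivative W)).comp (X + 1) := by rw [d1, derivative_comp]; simp
  have o2 := congrArg (fun p => p.comp (X + 1)) ode
  simp only [sub_comp, add_comp, mul_comp, X_comp, zero_comp, natCast_comp, one_comp, ofNat_comp, ← hU, ← d1, ← d2] at o2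
  have e : C 144 * derivative (X * derivative U) + C 144 * (X * derivative (X * derivative U)) + C (96 * r + 96 : ZMod l) * (X * derivative U) + C ((4 * r + 1) * (4 * r + 7) : ZMod l) * U = 0 := by
    simp only [derivative_mul, derivative_X, C_mul, C_add, C_sub, map_ofNat, map_natCast, C_1]
    linear_combination -o2
  have := congrArg (fun p => p.coeff i) e
  simp only [coeff_add, coeff_sub, coeff_C_mul, coeff_XE, coeff_derivative, coeff_zero] at this
  push_cast at this
  linear_combination -this

include h5 hr hs hlr in
lemma Up_eq {i : ℕ} (hi : i ≤ n) : ((Wp l n r s).comp (X + 1)).coeff i * 1728 ^ i = ((Wp l n r s).comp (X + 1)).coeff 0 * (cf n s (n - i) : ZMod l) := by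
  induction i with
  | zero => simp [cf_self]
  | succ i ih =>
    have ih := ih (by omega)
    have h1 := Up_rec h5 hr hs hlr i
    have h2 := cf_rec n s (n - (i + 1)) (by omega)
    rw [show n - (i + 1) + 1 = n - i by omega, show n - (n - (i + 1)) = i + 1 by omega] at h2
    have h2' := congrArg (Int.cast : ℤ → ZMod l) h2
    obtain ⟨N, rfl⟩ : ∃ N, n = i + 1 + N := ⟨n - i - 1, by omega⟩
    rw [show i + 1 + N - (i + 1) = N by omega] at h2' ⊢
    rw [show i + 1 + N - i = N + 1 by omega] at h2' ih
    push_cast at h2'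
    have hlc := l_cast hlr
    push_cast at hlc
    have hi0 := nat_ne (l := l) (k := i + 1) (by omega) (by omega)
    push_cast at hi0
    have h2n := two_ne' (l := l) h5
    have h3n := three_ne' (l := l) h5
    have e2 : 6 * (2 * N + s + 2 : ZMod l) = -(12 * i + 4 * r + 1) := by linear_combination hlc
    have e3 : 6 * (2 * N + s + 1 : ZMod l) = -(12 * i + 4 * r + 7) := by linear_combination hlc
    have h144 : (144 : ZMod l) ≠ 0 := by
      have : (144 : ZMod l) = 2 ^ 4 * 3 ^ 2 := by norm_num
      rw [this]; exact mul_ne_zero (pow_ne_zero _ h2n) (pow_ne_zero _ h3n)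
    apply mul_left_cancel₀ (mul_ne_zero h144 (pow_ne_zero 2 hi0))
    have h12 : 36 * ((2 * N + s + 2) * (2 * N + s + 1) : ZMod l) = (12 * i + 4 * r + 1) * (12 * i + 4 * r + 7) := by
      linear_combination 6 * (2 * N + s + 1 : ZMod l) * e2 - (12 * i + 4 * r + 1) * e3
    rw [pow_succ]
    linear_combination (-(1728 : ZMod l) ^ i * 1728) * h1 - 1728 * (12 * i + 4 * r + 1) * (12 * i + 4 * r + 7) * ih
      - 144 * ((Wp l (i + 1 + N) r s).comp (X + 1)).coeff 0 * h2' + 1728 * ((Wp l (i + 1 + N) r s).comp (X + 1)).coeff 0 * (cf (i + 1 + N) s (N + 1) : ZMod l) * h12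

include h5 hlr in
lemma num_ne : (1728 : ZMod l) ≠ 0 ∧ (432 : ZMod l) ≠ 0 := by
  have h2n := two_ne' (l := l) h5
  have h3n := three_ne' (l := l) h5
  constructor
  · rw [show (1728 : ZMod l) = 2 ^ 6 * 3 ^ 3 by norm_num]; exact mul_ne_zero (pow_ne_zero _ h2n) (pow_ne_zero _ h3n)
  · rw [show (432 : ZMod l) = 2 ^ 4 * 3 ^ 3 by norm_num]; exact mul_ne_zero (pow_ne_zero _ h2n) (pow_ne_zero _ h3n)

include h5 hlr in
lemma Up_zero_ne (hr : r = 0 ∨ r = 1) (hs : s = 0 ∨ s = 1) : ((Wp l n r s).comp (X + 1)).coeff 0 ≠ 0 := by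
  intro h
  have hd : (Wp l n r s).natDegree ≤ n := by
    rw [natDegree_le_iff_coeff_eq_zero]
    intro i hi
    rw [Wp_coeff, if_neg (by omega)]
  have hd2 : ((Wp l n r s).comp (X + 1)).natDegree ≤ n := by
    refine natDegree_comp_le.trans ?_
    have : (X + 1 : (ZMod l)[X]).natDegree = 1 := by rw [show (1 : (ZMod l)[X]) = C 1 by simp, natDegree_X_add_C]
    rw [this]; omega
  have hz : (Wp l n r s).comp (X + 1) = 0 := by
    ext i
    rw [coeff_zero]
    by_cases hi : i ≤ n
    · have := Up_eq h5 hr hs hlr hi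
      rw [h, zero_mul] at this
      exact (mul_eq_zero.1 this).resolve_right (pow_ne_zero _ (num_ne h5 hlr).1)
    · exact coeff_eq_zero_of_natDegree_lt (by omega)
  have hz' := congrArg (fun p => (p.comp (X - 1)).coeff 0) hz
  simp only [comp_assoc, add_comp, X_comp, one_comp, sub_add_cancel, comp_X, zero_comp, coeff_zero] at hz'
  rw [Wp_coeff, if_pos (by omega)] at hz'
  exact vc_ne h5 hlr (by omega) hz'

include h5 hr hs hlr in
lemma Wp_eval (z T : ZMod l) (hz : z * (T - 1) = 1728) : z ^ n * (Wp l n r s).eval T =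
    ((Wp l n r s).comp (X + 1)).coeff 0 * ∑ i ∈ Finset.range (n + 1), (cf n s i : ZMod l) * z ^ i := by
  set U := (Wp l n r s).comp (X + 1) with hU
  have hd : (Wp l n r s).natDegree ≤ n := by
    rw [natDegree_le_iff_coeff_eq_zero]
    intro i hi
    rw [Wp_coeff, if_neg (by omega)]
  have hd2 : U.natDegree ≤ n := by
    refine natDegree_comp_le.trans ?_
    have : (X + 1 : (ZMod l)[X]).natDegree = 1 := by rw [show (1 : (ZMod l)[X]) = C 1 by simp, natDegree_X_add_C]
    rw [this]; omega
  have e1 : (Wp l n r s).eval T = U.eval (T - 1) := by rw [hU, eval_comp]; simp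
  rw [e1, eval_eq_sum_range' (Nat.lt_succ_of_le hd2), Finset.mul_sum, Finset.mul_sum, ← Finset.sum_range_reflect]
  refine Finset.sum_congr rfl fun i hi => ?_
  rw [Finset.mem_range] at hi
  have := Up_eq h5 hr hs hlr (show n - i ≤ n by omega)
  rw [show n - (n - i) = i by omega, ← hU] at this
  have hzn : z ^ n = z ^ i * z ^ (n - i) := by rw [← pow_add]; congr 1; omega
  rw [show n.succ - 1 - i = n - i by omega, ← mul_assoc (U.coeff 0), ← this, ← hz, mul_pow, hzn]
  ring

include h5 hlr in
lemma cf_zero_ne (hs : s = 0 ∨ s = 1) : (cf n s 0 : ZMod l) ≠ 0 := by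
  rw [cf]; push_cast
  refine mul_ne_zero (mul_ne_zero ?_ ?_) (pow_ne_zero _ (neg_ne_zero.2 (num_ne h5 hlr).2))
  · exact choose_ne (by omega) (by omega)
  · exact choose_ne (by omega) (by omega)

include h5 hr hs hlr in
lemma Vc_iff {Q R : ZMod l} (hD : Q ^ 3 ≠ R ^ 2) : Vc Q R = 0 ↔ (gpol (ZMod l) n r s).eval (1728 * Q ^ 3 / (Q ^ 3 - R ^ 2)) = 0 := by
  have hD' : Q ^ 3 - R ^ 2 ≠ 0 := sub_ne_zero.2 hD
  have h1728 := (num_ne h5 hlr).1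
  set j := 1728 * Q ^ 3 / (Q ^ 3 - R ^ 2) with hj
  have hz : j - 1728 = 1728 * R ^ 2 / (Q ^ 3 - R ^ 2) := by rw [hj]; field_simp; ring
  have hj0 : j ^ (4 * r) = 0 ↔ Q ^ r = 0 := by
    have : j = 0 ↔ Q = 0 := by rw [hj]; simp [h1728, hD']
    simp only [pow_eq_zero_iff', this, ne_eq, mul_eq_zero, OfNat.ofNat_ne_zero, false_or]
  have hz0 : (j - 1728) ^ (6 * s) = 0 ↔ R ^ s = 0 := by
    have : j - 1728 = 0 ↔ R = 0 := by rw [hz]; simp [h1728, hD']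
    simp only [pow_eq_zero_iff', this, ne_eq, mul_eq_zero, OfNat.ofNat_ne_zero, false_or]
  have hg : (gpol (ZMod l) n r s).eval j = j ^ (4 * r) * (j - 1728) ^ (6 * s) * (∑ i ∈ Finset.range (n + 1), (cf n s i : ZMod l) * (j - 1728) ^ i) ^ 12 := by
    simp [gpol, eval_finset_sum]
  have hV : Vc Q R = Q ^ r * R ^ s * ∑ i ∈ Finset.range (n + 1), vc l n r s i * ((Q ^ 3) ^ i * (R ^ 2) ^ (n - i)) := by
    rw [Vc_eq hr hs hlr, Finset.mul_sum]
    refine Finset.sum_congr rfl fun i _ => ?_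
    rw [pow_add, pow_add, pow_mul, pow_mul]; ring
  rw [hg, hV]
  simp only [mul_eq_zero, hj0, hz0, pow_eq_zero_iff (show 12 ≠ 0 by norm_num)]
  refine or_congr Iff.rfl ?_
  by_cases hR : R = 0
  · have hQ : Q ≠ 0 := by rintro rfl; exact hD (by rw [hR]; ring)
    have hz00 : j - 1728 = 0 := by rw [hz, hR]; simp
    rw [hz00, hR]
    rw [Finset.sum_eq_single n, Finset.sum_eq_single 0]
    · simp [cf_zero_ne h5 hlr hs, vc_ne h5 hlr (le_refl n), hQ]
    · intro i _ hi; simp [hi]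
    · simp
    · intro i hi hi2
      rw [Finset.mem_range] at hi
      have : n - i ≠ 0 := by omega
      simp [this]
    · simp
  · have hR2 : R ^ 2 ≠ 0 := pow_ne_zero 2 hR
    have e1 : ∑ i ∈ Finset.range (n + 1), vc l n r s i * ((Q ^ 3) ^ i * (R ^ 2) ^ (n - i)) = (R ^ 2) ^ n * (Wp l n r s).eval (Q ^ 3 / R ^ 2) := by
      rw [Wp, eval_finset_sum, Finset.mul_sum]
      refine Finset.sum_congr rfl fun i hi => ?_
      rw [Finset.mem_range] at hi
      rw [eval_mul, eval_C, eval_pow, eval_X, div_pow]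
      have hzn : (R ^ 2) ^ n = (R ^ 2) ^ (n - i) * (R ^ 2) ^ i := by rw [← pow_add]; congr 1; omega
      rw [hzn]
      field_simp
    have e2 := Wp_eval h5 hr hs hlr (j - 1728) (Q ^ 3 / R ^ 2) (by rw [hz]; field_simp)
    have hzn : (j - 1728) ≠ 0 := by rw [hz]; exact div_ne_zero (mul_ne_zero h1728 hR2) hD'
    rw [e1]
    have hU := Up_zero_ne h5 hlr hr hs
    refine ⟨fun h => ?_, fun h => ?_⟩
    · have := (mul_eq_zero.1 h).resolve_left (pow_ne_zero _ hR2)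
      rw [this, mul_zero] at e2
      exact (mul_eq_zero.1 e2.symm).resolve_left hU
    · rw [h, mul_zero] at e2
      rw [(mul_eq_zero.1 e2).resolve_left (pow_ne_zero _ hzn), mul_zero]

include h5 hr hs hlr in
lemma Vc_Q0 {R : ZMod l} (hR : R ≠ 0) (hV : Vc 0 R = 0) : r = 1 := by
  by_contra h
  have h0 : r = 0 := by omega
  rw [Vc_eq hr hs hlr, Finset.sum_eq_single 0] at hV
  · rw [h0] at hV
    simp [hR] at hV
    exact vc_ne h5 (r := 0) (n := n) (s := s) (by omega) (by omega) hV
  · intro i _ hi; simp [hi]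
  · simp

include h5 hr hs hlr in
lemma Vc_R0 {Q : ZMod l} (hQ : Q ≠ 0) (hV : Vc Q 0 = 0) : s = 1 := by
  by_contra h
  have h0 : s = 0 := by omega
  rw [Vc_eq hr hs hlr, Finset.sum_eq_single n] at hV
  · rw [h0] at hV
    simp [hQ] at hV
    exact vc_ne h5 (r := r) (n := n) (s := 0) (by omega) (by omega) hV
  · intro i hi hi2
    rw [Finset.mem_range] at hi
    rw [zero_pow (by omega)]; simp
  · simp

end
end H7

namespace H7

section
open WeierstrassCurve WeierstrassCurve.Affine

/-- The short Weierstrass curve `y² = x³ - 3Qx + 2R`. -/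
abbrev Wc {F : Type*} [Field F] (Q R : F) : WeierstrassCurve.Affine F := ⟨0, 0, 0, -3 * Q, 2 * R⟩

variable {F : Type*} [Field F] [DecidableEq F] {Q R : F}

lemma Wc_eq (x y : F) : (Wc Q R).Equation x y ↔ y ^ 2 = x ^ 3 - 3 * Q * x + 2 * R := by
  rw [equation_iff]
  simp only [zero_mul, add_zero]
  rw [show x ^ 3 + -3 * Q * x + 2 * R = x ^ 3 - 3 * Q * x + 2 * R by ring]

lemma Wc_disc : (Wc Q R).Δ = 1728 * (Q ^ 3 - R ^ 2) := by
  simp only [WeierstrassCurve.Δ, WeierstrassCurve.b₂, WeierstrassCurve.b₄, WeierstrassCurve.b₆, WeierstrassCurve.b₈]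
  ring

lemma Wc_negY (x y : F) : (Wc Q R).negY x y = -y := by
  simp [negY]

lemma pt_congr {x y x' y' : F} (h : (Wc Q R).Nonsingular x y) (hx : x = x') (hy : y = y') :
    ∃ h' : (Wc Q R).Nonsingular x' y', Point.some x y h = Point.some x' y' h' := by
  subst hx hy
  exact ⟨h, rfl⟩

lemma pt_dbl (h2 : (2 : F) ≠ 0) {x y t : F} (h : (Wc Q R).Nonsingular x y) (hy : y ≠ 0) (ht : 2 * y * t = 3 * x ^ 2 - 3 * Q) :
    ∃ h', Point.some x y h + Point.some x y h = Point.some (W' := Wc Q R) (t ^ 2 - 2 * x) (-(t * (t ^ 2 - 3 * x) + y)) h' := by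
  have hy' : y ≠ (Wc Q R).negY x y := by
    rw [Wc_negY]
    intro h'
    apply hy
    have : 2 * y = 0 := by linear_combination h'
    exact (mul_eq_zero.1 this).resolve_left h2
  have hs : (Wc Q R).slope x x y y = t := by
    rw [slope_of_Y_ne rfl hy', Wc_negY, div_eq_iff (by rw [sub_neg_eq_add, ← two_mul]; exact mul_ne_zero h2 hy)]
    simp only [mul_zero, zero_mul]
    linear_combination -ht
  rw [Point.add_self_of_Y_ne hy']
  apply pt_congr
  · rw [hs, addX]; ring
  · rw [hs, addY, Wc_negY, negAddY, addX]; ring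

lemma pt_add {x y x' y' t : F} (h : (Wc Q R).Nonsingular x y) (h' : (Wc Q R).Nonsingular x' y') (hx : x ≠ x') (ht : t * (x - x') = y - y') :
    ∃ h'', Point.some x y h + Point.some x' y' h' = Point.some (W' := Wc Q R) (t ^ 2 - x - x') (-(t * (t ^ 2 - 2 * x - x') + y)) h'' := by
  have hs : (Wc Q R).slope x x' y y' = t := by
    rw [slope_of_X_ne hx, div_eq_iff (sub_ne_zero.2 hx), ht]
  rw [Point.add_of_X_ne hx]
  apply pt_congr
  · rw [hs, addX]; ring
  · rw [hs, addY, Wc_negY, negAddY, addX]; ring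

/-- algebraic form of being a point of order `7`. -/
def Ord7 (Q x y t u : F) : Prop :=
  y ≠ 0 ∧ 2 * y * t = 3 * x ^ 2 - 3 * Q ∧ 3 * x - t ^ 2 ≠ 0 ∧ u * (3 * x - t ^ 2) = 2 * y ∧ u - 2 * t ≠ 0 ∧
    (3 * x - t ^ 2) * ((3 * x - t ^ 2) + u * (u - 2 * t)) = u * (u - 2 * t) ^ 3

lemma ord7_core (h2 : (2 : F) ≠ 0) {x y t u : F} (h : (Wc Q R).Nonsingular x y) (hy : y ≠ 0)
    (ht : 2 * y * t = 3 * x ^ 2 - 3 * Q) (ha : 3 * x - t ^ 2 ≠ 0) (hu : u * (3 * x - t ^ 2) = 2 * y) :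
    (7 : ℕ) • Point.some x y h = 0 ↔ u - 2 * t ≠ 0 ∧
    (3 * x - t ^ 2) * ((3 * x - t ^ 2) + u * (u - 2 * t)) = u * (u - 2 * t) ^ 3 := by
  have hu0 : u ≠ 0 := by
    rintro rfl
    rw [zero_mul] at hu
    exact hy ((mul_eq_zero.1 hu.symm).resolve_left h2)
  set P := Point.some x y h with hP
  obtain ⟨k2, e2⟩ := pt_dbl h2 h hy ht
  have hx2 : x ≠ t ^ 2 - 2 * x := fun h' => ha (by linear_combination h')
  obtain ⟨k3, e3⟩ := pt_add (t := u - t) h k2 hx2 (by linear_combination hu)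
  rw [← e2, ← hP] at e3
  have e3' : (u - t) ^ 2 - x - (t ^ 2 - 2 * x) = x + u * (u - 2 * t) := by ring
  have hP0 : P ≠ 0 := Point.some_ne_zero h
  have p2 : P + P ≠ 0 := by rw [e2]; exact Point.some_ne_zero k2
  by_cases hc : u - 2 * t = 0
  · simp only [hc, ne_eq, not_true_eq_false, false_and, iff_false]
    have hx3 : (u - t) ^ 2 - x - (t ^ 2 - 2 * x) = x := by rw [e3', hc]; ring
    have := (Point.X_eq_iff (h₁ := k3) (h₂ := h)).1 hx3
    rw [← e3, ← hP] at this
    intro h7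
    have h4 : P + (P + P) = -P := by
      rcases this with h' | h'
      · exact absurd (by simpa using h') p2
      · exact h'
    apply hP0
    have h5 : (4 : ℕ) • P = 0 := by
      have := congrArg (· + P) h4
      simp only [neg_add_cancel] at this
      rw [← this]; abel
    calc P = (2 : ℕ) • (4 : ℕ) • P - (7 : ℕ) • P := by abel
      _ = 0 := by rw [h5, h7]; simp
  · simp only [ne_eq, hc, not_false_eq_true, true_and]
    have hX3 : u * (u - 2 * t) ≠ 0 := mul_ne_zero hu0 hc
    obtain ⟨m, hm⟩ : ∃ m, m * (x - ((u - t) ^ 2 - x - (t ^ 2 - 2 * x))) = y - (-((u - t) * ((u - t) ^ 2 - 2 * x - (t ^ 2 - 2 * x)) + y)) := by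
      have : x - ((u - t) ^ 2 - x - (t ^ 2 - 2 * x)) ≠ 0 := by
        rw [e3']; simpa using hX3
      exact ⟨_, div_mul_cancel₀ _ this⟩
    have hx3 : x ≠ (u - t) ^ 2 - x - (t ^ 2 - 2 * x) := by
      rw [e3']; intro h'; apply hX3; linear_combination -h'
    obtain ⟨k4, e4⟩ := pt_add h k3 hx3 hm
    rw [← e3, ← hP] at e4
    have key : (7 : ℕ) • P = 0 ↔ m ^ 2 - x - ((u - t) ^ 2 - x - (t ^ 2 - 2 * x)) = ((u - t) ^ 2 - x - (t ^ 2 - 2 * x)) := by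
      rw [Point.X_eq_iff (h₁ := k4) (h₂ := k3), ← e3, ← e4]
      constructor
      · intro h7
        right
        rw [eq_neg_iff_add_eq_zero, ← h7]; abel
      · rintro (h' | h')
        · exact absurd (by simpa using h') hP0
        · rw [eq_neg_iff_add_eq_zero] at h'
          rw [← h']; abel
    rw [key]
    have hm' : m * (u * (u - 2 * t)) = -(2 * y) - (u - t) * (u * (u - 2 * t)) := by
      linear_combination -hm
    have hm2 : m * (u - 2 * t) = -(3 * x - t ^ 2) - (u - t) * (u - 2 * t) := by
      apply mul_left_cancel₀ hu0
      linear_combination hm' + hu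
    have hc2 : (u - 2 * t) ^ 2 ≠ 0 := pow_ne_zero _ hc
    rw [← sub_eq_zero, ← mul_right_inj' hc2, mul_zero, ← sub_eq_zero (a := (3 * x - t ^ 2) * _)]
    have : (u - 2 * t) ^ 2 * (m ^ 2 - x - ((u - t) ^ 2 - x - (t ^ 2 - 2 * x)) - ((u - t) ^ 2 - x - (t ^ 2 - 2 * x))) =
      (3 * x - t ^ 2) * ((3 * x - t ^ 2) + u * (u - 2 * t)) - u * (u - 2 * t) ^ 3 := by
      linear_combination (m * (u - 2 * t) + (-(3 * x - t ^ 2) - (u - t) * (u - 2 * t))) * hm2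
    rw [this]

lemma ord7_iff (h2 : (2 : F) ≠ 0) {x y : F} (h : (Wc Q R).Nonsingular x y) :
    (7 : ℕ) • Point.some x y h = 0 ↔ ∃ t u, Ord7 Q x y t u := by
  have hP0 := Point.some_ne_zero h
  constructor
  · intro h7
    have hy : y ≠ 0 := by
      intro hy
      have : Point.some x y h + Point.some x y h = 0 := Point.add_self_of_Y_eq (by rw [Wc_negY, hy, neg_zero])
      apply hP0
      generalize Point.some x y h = P at *
      calc P = (7 : ℕ) • P - (3 : ℕ) • (P + P) := by abel
        _ = 0 := by rw [h7, this]; simp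
    obtain ⟨t, ht⟩ : ∃ t, 2 * y * t = 3 * x ^ 2 - 3 * Q := ⟨_, mul_div_cancel₀ _ (mul_ne_zero h2 hy)⟩
    have ha : 3 * x - t ^ 2 ≠ 0 := by
      intro ha
      obtain ⟨k2, e2⟩ := pt_dbl h2 h hy ht
      have := (Point.X_eq_iff (h₁ := k2) (h₂ := h)).1 (by linear_combination -ha)
      rw [← e2] at this
      apply hP0
      generalize Point.some x y h = P at *
      rcases this with h' | h'
      · simpa using h'
      · rw [eq_neg_iff_add_eq_zero] at h'
        calc P = (7 : ℕ) • P - (2 : ℕ) • (P + P + P) := by abel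
          _ = 0 := by rw [h7, h']; simp
    refine ⟨t, 2 * y / (3 * x - t ^ 2), hy, ht, ha, div_mul_cancel₀ _ ha, ?_⟩
    exact (ord7_core h2 h hy ht ha (div_mul_cancel₀ _ ha)).1 h7
  · rintro ⟨t, u, hy, ht, ha, hu, h'⟩
    exact (ord7_core h2 h hy ht ha hu).2 h'

end
end H7

namespace H7

section
open WeierstrassCurve WeierstrassCurve.Affine

variable {F : Type*} [Field F]

/-- `c₄` of the Tate normal form. -/
def c4v (d : F) : F := (d ^ 2 - d + 1) * (d ^ 6 - 11 * d ^ 5 + 30 * d ^ 4 - 15 * d ^ 3 - 10 * d ^ 2 + 5 * d + 1)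

/-- `-c₆` of the Tate normal form. -/
def wv (d : F) : F := d ^ 12 - 18 * d ^ 11 + 117 * d ^ 10 - 354 * d ^ 9 + 570 * d ^ 8 - 486 * d ^ 7
        + 273 * d ^ 6 - 222 * d ^ 5 + 174 * d ^ 4 - 46 * d ^ 3 - 15 * d ^ 2 + 6 * d + 1

/-- discriminant of the Tate normal form. -/
def Dv (d : F) : F := d ^ 7 * (d - 1) ^ 7 * (d ^ 3 - 8 * d ^ 2 + 5 * d + 1)

lemma cwD (d : F) : c4v d ^ 3 - wv d ^ 2 = 1728 * Dv d := by
  unfold c4v wv Dv; ring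

/-- x-coordinate. -/
def xv (d v : F) : F := v ^ 2 * (3 * (1 - (d ^ 2 - d)) ^ 2 - 12 * (d ^ 3 - d ^ 2))
/-- y-coordinate. -/
def yv (d v : F) : F := -108 * v ^ 3 * (d ^ 3 - d ^ 2)

lemma par_eq (d v : F) : yv d v ^ 2 = xv d v ^ 3 - 3 * (9 * v ^ 4 * c4v d) * xv d v + 2 * (27 * v ^ 6 * wv d) := by
  unfold xv yv c4v wv; ring

lemma par_t (d v : F) : 2 * yv d v * (3 * v * (1 - (d ^ 2 - d))) = 3 * xv d v ^ 2 - 3 * (9 * v ^ 4 * c4v d) := by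
  unfold xv yv c4v; ring

lemma par_a (d v : F) : 3 * xv d v - (3 * v * (1 - (d ^ 2 - d))) ^ 2 = -36 * v ^ 2 * (d ^ 3 - d ^ 2) := by
  unfold xv; ring

/-- the parametrising condition -/
def Mcond (Q R : F) (p : F × F) : Prop := p.2 ≠ 0 ∧ Dv p.1 ≠ 0 ∧ Q = 9 * p.2 ^ 4 * c4v p.1 ∧ R = 27 * p.2 ^ 6 * wv p.1

lemma D_ne {d : F} (h : Dv d ≠ 0) : d ≠ 0 ∧ d - 1 ≠ 0 := by
  unfold Dv at h
  constructor <;> rintro h' <;> simp [h'] at h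

lemma par_ord7 (h2 : (2 : F) ≠ 0) (h3 : (3 : F) ≠ 0) {Q R : F} {p : F × F} (h : Mcond Q R p) :
    Ord7 Q (xv p.1 p.2) (yv p.1 p.2) (3 * p.2 * (1 - (p.1 ^ 2 - p.1))) (6 * p.2) := by
  obtain ⟨d, v⟩ := p
  obtain ⟨hv, hD, hQ, hR⟩ := h
  obtain ⟨hd, hd1⟩ := D_ne hD
  have hb : d ^ 3 - d ^ 2 ≠ 0 := by
    rw [show d ^ 3 - d ^ 2 = d ^ 2 * (d - 1) by ring]; exact mul_ne_zero (pow_ne_zero _ hd) hd1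
  have h6 : (6 : F) ≠ 0 := by rw [show (6 : F) = 2 * 3 by norm_num]; exact mul_ne_zero h2 h3
  have h36 : (-36 : F) ≠ 0 := by rw [show (-36 : F) = -(6 * 6) by norm_num]; exact neg_ne_zero.2 (mul_ne_zero h6 h6)
  refine ⟨?_, ?_, ?_, ?_, ?_, ?_⟩
  · unfold yv
    rw [show (-108 : F) = -36 * 3 by norm_num]
    exact mul_ne_zero (mul_ne_zero (mul_ne_zero h36 h3) (pow_ne_zero _ hv)) hb
  · rw [hQ]; exact par_t d v
  · dsimp only; rw [par_a]; exact mul_ne_zero (mul_ne_zero h36 (pow_ne_zero _ hv)) hb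
  · dsimp only; rw [par_a]; unfold yv; ring
  · dsimp only
    rw [show 6 * v - 2 * (3 * v * (1 - (d ^ 2 - d))) = 6 * v * (d * (d - 1)) by ring]
    exact mul_ne_zero (mul_ne_zero h6 hv) (mul_ne_zero hd hd1)
  · dsimp only; rw [par_a]; ring

lemma par_inj (h2 : (2 : F) ≠ 0) (h3 : (3 : F) ≠ 0) {Q R : F} {p q : F × F} (hp : Mcond Q R p) (hq : Mcond Q R q)
    (hx : xv p.1 p.2 = xv q.1 q.2) (hy : yv p.1 p.2 = yv q.1 q.2) : p = q := by
  obtain ⟨a1, a2, a3, a4, a5, a6⟩ := par_ord7 h2 h3 hp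
  obtain ⟨b1, b2, b3, b4, b5, b6⟩ := par_ord7 h2 h3 hq
  rw [← hx, ← hy] at b2 b4
  have ht := mul_left_cancel₀ (mul_ne_zero h2 a1) (a2.trans b2.symm)
  rw [← ht] at b4
  have hu := mul_right_cancel₀ a3 (a4.trans b4.symm)
  have h6 : (6 : F) ≠ 0 := by rw [show (6 : F) = 2 * 3 by norm_num]; exact mul_ne_zero h2 h3
  have hv := mul_left_cancel₀ h6 hu
  obtain ⟨d, v⟩ := p
  obtain ⟨e, w⟩ := q
  obtain ⟨hv0, hD, -⟩ := hp
  obtain ⟨hd, hd1⟩ := D_ne hD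
  dsimp only at *
  subst hv
  have hc : d ^ 2 - d = e ^ 2 - e := by
    have := mul_left_cancel₀ (mul_ne_zero h3 hv0) ht
    linear_combination -this
  have hb : d ^ 3 - d ^ 2 = e ^ 3 - e ^ 2 := by
    unfold xv at hx
    have := mul_left_cancel₀ (pow_ne_zero _ hv0) hx
    rw [hc] at this
    apply mul_left_cancel₀ (mul_ne_zero h2 h6)
    linear_combination -this
  have : d = e := by
    apply mul_right_cancel₀ (mul_ne_zero hd hd1)
    linear_combination hb - e * hc
  rw [this]

lemma par_surj (h2 : (2 : F) ≠ 0) (h3 : (3 : F) ≠ 0) {Q R x y t u : F} (hD : Q ^ 3 ≠ R ^ 2)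
    (he : y ^ 2 = x ^ 3 - 3 * Q * x + 2 * R) (h : Ord7 Q x y t u) : ∃ p, Mcond Q R p ∧ xv p.1 p.2 = x ∧ yv p.1 p.2 = y := by
  obtain ⟨hy, ht, ha, hu, hc, h7⟩ := h
  have h6 : (6 : F) ≠ 0 := by rw [show (6 : F) = 2 * 3 by norm_num]; exact mul_ne_zero h2 h3
  have hu0 : u ≠ 0 := by
    rintro rfl
    rw [zero_mul] at hu
    exact hy ((mul_eq_zero.1 hu.symm).resolve_left h2)
  obtain ⟨v, rfl⟩ : ∃ v, u = 6 * v := ⟨u / 6, (mul_div_cancel₀ _ h6).symm⟩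
  have hv : v ≠ 0 := right_ne_zero_of_mul hu0
  obtain ⟨c, rfl⟩ : ∃ c, t = 3 * v * (1 - c) := ⟨1 - t / (3 * v), by field_simp; ring⟩
  obtain ⟨b, hb⟩ : ∃ b, 3 * x - (3 * v * (1 - c)) ^ 2 = -(36 * v ^ 2) * b :=
    ⟨(3 * x - (3 * v * (1 - c)) ^ 2) / (-(36 * v ^ 2)), by
      rw [mul_div_cancel₀]
      rw [show (36 : F) = 6 * 6 by norm_num]
      exact neg_ne_zero.2 (mul_ne_zero (mul_ne_zero h6 h6) (pow_ne_zero _ hv))⟩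
  rw [hb] at ha hu h7
  have hc0 : c ≠ 0 := by rintro rfl; apply hc; ring
  obtain ⟨d, rfl⟩ : ∃ d, b = d * c := ⟨b / c, (div_mul_cancel₀ _ hc0).symm⟩
  have hcd : c = d ^ 2 - d := by
    have : 6 ^ 4 * v ^ 4 * c ^ 2 * c = 6 ^ 4 * v ^ 4 * c ^ 2 * (d ^ 2 - d) := by
      linear_combination -h7
    exact mul_left_cancel₀ (mul_ne_zero (mul_ne_zero (pow_ne_zero _ h6) (pow_ne_zero _ hv)) (pow_ne_zero _ hc0)) this
  subst hcd
  have hxx : xv d v = x := by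
    apply mul_left_cancel₀ h3
    unfold xv
    linear_combination -hb
  have hyy : yv d v = y := by
    apply mul_left_cancel₀ h2
    unfold yv
    linear_combination hu
  have hQ : Q = 9 * v ^ 4 * c4v d := by
    have := par_t d v
    rw [hxx, hyy, ht] at this
    apply mul_left_cancel₀ h3
    linear_combination -this
  have hR : R = 27 * v ^ 6 * wv d := by
    have := par_eq d v
    rw [hxx, hyy, ← hQ, he] at this
    apply mul_left_cancel₀ h2
    linear_combination this
  refine ⟨(d, v), ⟨hv, ?_, hQ, hR⟩, hxx, hyy⟩
  intro h0
  apply hD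
  have := cwD d
  dsimp only at h0
  rw [h0] at this
  rw [hQ, hR]
  linear_combination 729 * v ^ 12 * this

lemma par_card [DecidableEq F] [Fintype F] (h2 : (2 : F) ≠ 0) (h3 : (3 : F) ≠ 0) {Q R : F} (hD : Q ^ 3 ≠ R ^ 2) :
    Nat.card {p : F × F // Mcond Q R p} = Nat.card {P : (Wc Q R).Point // (7 : ℕ) • P = 0 ∧ P ≠ 0} := by
  have h1728 : (1728 : F) ≠ 0 := by
    rw [show (1728 : F) = 2 ^ 6 * 3 ^ 3 by norm_num]; exact mul_ne_zero (pow_ne_zero _ h2) (pow_ne_zero _ h3)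
  have hΔ : (Wc Q R).Δ ≠ 0 := by rw [Wc_disc]; exact mul_ne_zero h1728 (sub_ne_zero.2 hD)
  have hns : ∀ p : F × F, Mcond Q R p → (Wc Q R).Nonsingular (xv p.1 p.2) (yv p.1 p.2) := fun p hp => by
    rw [← equation_iff_nonsingular_of_Δ_ne_zero hΔ, Wc_eq]
    have := par_eq p.1 p.2
    rw [← hp.2.2.1, ← hp.2.2.2] at this
    exact this
  refine Nat.card_eq_of_bijective (fun p => ⟨Point.some _ _ (hns p.1 p.2),
    (ord7_iff h2 (hns p.1 p.2)).2 ⟨_, _, par_ord7 h2 h3 p.2⟩, Point.some_ne_zero _⟩) ⟨?_, ?_⟩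
  · rintro ⟨p, hp⟩ ⟨q, hq⟩ h
    simp only [Subtype.mk.injEq, Point.some.injEq] at h
    exact Subtype.ext (par_inj h2 h3 hp hq h.1 h.2)
  · rintro ⟨P, h7, h0⟩
    rcases P with _ | ⟨x, y, h⟩
    · exact absurd rfl h0
    · obtain ⟨t, u, ho⟩ := (ord7_iff h2 h).1 h7
      obtain ⟨p, hp, hx, hy⟩ := par_surj h2 h3 hD ((Wc_eq x y).1 h.1) ho
      refine ⟨⟨p, hp⟩, ?_⟩
      simp only [Subtype.mk.injEq, Point.some.injEq]
      exact ⟨hx, hy⟩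

end
end H7

namespace H7

lemma seven_group (G : Type*) [AddCommGroup G] [Finite G] (h : 7 ∣ Nat.card G) :
    Nat.card {P : G // (7 : ℕ) • P = 0 ∧ P ≠ 0} = 6 ∨ 48 ≤ Nat.card {P : G // (7 : ℕ) • P = 0 ∧ P ≠ 0} := by
  classical
  have : Fintype G := Fintype.ofFinite G
  let H : AddSubgroup G := (nsmulAddMonoidHom (α := G) 7).ker
  have hH : ∀ P : G, P ∈ H ↔ (7 : ℕ) • P = 0 := fun P => by simp [H, AddMonoidHom.mem_ker]
  have : Fact (Nat.Prime 7) := ⟨by norm_num⟩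
  letI : Module (ZMod 7) H := AddCommGroup.zmodModule (n := 7) (fun x => by
    apply Subtype.ext
    simpa using (hH x).1 x.2)
  have hc : Nat.card H = 7 ^ Module.finrank (ZMod 7) H := by
    rw [Module.natCard_eq_pow_finrank (K := ZMod 7), Nat.card_zmod]
  have h1 : Nat.card {P : G // (7 : ℕ) • P = 0 ∧ P ≠ 0} + 1 = Nat.card H := by
    have e1 : Nat.card H = (Finset.univ.filter fun P : G => (7 : ℕ) • P = 0).card := 
      Nat.subtype_card _ (fun P => by simpa using (hH P).symm)
    have e2 : Nat.card {P : G // (7 : ℕ) • P = 0 ∧ P ≠ 0} = ((Finset.univ.filter fun P : G => (7 : ℕ) • P = 0).erase 0).card :=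
      Nat.subtype_card _ (fun P => by simp [and_comm])
    rw [e1, e2, Finset.card_erase_add_one (by simp)]
  obtain ⟨P, hP⟩ := exists_prime_addOrderOf_dvd_card' 7 h
  have hP7 : (7 : ℕ) • P = 0 := by rw [← hP]; exact addOrderOf_nsmul_eq_zero P
  have hP0 : P ≠ 0 := by rintro rfl; simp at hP
  have h2 : 0 < Nat.card {P : G // (7 : ℕ) • P = 0 ∧ P ≠ 0} :=
    Nat.card_pos_iff.2 ⟨⟨⟨P, hP7, hP0⟩⟩, inferInstance⟩
  rw [hc] at h1
  rcases hk : Module.finrank (ZMod 7) H with _ | _ | k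
  · rw [hk] at h1; omega
  · rw [hk] at h1; left; omega
  · rw [hk, pow_add] at h1
    have := Nat.one_le_pow k 7 (by norm_num)
    right
    have : 7 ^ (k + 1 + 1) = 49 * 7 ^ k := by ring
    omega

section
open WeierstrassCurve WeierstrassCurve.Affine
variable {l : ℕ} [Fact l.Prime]

lemma Wc_finite (Q R : ZMod l) : Finite (Wc Q R).Point :=
  haveI : Finite (WithZero {xy : ZMod l × ZMod l // (Wc Q R).Nonsingular xy.1 xy.2}) :=
    inferInstanceAs (Finite (Option {xy : ZMod l × ZMod l // (Wc Q R).Nonsingular xy.1 xy.2}))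
  Finite.of_equiv _ (nonsingularPointEquiv (Wc Q R)).symm

lemma Wc_card (h5 : 5 ≤ l) {Q R : ZMod l} (hD : Q ^ 3 ≠ R ^ 2) (hV : Vc Q R = 0) : Nat.card (Wc Q R).Point = l + 1 := by
  classical
  have h2 := two_ne' h5
  have h3 := three_ne' h5
  have h1728 : (1728 : ZMod l) ≠ 0 := by
    rw [show (1728 : ZMod l) = 2 ^ 6 * 3 ^ 3 by norm_num]; exact mul_ne_zero (pow_ne_zero _ h2) (pow_ne_zero _ h3)
  have hΔ : (Wc Q R).Δ ≠ 0 := by rw [Wc_disc]; exact mul_ne_zero h1728 (sub_ne_zero.2 hD)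
  rw [Nat.card_congr (nonsingularPointEquiv (Wc Q R))]
  have : Nat.card (WithZero {xy : ZMod l × ZMod l // (Wc Q R).Nonsingular xy.1 xy.2}) =
     Nat.card {xy : ZMod l × ZMod l // (Wc Q R).Nonsingular xy.1 xy.2} + 1 := Finite.card_option
  rw [this]
  congr 1
  refine Eq.trans (Nat.subtype_card _ fun p => ?_) (aff_card h5 Q R hV)
  rw [← equation_iff_nonsingular_of_Δ_ne_zero hΔ, Wc_eq]
  simp

lemma M_dich (h5 : 5 ≤ l) (h7 : l % 7 = 6) {Q R : ZMod l} (hD : Q ^ 3 ≠ R ^ 2) (hV : Vc Q R = 0) :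
    Nat.card {p : ZMod l × ZMod l // Mcond Q R p} = 6 ∨ 48 ≤ Nat.card {p : ZMod l × ZMod l // Mcond Q R p} := by
  rw [par_card (two_ne' h5) (three_ne' h5) hD]
  have := Wc_finite Q R
  apply seven_group
  rw [Wc_card h5 hD hV]
  omega

end
end H7

namespace H7

section
variable {l : ℕ} [Fact l.Prime]

open Classical in
/-- fibre over `j₀` -/
noncomputable def Dset (l : ℕ) [Fact l.Prime] (j0 : ZMod l) : Finset (ZMod l) :=
  Finset.univ.filter fun d => Dv d ≠ 0 ∧ c4v d ^ 3 = j0 * Dv d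

lemma mem_Dset {j0 d : ZMod l} : d ∈ Dset l j0 ↔ Dv d ≠ 0 ∧ c4v d ^ 3 = j0 * Dv d := by
  simp [Dset]

lemma Dset_le (j0 : ZMod l) : (Dset l j0).card ≤ 24 := by
  classical
  set P : (ZMod l)[X] := ((X ^ 2 - X + 1) * (X ^ 6 - 11 * X ^ 5 + 30 * X ^ 4 - 15 * X ^ 3 - 10 * X ^ 2 + 5 * X + 1)) ^ 3
    - C j0 * (X ^ 7 * (X - 1) ^ 7 * (X ^ 3 - 8 * X ^ 2 + 5 * X + 1)) with hP
  have hd : P.natDegree ≤ 24 := by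
    rw [hP]; compute_degree
  have h0 : P ≠ 0 := by
    intro h
    have := congrArg (eval 0) h
    simp [hP] at this
  calc (Dset l j0).card ≤ P.roots.toFinset.card := by
        apply Finset.card_le_card
        intro d hd'
        rw [mem_Dset] at hd'
        rw [Multiset.mem_toFinset, mem_roots h0, IsRoot.def]
        have := hd'.2
        unfold c4v Dv at this
        simp [hP]
        linear_combination this
    _ ≤ P.roots.card := Multiset.toFinset_card_le _
    _ ≤ 24 := (card_roots' P).trans hd

lemma Dset_six (h5 : 5 ≤ l) (h7 : l % 7 = 6) {j0 Q0 R0 Q1 R1 : ZMod l}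
    (hD0 : Q0 ^ 3 ≠ R0 ^ 2) (hD1 : Q1 ^ 3 ≠ R1 ^ 2) (hj0 : (j0 - 1728) * Q0 ^ 3 = j0 * R0 ^ 2)
    (hj1 : (j0 - 1728) * Q1 ^ 3 = j0 * R1 ^ 2) (hV0 : Vc Q0 R0 = 0) (hV1 : Vc Q1 R1 = 0)
    (hne : ¬ (Q0 = Q1 ∧ R0 = R1))
    (hq : ∀ d ∈ Dset l j0, ∃ q : ZMod l, q ≠ 0 ∧ ∀ v : ZMod l, ((Q0 = 9 * v ^ 4 * c4v d ∧ R0 = 27 * v ^ 6 * wv d) ∨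
      (Q1 = 9 * v ^ 4 * c4v d ∧ R1 = 27 * v ^ 6 * wv d)) ↔ v = q ∨ v = -q) : (Dset l j0).card = 6 := by
  classical
  have h2 := two_ne' h5
  have h3 := three_ne' h5
  have h1728 : (1728 : ZMod l) ≠ 0 := by
    rw [show (1728 : ZMod l) = 2 ^ 6 * 3 ^ 3 by norm_num]; exact mul_ne_zero (pow_ne_zero _ h2) (pow_ne_zero _ h3)
  have c0 := M_dich h5 h7 hD0 hV0
  have c1 := M_dich h5 h7 hD1 hV1
  have f : ∀ Q R : ZMod l, Nat.card {p : ZMod l × ZMod l // Mcond Q R p} = (Finset.univ.filter fun p : ZMod l × ZMod l => Mcond Q R p).card :=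
    fun Q R => Nat.subtype_card _ (by simp)
  rw [f] at c0 c1
  have hmem : ∀ Q R : ZMod l, (j0 - 1728) * Q ^ 3 = j0 * R ^ 2 → ∀ p, Mcond Q R p → p.1 ∈ Dset l j0 := by
    rintro Q R h ⟨d, v⟩ ⟨hv, hD, hQ, hR⟩
    rw [mem_Dset]
    refine ⟨hD, ?_⟩
    dsimp only at *
    have hc := cwD d
    rw [hQ, hR] at h
    apply mul_left_cancel₀ (mul_ne_zero (mul_ne_zero (pow_ne_zero 6 h3) (pow_ne_zero 12 hv)) h1728)
    linear_combination -h + 3 ^ 6 * v ^ 12 * j0 * hc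
  have hsum : (Finset.univ.filter fun p : ZMod l × ZMod l => Mcond Q0 R0 p).card +
      (Finset.univ.filter fun p : ZMod l × ZMod l => Mcond Q1 R1 p).card = 2 * (Dset l j0).card := by
    rw [← Finset.card_union_of_disjoint, Finset.card_eq_sum_card_fiberwise (f := Prod.fst) (t := Dset l j0), Finset.sum_const_nat (m := 2), mul_comm]
    · intro d hd
      obtain ⟨q, hq0, hq⟩ := hq d hd
      have : (({p ∈ (Finset.univ.filter fun p : ZMod l × ZMod l => Mcond Q0 R0 p) ∪ (Finset.univ.filter fun p : ZMod l × ZMod l => Mcond Q1 R1 p) | p.1 = d} : Finset (ZMod l × ZMod l))) = {(d, q), (d, -q)} := by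
        ext ⟨d', v⟩
        have hv : v = q ∨ v = -q → v ≠ 0 := by rintro (rfl | rfl) <;> simpa using hq0
        have hDd := (mem_Dset.1 hd).1
        simp only [Finset.mem_filter, Finset.mem_union, Finset.mem_univ, true_and, Finset.mem_insert, Finset.mem_singleton, Prod.mk.injEq]
        simp only [Mcond]
        constructor
        · rintro ⟨h, rfl⟩
          have := (hq v).1 (h.imp (fun h => h.2.2) (fun h => h.2.2))
          exact this.imp (fun h => ⟨rfl, h⟩) (fun h => ⟨rfl, h⟩)
        · intro h
          have hdd : d' = d := h.elim And.left And.left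
          subst hdd
          have h' : v = q ∨ v = -q := h.imp And.right And.right
          exact ⟨((hq v).2 h').imp (fun h => ⟨hv h', hDd, h⟩) (fun h => ⟨hv h', hDd, h⟩), rfl⟩
      rw [this, Finset.card_pair]
      intro h
      apply hq0
      have : 2 * q = 0 := by linear_combination (Prod.ext_iff.1 h).2
      exact (mul_eq_zero.1 this).resolve_left h2
    · intro p hp
      simp only [Finset.coe_union, Finset.coe_filter, Finset.mem_univ, true_and, Set.mem_union, Set.mem_setOf_eq] at hp
      rcases hp with hp | hp
      · exact hmem _ _ hj0 p hp
      · exact hmem _ _ hj1 p hp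
    · rw [Finset.disjoint_filter]
      rintro p - ⟨-, -, a, b⟩ ⟨-, -, c, d⟩
      exact hne ⟨a.trans c.symm, b.trans d.symm⟩
  have := Dset_le j0
  omega

lemma sq_pair {g t : ZMod l} (hg : ¬ IsSquare g) (ht : t ≠ 0) : ∃ q : ZMod l, q ≠ 0 ∧ ∀ v, (v ^ 2 = t ∨ v ^ 2 = g * t) ↔ v = q ∨ v = -q := by
  have hg0 : g ≠ 0 := by rintro rfl; exact hg (IsSquare.zero)
  have key : ∀ t t' : ZMod l, t ≠ 0 → IsSquare t → ¬ IsSquare t' → ∃ q : ZMod l, q ≠ 0 ∧ ∀ v, (v ^ 2 = t ∨ v ^ 2 = t') ↔ v = q ∨ v = -q := by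
    rintro t t' ht ⟨q, rfl⟩ h'
    refine ⟨q, left_ne_zero_of_mul ht, fun v => ?_⟩
    rw [← pow_two, sq_eq_sq_iff_eq_or_eq_neg]
    constructor
    · rintro (h | h)
      · exact h
      · exact absurd ⟨v, by rw [← h, pow_two]⟩ h'
    · exact Or.inl
  by_cases h : IsSquare t
  · apply key _ _ ht h
    rintro h'
    apply hg
    have := h'.mul h.inv
    rwa [mul_assoc, mul_inv_cancel₀ ht, mul_one] at this
  · have h' : IsSquare (g * t) := by
      rw [← quadraticChar_one_iff_isSquare (mul_ne_zero hg0 ht), map_mul,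
        quadraticChar_neg_one_iff_not_isSquare.2 h, quadraticChar_neg_one_iff_not_isSquare.2 hg]; norm_num
    obtain ⟨q, h0, hq⟩ := key _ _ (mul_ne_zero hg0 ht) h' h
    exact ⟨q, h0, fun v => by rw [or_comm, hq]⟩

end
end H7

namespace H7

section
variable {l : ℕ} [Fact l.Prime] {n r s : ℕ} (h5 : 5 ≤ l) (hr : r = 0 ∨ r = 1) (hs : s = 0 ∨ s = 1) (hlr : l = 12 * n + 4 * r + 6 * s + 1)

lemma cube_pow (h3 : l % 3 = 2) (x : ZMod l) : (x ^ 3) ^ ((2 * l - 1) / 3) = x := by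
  rw [← pow_mul, show 3 * ((2 * l - 1) / 3) = l + (l - 1) by omega, pow_add, ZMod.pow_card, ← pow_succ',
    show l - 1 + 1 = l by omega, ZMod.pow_card]

lemma cube_inj (h3 : l % 3 = 2) {x y : ZMod l} (h : x ^ 3 = y ^ 3) : x = y := by
  rw [← cube_pow h3 x, h, cube_pow h3]

lemma cube_surj (h3 : l % 3 = 2) (x : ZMod l) : ∃ y, y ^ 3 = x :=
  ⟨x ^ ((2 * l - 1) / 3), by rw [← pow_mul, mul_comm, pow_mul, cube_pow h3]⟩

include h5 hr hs hlr in
lemma Vc_of {j0 Q R : ZMod l} (hj : (gpol (ZMod l) n r s).eval j0 = 0) (hD : Q ^ 3 ≠ R ^ 2) (h : (j0 - 1728) * Q ^ 3 = j0 * R ^ 2) :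
    Vc Q R = 0 := by
  rw [Vc_iff h5 hr hs hlr hD]
  convert hj
  rw [div_eq_iff (sub_ne_zero.2 hD)]
  linear_combination -h

include h5 in
lemma exists_nonsq : ∃ g : ZMod l, ¬ IsSquare g := by
  apply FiniteField.exists_nonsquare
  rw [ZMod.ringChar_zmod_n]; omega

include h5 hr hs hlr in
theorem Dset_card (h7 : l % 7 = 6) {j0 : ZMod l} (hj : (gpol (ZMod l) n r s).eval j0 = 0) : (Dset l j0).card = 6 := by
  have h2 := two_ne' h5
  have h3 := three_ne' h5
  have h1728 : (1728 : ZMod l) ≠ 0 := by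
    rw [show (1728 : ZMod l) = 2 ^ 6 * 3 ^ 3 by norm_num]; exact mul_ne_zero (pow_ne_zero _ h2) (pow_ne_zero _ h3)
  have h9 : (9 : ZMod l) ≠ 0 := by
    rw [show (9 : ZMod l) = 3 ^ 2 by norm_num]; exact pow_ne_zero _ h3
  obtain ⟨g, hg⟩ := exists_nonsq h5
  have hg0 : g ≠ 0 := by rintro rfl; exact hg (IsSquare.zero)
  have hg1 : g ≠ 1 := by rintro rfl; exact hg (IsSquare.one)
  by_cases hj0 : j0 = 0
  · subst hj0
    have hV : Vc (0 : ZMod l) 1 = 0 := Vc_of h5 hr hs hlr hj (by simp) (by simp)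
    have hr1 := Vc_Q0 h5 hr hs hlr one_ne_zero hV
    have hl3 : l % 3 = 2 := by omega
    have hg3 : (0 : ZMod l) ^ 3 ≠ (g ^ 3) ^ 2 := by
      rw [zero_pow (by norm_num)]; exact (pow_ne_zero _ (pow_ne_zero _ hg0)).symm
    refine Dset_six h5 h7 (Q0 := 0) (R0 := 1) (Q1 := 0) (R1 := g ^ 3) (by simp) hg3 (by simp) (by simp) hV
      (Vc_of h5 hr hs hlr hj hg3 (by simp)) ?_ ?_
    · rintro ⟨-, h⟩
      exact hg1 (cube_inj hl3 (by rw [← h, one_pow]))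
    · intro d hd
      rw [mem_Dset, zero_mul, pow_eq_zero_iff (by norm_num)] at hd
      obtain ⟨hD, hc⟩ := hd
      have hw : wv d ≠ 0 := by
        intro h0
        have := cwD d
        rw [hc, h0] at this
        exact mul_ne_zero h1728 hD (by rw [← this]; ring)
      obtain ⟨t, ht⟩ := cube_surj hl3 (1 / (27 * wv d))
      have h27 : (27 * wv d) ≠ 0 := by
        rw [show (27 : ZMod l) = 3 ^ 3 by norm_num]; exact mul_ne_zero (pow_ne_zero _ h3) hw
      have ht' : 27 * t ^ 3 * wv d = 1 := by rw [ht, mul_right_comm, mul_one_div_cancel h27]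
      have ht0 : t ≠ 0 := by rintro rfl; simp at ht'
      obtain ⟨q, hq0, hq⟩ := sq_pair hg ht0
      refine ⟨q, hq0, fun v => ?_⟩
      rw [← hq]
      have key : ∀ e : ZMod l, (0 = 9 * v ^ 4 * c4v d ∧ e ^ 3 = 27 * v ^ 6 * wv d) ↔ v ^ 2 = e * t := by
        intro e
        constructor
        · rintro ⟨-, h⟩
          apply cube_inj hl3
          apply mul_left_cancel₀ h27
          linear_combination -h - e ^ 3 * ht'
        · intro h
          refine ⟨by rw [hc, mul_zero], ?_⟩
          rw [show v ^ 6 = (v ^ 2) ^ 3 by ring, h]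
          linear_combination - e ^ 3 * ht'
      have k1 := key 1
      rw [one_pow, one_mul] at k1
      rw [k1, key g]
  by_cases hj1 : j0 = 1728
  · subst hj1
    have hV : Vc (1 : ZMod l) 0 = 0 := Vc_of h5 hr hs hlr hj (by simp) (by simp)
    have hs1 := Vc_R0 h5 hr hs hlr one_ne_zero hV
    have hl4 : l % 4 = 3 := by omega
    have hneg : ¬ IsSquare (-1 : ZMod l) := by
      rw [ZMod.exists_sq_eq_neg_one_iff]; omega
    have hg3 : (-1 : ZMod l) ^ 3 ≠ 0 ^ 2 := by
      rw [zero_pow (by norm_num)]; exact (pow_ne_zero _ (by simp))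
    refine Dset_six h5 h7 (Q0 := 1) (R0 := 0) (Q1 := -1) (R1 := 0) (by simp) hg3 (by simp) (by simp) hV
      (Vc_of h5 hr hs hlr hj hg3 (by simp)) ?_ ?_
    · rintro ⟨h, -⟩
      apply h2
      linear_combination h
    · intro d hd
      rw [mem_Dset] at hd
      obtain ⟨hD, hc⟩ := hd
      have hw : wv d = 0 := by
        have := cwD d
        have h : wv d ^ 2 = 0 := by linear_combination hc - this
        exact pow_eq_zero_iff (by norm_num) |>.1 h
      have hc0 : c4v d ≠ 0 := by
        intro h
        rw [h] at hc
        exact mul_ne_zero h1728 hD (by rw [← hc]; ring)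
      have h9c := mul_ne_zero h9 hc0
      have sq : ∀ e : ZMod l, e ≠ 0 → ∃ q : ZMod l, q ≠ 0 ∧ (q ^ 2 = e ∨ q ^ 2 = -e) := fun e he => by
        obtain ⟨q, hq0, hq⟩ := sq_pair hneg he
        exact ⟨q, hq0, by simpa using (hq q).2 (Or.inl rfl)⟩
      obtain ⟨e, he, he0⟩ : ∃ e, 9 * c4v d * e = 1 ∧ e ≠ 0 :=
        ⟨(9 * c4v d)⁻¹, mul_inv_cancel₀ h9c, inv_ne_zero h9c⟩
      obtain ⟨q1, hq1, h1⟩ := sq e he0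
      obtain ⟨q, hq, h2⟩ := sq q1 hq1
      have hq4 : q ^ 4 = e ∨ q ^ 4 = -e := by
        have : q ^ 4 = q1 ^ 2 := by rcases h2 with h | h <;> rw [show q ^ 4 = (q ^ 2) ^ 2 by ring, h] <;> ring
        rwa [this]
      refine ⟨q, hq, fun v => ?_⟩
      have k1 : ∀ a : ZMod l, (a = 9 * v ^ 4 * c4v d ∧ 0 = 27 * v ^ 6 * wv d) ↔ v ^ 4 = a * e := fun a => by
        rw [hw, mul_zero]
        simp only [and_true]
        constructor
        · intro h; rw [h]; linear_combination -v ^ 4 * he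
        · intro h; rw [h]; linear_combination -a * he
      rw [k1, k1, one_mul, neg_one_mul]
      have k2 : (v ^ 4 = e ∨ v ^ 4 = -e) ↔ v ^ 4 = q ^ 4 ∨ v ^ 4 = -q ^ 4 := by
        rcases hq4 with h | h <;> rw [h]
        rw [neg_neg, or_comm]
      rw [k2]
      constructor
      · rintro (h | h)
        · have : (v ^ 2) ^ 2 = (q ^ 2) ^ 2 := by linear_combination h
          rcases sq_eq_sq_iff_eq_or_eq_neg.1 this with h | h
          · exact sq_eq_sq_iff_eq_or_eq_neg.1 h
          · exfalso
            apply hneg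
            refine ⟨v / q, ?_⟩
            field_simp
            linear_combination -h
        · exfalso
          apply hneg
          refine ⟨v ^ 2 / q ^ 2, ?_⟩
          field_simp
          linear_combination -h
      · rintro (rfl | rfl)
        · left; rfl
        · left; ring
  · have hj1' : j0 - 1728 ≠ 0 := sub_ne_zero.2 hj1
    obtain ⟨k, hk⟩ : ∃ k, (j0 - 1728) * k = j0 := ⟨j0 / (j0 - 1728), mul_div_cancel₀ _ hj1'⟩
    have hk0 : k ≠ 0 := by rintro rfl; rw [mul_zero] at hk; exact hj0 hk.symm
    have hk1 : k - 1 ≠ 0 := by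
      intro h
      apply h1728
      linear_combination -hk + (j0 - 1728) * h
    have hD : ∀ e : ZMod l, e ≠ 0 → (e ^ 2 * k) ^ 3 ≠ (e ^ 3 * k) ^ 2 := fun e he h => by
      have : e ^ 6 * k ^ 2 * (k - 1) = 0 := by linear_combination h
      exact mul_ne_zero (mul_ne_zero (pow_ne_zero _ he) (pow_ne_zero _ hk0)) hk1 this
    have hJ : ∀ e : ZMod l, (j0 - 1728) * (e ^ 2 * k) ^ 3 = j0 * (e ^ 3 * k) ^ 2 := fun e => by
      linear_combination e ^ 6 * k ^ 2 * hk
    refine Dset_six h5 h7 (hD 1 one_ne_zero) (hD g hg0) (hJ 1) (hJ g) (Vc_of h5 hr hs hlr hj (hD 1 one_ne_zero) (hJ 1))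
      (Vc_of h5 hr hs hlr hj (hD g hg0) (hJ g)) ?_ ?_
    · rintro ⟨ha, hb⟩
      have ha' := mul_right_cancel₀ hk0 ha
      have hb' := mul_right_cancel₀ hk0 hb
      apply hg1
      linear_combination -hb' + g * ha'
    · intro d hd
      rw [mem_Dset] at hd
      obtain ⟨hDd, hc⟩ := hd
      have hcw := cwD d
      have hw2 : wv d ^ 2 = (j0 - 1728) * Dv d := by linear_combination hc - hcw
      have hc0 : c4v d ≠ 0 := by
        intro h
        rw [h] at hc
        exact mul_ne_zero hj0 hDd (by rw [← hc]; ring)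
      have hw0 : wv d ≠ 0 := by
        intro h
        rw [h] at hw2
        exact mul_ne_zero hj1' hDd (by rw [← hw2]; ring)
      obtain ⟨t, ht⟩ : ∃ t, 3 * wv d * t = c4v d := ⟨c4v d / (3 * wv d), mul_div_cancel₀ _ (mul_ne_zero h3 hw0)⟩
      have ht0 : t ≠ 0 := by rintro rfl; rw [mul_zero] at ht; exact hc0 ht.symm
      have hkw : k * wv d ^ 2 = c4v d ^ 3 := by
        rw [hw2, hc]; linear_combination Dv d * hk
      have e1 : k = 9 * t ^ 2 * c4v d := by
        apply mul_right_cancel₀ (pow_ne_zero 2 hw0)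
        rw [hkw]
        linear_combination -c4v d * (3 * wv d * t + c4v d) * ht
      have e2 : k = 27 * t ^ 3 * wv d := by
        rw [e1]; linear_combination -9 * t ^ 2 * ht
      obtain ⟨q, hq0, hq⟩ := sq_pair hg ht0
      refine ⟨q, hq0, fun v => ?_⟩
      rw [← hq]
      have key : ∀ e : ZMod l, e ≠ 0 → ((e ^ 2 * k = 9 * v ^ 4 * c4v d ∧ e ^ 3 * k = 27 * v ^ 6 * wv d) ↔ v ^ 2 = e * t) := by
        intro e he
        constructor
        · rintro ⟨ha, hb⟩
          apply mul_left_cancel₀ (mul_ne_zero (pow_ne_zero 2 he) hk0)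
          linear_combination v ^ 2 * ha + 3 * v ^ 4 * v ^ 2 * ht * (-3) - t * hb + 0
        · intro h
          refine ⟨?_, ?_⟩
          · rw [show v ^ 4 = (v ^ 2) ^ 2 by ring, h]; linear_combination e ^ 2 * e1
          · rw [show v ^ 6 = (v ^ 2) ^ 3 by ring, h]; linear_combination e ^ 3 * e2
      have k1 := key 1 one_ne_zero
      rw [one_mul t] at k1
      rw [k1, key g hg0]

end
end H7

namespace H7

section
variable {l : ℕ} [Fact l.Prime]

lemma leg_neg_three (h5 : 5 ≤ l) : legendreSym l (-3) = if l % 3 = 1 then 1 else -1 := by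
  have hl : l.Prime := Fact.out
  have hodd : l % 2 = 1 := hl.eq_two_or_odd.resolve_left (by omega)
  have hl3 : l % 3 ≠ 0 := fun h => by
    have := (Nat.prime_dvd_prime_iff_eq Nat.prime_three hl).1 (Nat.dvd_of_mod_eq_zero h)
    omega
  have hJ : jacobiSym (l : ℤ) 3 = if l % 3 = 1 then 1 else -1 := by
    rw [jacobiSym.mod_left]
    rcases (by omega : l % 3 = 1 ∨ l % 3 = 2) with h | h
    · rw [show ((l : ℤ) % (3 : ℕ)) = 1 by omega, h]; norm_num
    · rw [show ((l : ℤ) % (3 : ℕ)) = 2 by omega, h]; norm_num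
  rw [← hJ, show (-3 : ℤ) = -1 * ((3 : ℕ) : ℤ) by norm_num, legendreSym.mul, legendreSym.at_neg_one (by omega),
    jacobiSym.legendreSym.to_jacobiSym l ((3 : ℕ) : ℤ)]
  rcases (by omega : l % 4 = 1 ∨ l % 4 = 3) with h | h
  · rw [ZMod.χ₄_nat_one_mod_four h, jacobiSym.quadratic_reciprocity_one_mod_four' (by decide) h, one_mul]
  · rw [ZMod.χ₄_nat_three_mod_four h, jacobiSym.quadratic_reciprocity_three_mod_four (by norm_num) h]; ring

lemma leg_neg_four (h5 : 5 ≤ l) : legendreSym l (-4) = if l % 4 = 1 then 1 else -1 := by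
  have hl : l.Prime := Fact.out
  have hodd : l % 2 = 1 := hl.eq_two_or_odd.resolve_left (by omega)
  rw [show (-4 : ℤ) = -1 * 2 ^ 2 by norm_num, legendreSym.mul, legendreSym.at_neg_one (by omega),
    legendreSym.sq_one' (p := l) (a := 2) (by simpa using two_ne' h5), mul_one]
  rcases (by omega : l % 4 = 1 ∨ l % 4 = 3) with h | h
  · rw [ZMod.χ₄_nat_one_mod_four h, h]; rfl
  · rw [ZMod.χ₄_nat_three_mod_four h, h]; rfl

lemma rs_facts (h5 : 5 ≤ l) {r s : ℕ} (hr : r = ((1 - legendreSym l (-3)) / 2).toNat) (hs : s = ((1 - legendreSym l (-4)) / 2).toNat) :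
    (r = 0 ∨ r = 1) ∧ (s = 0 ∨ s = 1) ∧ l = 12 * (l / 12) + 4 * r + 6 * s + 1 := by
  have hl : l.Prime := Fact.out
  have hodd : l % 2 = 1 := hl.eq_two_or_odd.resolve_left (by omega)
  have hl3 : l % 3 ≠ 0 := fun h => by
    have := (Nat.prime_dvd_prime_iff_eq Nat.prime_three hl).1 (Nat.dvd_of_mod_eq_zero h)
    omega
  rw [leg_neg_three h5] at hr
  rw [leg_neg_four h5] at hs
  split_ifs at hr hs <;> simp at hr hs <;> subst hr hs <;> refine ⟨by simp, by simp, by omega⟩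

lemma cusp_ne (hl7 : l ≠ 7) {x : ZMod l} (h : Dv x = 0) : c4v x ≠ 0 := by
  have h7 : (49 : ZMod l) ≠ 0 := by
    intro h
    have h' : ((49 : ℕ) : ZMod l) = 0 := by exact_mod_cast h
    rw [ZMod.natCast_eq_zero_iff] at h'
    have hl : l.Prime := Fact.out
    rw [show 49 = 7 ^ 2 by norm_num] at h'
    exact hl7 ((Nat.prime_dvd_prime_iff_eq hl (by norm_num)).1 (hl.dvd_of_dvd_pow h'))
  unfold Dv at h
  rw [mul_eq_zero, mul_eq_zero, pow_eq_zero_iff (by norm_num), pow_eq_zero_iff (by norm_num)] at h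
  rcases h with (h | h) | h
  · subst h; simp [c4v]
  · obtain rfl : x = 1 := sub_eq_zero.1 h
    unfold c4v
    rw [show ((1 : ZMod l) ^ 2 - 1 + 1) * (1 ^ 6 - 11 * 1 ^ 5 + 30 * 1 ^ 4 - 15 * 1 ^ 3 - 10 * 1 ^ 2 + 5 * 1 + 1) = 1 by ring]
    exact one_ne_zero
  · intro hc
    apply h7
    unfold c4v at hc
    linear_combination (1710 + 3005 * x - 444 * x ^ 2) * hc +
      (-1661 - 1540 * x + 6776 * x ^ 2 - 693 * x ^ 3 - 6853 * x ^ 4 + 12530 * x ^ 5 - 4781 * x ^ 6 + 444 * x ^ 7) * h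

/-- the value of `Ĥ` -/
noncomputable def Hval (n r s : ℕ) (x : ZMod l) : ZMod l :=
  c4v x ^ r * wv x ^ s * ∑ k ∈ Finset.range (n + 1), (cf n s k : ZMod l) * (wv x ^ 2) ^ k * Dv x ^ (n - k)

lemma Hval_cusp (hl7 : l ≠ 7) (n r s : ℕ) {x : ZMod l} (h : Dv x = 0) : Hval n r s x ≠ 0 := by
  have hc := cusp_ne hl7 h
  have hw : wv x ≠ 0 := by
    intro h0
    have := cwD x
    rw [h, h0] at this
    apply pow_ne_zero 3 hc
    linear_combination this
  unfold Hval
  rw [Finset.sum_range_succ, Finset.sum_eq_zero, cf_self, h]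
  · simp [hc, hw]
  · intro k hk
    rw [h, zero_pow (by have := Finset.mem_range.1 hk; omega), mul_zero]

lemma Hval_iff (n : ℕ) {r s : ℕ} (hr : r = 0 ∨ r = 1) (hs : s = 0 ∨ s = 1) {x : ZMod l} (h : Dv x ≠ 0) :
    Hval n r s x = 0 ↔ (gpol (ZMod l) n r s).eval (c4v x ^ 3 / Dv x) = 0 := by
  have hj : c4v x ^ 3 / Dv x - 1728 = wv x ^ 2 / Dv x := by
    field_simp
    linear_combination cwD x
  have hsum : ∑ k ∈ Finset.range (n + 1), (cf n s k : ZMod l) * (wv x ^ 2) ^ k * Dv x ^ (n - k) =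
      Dv x ^ n * ∑ k ∈ Finset.range (n + 1), (cf n s k : ZMod l) * (wv x ^ 2 / Dv x) ^ k := by
    rw [Finset.mul_sum]
    refine Finset.sum_congr rfl fun k hk => ?_
    have hk' : k ≤ n := by have := Finset.mem_range.1 hk; omega
    rw [div_pow, show Dv x ^ n = Dv x ^ (n - k) * Dv x ^ k by rw [← pow_add, Nat.sub_add_cancel hk']]
    field_simp
  unfold Hval gpol
  simp only [eval_mul, eval_pow, eval_X, eval_sub, eval_C, eval_finset_sum, hj, hsum]
  rcases hr with rfl | rfl <;> rcases hs with rfl | rfl <;> simp [h]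

end
end H7

namespace H7

lemma hasse_eval (l : ℕ) [Fact (Nat.Prime l)] (x : ZMod l) : (hasseH7 l).eval x =
    Hval (l / 12) ((1 - legendreSym l (-3)) / 2).toNat ((1 - legendreSym l (-4)) / 2).toNat x := by
  unfold hasseH7 Hval
  simp only [eval_mul, eval_pow, eval_add, eval_sub, eval_X, eval_one, eval_ofNat, eval_C, eval_finset_sum]
  rw [← mul_pow]
  refine congrArg₂ (· * ·) rfl (Finset.sum_congr rfl fun k _ => ?_)
  have hw : wv x ^ 2 = (x ^ 2 - x + 1) ^ 3 * (x ^ 6 - 11 * x ^ 5 + 30 * x ^ 4 - 15 * x ^ 3 - 10 * x ^ 2 + 5 * x + 1) ^ 3 -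
      1728 * (x ^ 7 * (x - 1) ^ 7 * (x ^ 3 - 8 * x ^ 2 + 5 * x + 1)) := by
    have := cwD x
    unfold c4v Dv at this
    linear_combination -this
  rw [hw]
  simp only [cf, Dv]
  push_cast
  rfl

open Classical in
lemma root_card (l : ℕ) [Fact (Nat.Prime l)] (h5 : 5 ≤ l) (hl7 : l ≠ 7) (h7 : l % 7 = 6) :
    (hasseH7 l).roots.toFinset.card = 3 * (Hset l).ncard := by
  obtain ⟨hr, hs, hlr⟩ := rs_facts (l := l) h5 rfl rfl
  have hev := hasse_eval l
  set r := ((1 - legendreSym l (-3)) / 2).toNat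
  set s := ((1 - legendreSym l (-4)) / 2).toNat
  have h0 : hasseH7 l ≠ 0 := by
    intro h
    have := hev 0
    rw [h, eval_zero] at this
    exact Hval_cusp hl7 _ _ _ (by simp [Dv]) this.symm
  have hcard : (hasseH7 l).roots.toFinset.card = ∑ j ∈ Finset.univ.filter (fun j : ZMod l => (gpol (ZMod l) (l / 12) r s).eval j = 0), 6 := by
    rw [Finset.card_eq_sum_card_fiberwise (f := fun x => c4v x ^ 3 / Dv x)
      (t := Finset.univ.filter (fun j : ZMod l => (gpol (ZMod l) (l / 12) r s).eval j = 0))]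
    · refine Finset.sum_congr rfl fun j hj => ?_
      have hj' := (Finset.mem_filter.1 hj).2
      rw [← Dset_card h5 hr hs hlr h7 hj']
      congr 1
      ext x
      rw [mem_Dset, Finset.mem_filter, Multiset.mem_toFinset, mem_roots h0, IsRoot.def, hev]
      constructor
      · rintro ⟨hx, hx'⟩
        have hD : Dv x ≠ 0 := fun h => Hval_cusp hl7 _ _ _ h hx
        exact ⟨hD, by rw [← hx', div_mul_cancel₀ _ hD]⟩
      · rintro ⟨hD, hx⟩
        have e : c4v x ^ 3 / Dv x = j := by rw [hx, mul_div_cancel_right₀ _ hD]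
        exact ⟨by rw [Hval_iff _ hr hs hD, e, hj'], e⟩
    · intro x hx
      have hx' := Multiset.mem_toFinset.1 hx
      rw [mem_roots h0, IsRoot.def, hev] at hx'
      have hD : Dv x ≠ 0 := fun h => Hval_cusp hl7 _ _ _ h hx'
      rw [Hval_iff _ hr hs hD] at hx'
      exact Finset.mem_coe.2 (Finset.mem_filter.2 ⟨Finset.mem_univ _, hx'⟩)
  rw [hcard, Finset.sum_const, smul_eq_mul, ← ss_count l (l / 12) r s h5 hr hs hlr]
  ring

end H7

/-- Theorem A(a): for a prime `l ≡ 6 (mod 7)`, `l ∉ {2,3,7}`, the number of distinct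
roots of `Ĥ_{7,l}` in `𝔽_l` (i.e. the number of its distinct monic linear factors)
is `3·h(-l)` if `l ≡ 1 (mod 4)` and `3·(3 - (2|l))·h(-l)` if `l ≡ 3 (mod 4)`,
where `h(-l)` is the class number of `ℚ(√-l)`. -/
theorem hasseH7_linear_factor_count (l : ℕ) [Fact (Nat.Prime l)]
    (hl2 : l ≠ 2) (hl3 : l ≠ 3) (hl7 : l ≠ 7) (hmod7 : l % 7 = 6)
    (K : Type) [Field K] [NumberField K]
    (hdeg : Module.finrank ℚ K = 2) (α : K) (hα : α ^ 2 = -(l : K)) :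
    ((hasseH7 l).roots.toFinset.card : ℤ) =
      if l % 4 = 1 then 3 * (NumberField.classNumber K : ℤ)
      else 3 * (3 - legendreSym l 2) * (NumberField.classNumber K : ℤ) := by
  have h5 : 5 ≤ l := by omega
  have e := H7.root_card l h5 hl7 hmod7
  have h := H7.Hset_card hdeg h5 α hα
  have e' : (hasseH7 l).roots.toFinset.card = 3 * (H7.Hset l).ncard := by
    convert e
  rw [e']
  push_cast
  rw [h]
  split_ifs <;> ring
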